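/- The complex dimensions of the spaces S₁(Γ₁(N); ℂ) of weight 1 cusp forms are as follows: dimension 1 for N = 31, N = 39, N = 44, N = 55, N = 56, and N = 59; and dimension 2 for N = 47, N = 52, and N = 57. -/

import Mathlib

namespace WeightOne

open UpperHalfPlane hiding I
open Complex Filter Topology ModularForm CongruenceSubgroup MatrixGroups Manifold
open scoped Real

/-! ### Leading exponents at `i∞` -/

/-- `F τ ~ β * exp (2 π i s τ)` as `Im τ → ∞`; for `β = 0` this only says that `F` is of smaller
order than the exponential. -/
def HasLead (F : ℍ → ℂ) (s : ℝ) (β : ℂ) : Prop :=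
  Tendsto (fun τ : ℍ ↦ F τ * cexp (-(2 * π * I * s * τ))) atImInfty (𝓝 β)

lemma tendsto_cexp_atImInfty {s : ℝ} (hs : 0 < s) :
    Tendsto (fun τ : ℍ ↦ cexp (2 * π * I * s * τ)) atImInfty (𝓝 0) := by
  rw [tendsto_zero_iff_norm_tendsto_zero]
  have h : ∀ τ : ℍ, ‖cexp (2 * π * I * s * τ)‖ = Real.exp (-(2 * π * s * τ.im)) := by
    intro τ
    rw [norm_exp]
    congr 1
    simp
  simp_rw [h]
  refine Real.tendsto_exp_neg_atTop_nhds_zero.comp ?_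
  exact Tendsto.const_mul_atTop (by positivity) tendsto_comap

lemma HasLead.unique {F : ℍ → ℂ} {s : ℝ} {β β' : ℂ} (h : HasLead F s β) (h' : HasLead F s β') :
    β = β' :=
  tendsto_nhds_unique h h'

lemma HasLead.of_lt {F : ℍ → ℂ} {s s' : ℝ} {β : ℂ} (h : HasLead F s β) (hs : s' < s) :
    HasLead F s' 0 := by
  have := Tendsto.mul h (tendsto_cexp_atImInfty (sub_pos.mpr hs))
  rw [mul_zero] at this
  refine this.congr fun τ ↦ ?_
  rw [mul_assoc, ← Complex.exp_add]
  congr 2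
  push_cast
  ring

lemma HasLead.mul {F G : ℍ → ℂ} {s t : ℝ} {β δ : ℂ} (hF : HasLead F s β) (hG : HasLead G t δ) :
    HasLead (F * G) (s + t) (β * δ) := by
  refine (Tendsto.mul hF hG).congr fun τ ↦ ?_
  rw [Pi.mul_apply, mul_mul_mul_comm, ← Complex.exp_add]
  congr 2
  push_cast
  ring

lemma HasLead.const_mul {F : ℍ → ℂ} {s : ℝ} {β : ℂ} (hF : HasLead F s β) (a : ℂ) :
    HasLead (fun τ ↦ a * F τ) s (a * β) := by
  refine (Tendsto.const_mul a hF).congr fun τ ↦ ?_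
  ring

lemma HasLead.neg {F : ℍ → ℂ} {s : ℝ} {β : ℂ} (hF : HasLead F s β) : HasLead (-F) s (-β) := by
  refine (Tendsto.neg hF).congr fun τ ↦ ?_
  simp

lemma HasLead.add {F G : ℍ → ℂ} {s : ℝ} {β δ : ℂ} (hF : HasLead F s β) (hG : HasLead G s δ) :
    HasLead (F + G) s (β + δ) := by
  refine (Tendsto.add hF hG).congr fun τ ↦ ?_
  rw [Pi.add_apply, add_mul]

lemma HasLead.sub {F G : ℍ → ℂ} {s : ℝ} {β δ : ℂ} (hF : HasLead F s β) (hG : HasLead G s δ) :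
    HasLead (F - G) s (β - δ) := by
  refine (Tendsto.sub hF hG).congr fun τ ↦ ?_
  rw [Pi.sub_apply, sub_mul]

lemma hasLead_one : HasLead 1 0 1 := by
  simp only [HasLead, Pi.one_apply, ofReal_zero, mul_zero, zero_mul, neg_zero, Complex.exp_zero,
    mul_one]
  exact tendsto_const_nhds

lemma hasLead_zero_iff {F : ℍ → ℂ} {β : ℂ} : HasLead F 0 β ↔ Tendsto F atImInfty (𝓝 β) := by
  simp [HasLead]

lemma HasLead.zpow {F : ℍ → ℂ} {s : ℝ} {β : ℂ} (hF : HasLead F s β) (hβ : β ≠ 0) (n : ℤ) :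
    HasLead (fun τ ↦ F τ ^ n) (n * s) (β ^ n) := by
  refine (Tendsto.zpow₀ hF n (Or.inl hβ)).congr fun τ ↦ ?_
  rw [mul_zpow, ← Complex.exp_int_mul]
  congr 2
  push_cast
  ring

lemma HasLead.pow {F : ℍ → ℂ} {s : ℝ} {β : ℂ} (hF : HasLead F s β) (n : ℕ) :
    HasLead (F ^ n) (n * s) (β ^ n) := by
  refine (Tendsto.pow hF n).congr fun τ ↦ ?_
  rw [mul_pow, ← Complex.exp_nat_mul, Pi.pow_apply]
  congr 2
  push_cast
  ring

lemma HasLead.comp_vadd {F G : ℍ → ℂ} {s : ℝ} {β : ℂ} (hF : HasLead F s β) (x : ℝ)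
    (hG : ∀ τ, G τ = F (x +ᵥ τ)) : HasLead G s (cexp (2 * π * I * s * x) * β) := by
  have ht : Tendsto (fun τ : ℍ ↦ x +ᵥ τ) atImInfty atImInfty := by
    rw [atImInfty, tendsto_comap_iff]
    refine tendsto_comap.congr fun τ ↦ ?_
    simp
  refine ((Tendsto.comp hF ht).const_mul (cexp (2 * π * I * s * x))).congr fun τ ↦ ?_
  simp only [Function.comp_apply, hG, coe_vadd]
  rw [mul_left_comm, ← Complex.exp_add]
  congr 2
  ring

/-! ### Theta functions with characteristics -/

lemma tsum_gaussian_shift {t : ℂ} (ht : 0 < t.re) (α κ : ℝ) :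
    ∑' n : ℤ, cexp (-π * t * (n + α) ^ 2 + 2 * π * I * κ * (n + α)) =
      1 / t ^ (1 / 2 : ℂ) * ∑' n : ℤ, cexp (-π * (n - κ) ^ 2 / t + 2 * π * I * α * n) := by
  have ht0 : t ≠ 0 := fun h ↦ by simp [h] at ht
  have key := Complex.tsum_exp_neg_quadratic ht (-t * α + I * κ)
  have h1 : ∀ n : ℤ, cexp (-π * t * (n + α) ^ 2 + 2 * π * I * κ * (n + α)) =
      cexp (-π * t * α ^ 2 + 2 * π * I * κ * α) *
        cexp (-π * t * n ^ 2 + 2 * π * (-t * α + I * κ) * n) := by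
    intro n
    rw [← Complex.exp_add]
    congr 1
    ring
  have h2 : ∀ n : ℤ, cexp (-π * (n - κ) ^ 2 / t + 2 * π * I * α * n) =
      cexp (-π * t * α ^ 2 + 2 * π * I * κ * α) *
        cexp (-π / t * (n + I * (-t * α + I * κ)) ^ 2) := by
    intro n
    rw [← Complex.exp_add]
    congr 1
    field_simp
    ring_nf
    simp only [I_sq, show I ^ 3 = -I by rw [pow_succ, I_sq]; ring, show I ^ 4 = 1 by simp]
    ring
  simp_rw [h1, h2, tsum_mul_left, key]
  ring

/-- The theta function with real characteristics. -/
noncomputable def theta (α β : ℝ) (τ : ℂ) : ℂ :=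
  ∑' n : ℤ, cexp (π * I * (n + α) ^ 2 * τ + 2 * π * I * (n + α) * β)

lemma theta_eq_jacobi (α β : ℝ) (τ : ℂ) :
    theta α β τ =
      cexp (π * I * α ^ 2 * τ + 2 * π * I * α * β) * jacobiTheta₂ (β + α * τ) τ := by
  rw [theta, jacobiTheta₂, ← tsum_mul_left]
  refine tsum_congr fun n ↦ ?_
  rw [jacobiTheta₂_term, ← Complex.exp_add]
  congr 1
  ring

lemma differentiableAt_theta (α β : ℝ) {τ : ℂ} (hτ : 0 < τ.im) :
    DifferentiableAt ℂ (theta α β) τ := by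
  have : theta α β = fun τ ↦
      cexp (π * I * α ^ 2 * τ + 2 * π * I * α * β) * jacobiTheta₂ (β + α * τ) τ :=
    funext fun τ ↦ theta_eq_jacobi α β τ
  rw [this]
  refine DifferentiableAt.mul (by fun_prop) ?_
  have h := (hasFDerivAt_jacobiTheta₂ (β + α * τ) hτ).differentiableAt
  have h2 : DifferentiableAt ℂ (fun τ : ℂ ↦ ((β + α * τ : ℂ), τ)) τ := by fun_prop
  exact DifferentiableAt.comp τ (f := fun τ : ℂ ↦ ((β + α * τ : ℂ), τ))
    (g := fun p : ℂ × ℂ ↦ jacobiTheta₂ p.1 p.2) h h2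

lemma theta_vadd_one (α β : ℝ) (τ : ℂ) :
    theta α β (τ + 1) = cexp (-(π * I * (α ^ 2 + α))) * theta α (β + α + 1 / 2) τ := by
  rw [theta, theta, ← tsum_mul_left]
  refine tsum_congr fun n ↦ ?_
  rw [← Complex.exp_add]
  obtain ⟨k, hk⟩ : Even (n * (n + 1)) := Int.even_mul_succ_self n
  have hk' : (n : ℂ) * (n + 1) = k + k := by exact_mod_cast hk
  rw [Complex.exp_eq_exp_iff_exists_int]
  refine ⟨k - n, ?_⟩
  push_cast
  linear_combination (π * I) * hk'

lemma theta_add_int (α β : ℝ) (m n : ℤ) (τ : ℂ) :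
    theta (α + m) (β + n) τ = cexp (2 * π * I * n * α) * theta α β τ := by
  rw [theta, theta, ← tsum_mul_left, ← (Equiv.subRight m).tsum_eq]
  refine tsum_congr fun k ↦ ?_
  rw [← Complex.exp_add, Complex.exp_eq_exp_iff_exists_int]
  refine ⟨(k - m) * n + m * n, ?_⟩
  simp only [Equiv.subRight_apply]
  push_cast
  ring

lemma theta_neg_inv (α β : ℝ) {τ : ℂ} (hτ : 0 < τ.im) :
    theta α β (-τ⁻¹) =
      (-I * τ) ^ (1 / 2 : ℂ) * cexp (2 * π * I * α * β) * theta β (-α) τ := by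
  have h0 : τ ≠ 0 := fun h ↦ by simp [h] at hτ
  have hre : 0 < (-I * τ).re := by simpa using hτ
  have key := tsum_gaussian_shift hre β (-α)
  have e1 : theta β (-α) τ =
      ∑' n : ℤ, cexp (-π * (-I * τ) * (n + β) ^ 2 + 2 * π * I * (-α : ℝ) * (n + β)) := by
    refine tsum_congr fun n ↦ ?_
    congr 1
    push_cast
    ring
  have e2 : theta α β (-τ⁻¹) = cexp (2 * π * I * α * β) *
      ∑' n : ℤ, cexp (-π * (n - (-α : ℝ)) ^ 2 / (-I * τ) + 2 * π * I * β * n) := by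
    rw [theta, ← tsum_mul_left]
    refine tsum_congr fun n ↦ ?_
    rw [← Complex.exp_add]
    congr 1
    have : (-I * τ)⁻¹ = I * τ⁻¹ := by rw [mul_inv, inv_neg, inv_I, neg_neg]
    rw [div_eq_mul_inv, this]
    push_cast
    ring
  have hne : (-I * τ) ^ (1 / 2 : ℂ) ≠ 0 := by
    simp [Complex.cpow_eq_zero_iff, h0]
  rw [e1, key, e2]
  generalize ∑' n : ℤ, cexp (-π * (n - (-α : ℝ)) ^ 2 / (-I * τ) + 2 * π * I * β * n) = S
  field_simp

lemma summable_theta_bound (α : ℝ) :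
    Summable fun n : ℤ ↦ Real.exp (-(π * (n + α) ^ 2)) := by
  have h := ((summable_jacobiTheta₂_term_iff (α * I) I).mpr (by simp)).norm.mul_left
    (Real.exp (-(π * α ^ 2)))
  refine h.congr fun n ↦ ?_
  rw [norm_jacobiTheta₂_term, ← Real.exp_add]
  congr 1
  simp
  ring

/-- If `μ ^ 2` is the minimum of `(n + α) ^ 2`, the leading exponent of `theta α β` is
`μ ^ 2 / 2`. -/
lemma hasLead_theta (α β μ : ℝ) (hμ : ∀ n : ℤ, μ ^ 2 ≤ (n + α) ^ 2) :
    HasLead (fun τ ↦ theta α β τ) (μ ^ 2 / 2)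
      (∑' n : ℤ, if (n + α) ^ 2 = μ ^ 2 then cexp (2 * π * I * (n + α) * β) else 0) := by
  have hterm : ∀ (τ : ℍ), theta α β τ * cexp (-(2 * π * I * (μ ^ 2 / 2 : ℝ) * τ)) =
      ∑' n : ℤ, cexp (2 * π * I * (n + α) * β) *
        cexp (2 * π * I * (((n + α) ^ 2 - μ ^ 2) / 2 : ℝ) * τ) := by
    intro τ
    rw [theta, ← tsum_mul_right]
    refine tsum_congr fun n ↦ ?_
    rw [← Complex.exp_add, ← Complex.exp_add]
    congr 1
    push_cast
    ring
  refine Tendsto.congr (fun τ ↦ (hterm τ).symm) ?_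
  have hnorm : ∀ n : ℤ, ‖cexp (2 * π * I * (n + α) * β)‖ = 1 := by
    intro n
    have : 2 * π * I * (n + α) * β = ((2 * π * (n + α) * β : ℝ) : ℂ) * I := by
      push_cast
      ring
    rw [this, norm_exp_ofReal_mul_I]
  refine tendsto_tsum_of_dominated_convergence
    ((summable_theta_bound α).mul_left (Real.exp (π * μ ^ 2))) (fun n ↦ ?_) ?_
  · split_ifs with h
    · simp only [h, sub_self, zero_div, ofReal_zero, mul_zero, zero_mul, Complex.exp_zero, mul_one]
      exact tendsto_const_nhds
    · have : 0 < ((n + α) ^ 2 - μ ^ 2) / 2 := by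
        have := lt_of_le_of_ne (hμ n) (Ne.symm h)
        linarith
      simpa using (tendsto_cexp_atImInfty this).const_mul (cexp (2 * π * I * (n + α) * β))
  · have : ∀ᶠ τ : ℍ in atImInfty, 1 ≤ τ.im := tendsto_comap.eventually_ge_atTop 1
    filter_upwards [this] with τ hτ n
    rw [norm_mul, hnorm, one_mul, norm_exp, ← Real.exp_add]
    refine Real.exp_le_exp.mpr ?_
    have h : (2 * π * I * (((n + α) ^ 2 - μ ^ 2) / 2 : ℝ) * τ).re =
        -(π * ((n + α) ^ 2 - μ ^ 2) * τ.im) := by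
      have : 2 * π * I * (((n + α) ^ 2 - μ ^ 2) / 2 : ℝ) * τ =
        ((π * ((n + α) ^ 2 - μ ^ 2) : ℝ) : ℂ) * (I * τ) := by
        push_cast
        ring
      rw [this, re_ofReal_mul]
      simp
    rw [h]
    have := mul_le_mul_of_nonneg_left hτ
      (mul_nonneg Real.pi_pos.le (sub_nonneg.mpr (hμ n)))
    linarith

/-! ### Klein forms -/

lemma sqrt_div_sqrt_I (τ : ℍ) : sqrt (τ : ℂ) / sqrt I = (-I * τ) ^ (1 / 2 : ℂ) := by
  have h0 : (τ : ℂ) ≠ 0 := τ.ne_zero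
  have h1 : -I * (τ : ℂ) ≠ 0 := by simp [h0]
  have hlog : log (-I * τ) = log τ - log I := by
    have : -I * (τ : ℂ) = cexp (log τ - log I) := by
      rw [Complex.exp_sub, exp_log h0, exp_log I_ne_zero, div_I]
      ring
    rw [this, log_exp]
    · have := arg_mem_Ioc (τ : ℂ)
      have h2 := arg_nonneg_iff.mpr τ.im_pos.le
      simp only [sub_im, log_im, log_I, mul_im, Complex.I_im, Complex.I_re]
      norm_num
      linarith [Real.pi_pos]
    · have := arg_le_pi (τ : ℂ)
      simp only [sub_im, log_im, log_I, mul_im, Complex.I_im, Complex.I_re]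
      norm_num
      linarith [Real.pi_pos]
  rw [sqrt_eq_exp h0, sqrt_eq_exp I_ne_zero, ← Complex.exp_sub, cpow_def_of_ne_zero h1, hlog]
  congr 1
  ring

lemma eta_neg_inv (τ : ℍ) : η (-(τ : ℂ)⁻¹) = (-I * τ) ^ (1 / 2 : ℂ) * η τ := by
  have := eta_comp_eq_csqrt_I_inv τ.2
  simp only [Function.comp_apply, Pi.smul_apply, Pi.mul_apply, smul_eq_mul] at this
  rw [← sqrt_div_sqrt_I, show -(τ : ℂ)⁻¹ = -1 / τ by ring]
  rw [show (τ : ℂ) = τ.1 from rfl, this]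
  ring

lemma eta_add_one (τ : ℂ) : η (τ + 1) = cexp (2 * π * I / 24) * η τ := by
  have h : ∀ n, eta_q n (τ + 1) = eta_q n τ := by
    intro n
    rw [eta_q_eq_pow, eta_q_eq_pow, mul_add, mul_one, Complex.exp_add, exp_two_pi_mul_I, mul_one]
  simp only [ModularForm.eta, h, Function.Periodic.qParam]
  rw [← mul_assoc, ← Complex.exp_add]
  congr 2
  push_cast
  ring

/-- The Klein form with characteristic `(x, y)`, a function of weight `-1`. -/
noncomputable def klein (x y : ℝ) (τ : ℍ) : ℂ :=
  cexp (-(π * I * x * (y + 1))) * theta (x + 1 / 2) (y + 1 / 2) τ / η τ ^ 3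

lemma eta_coe_ne_zero (τ : ℍ) : η τ ≠ 0 := eta_ne_zero τ.2

lemma klein_vadd_one (x y : ℝ) (τ : ℍ) : klein x y ((1 : ℝ) +ᵥ τ) = klein x (x + y) τ := by
  have h := theta_vadd_one (x + 1 / 2) (y + 1 / 2) τ
  have h' := theta_add_int (x + 1 / 2) (x + y + 1 / 2) 0 1 τ
  rw [show y + 1 / 2 + (x + 1 / 2) + 1 / 2 = x + y + 1 / 2 + (1 : ℤ) by push_cast; ring,
    show x + 1 / 2 = x + 1 / 2 + (0 : ℤ) by simp, h'] at h
  simp only [Int.cast_zero, add_zero] at h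
  simp only [klein, coe_vadd, ofReal_one]
  rw [add_comm 1 (τ : ℂ), h, eta_add_one, mul_pow, ← Complex.exp_nat_mul]
  have hη := eta_coe_ne_zero τ
  have e : cexp (-(π * I * x * (y + 1))) *
      (cexp (-(π * I * ((x + 1 / 2 : ℝ) ^ 2 + (x + 1 / 2 : ℝ)))) *
      cexp (2 * π * I * (1 : ℤ) * (x + 1 / 2 : ℝ))) =
      cexp ((3 : ℕ) * (2 * π * I / 24)) * cexp (-(π * I * x * ((x + y : ℝ) + 1))) := by
    rw [← Complex.exp_add, ← Complex.exp_add, ← Complex.exp_add]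
    congr 1
    push_cast
    ring
  generalize theta (x + 1 / 2) (x + y + 1 / 2) τ = θ
  rw [div_eq_div_iff (by simp [hη]) (by simp [hη])]
  linear_combination (θ * η τ ^ 3) * e

lemma klein_neg_inv (x y : ℝ) (τ σ : ℍ) (hσ : (σ : ℂ) = -(τ : ℂ)⁻¹) :
    klein x y σ = (τ : ℂ)⁻¹ * klein y (-x) τ := by
  have h := theta_neg_inv (x + 1 / 2) (y + 1 / 2) τ.2
  have h' := theta_add_int (y + 1 / 2) (-x + 1 / 2) 0 (-1) τ
  rw [show -(x + 1 / 2) = -x + 1 / 2 + (-1 : ℤ) by push_cast; ring,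
    show y + 1 / 2 = y + 1 / 2 + (0 : ℤ) by simp, h'] at h
  simp only [Int.cast_zero, add_zero] at h
  have hη := eta_coe_ne_zero τ
  have h0 : (τ : ℂ) ≠ 0 := τ.ne_zero
  set u := (-I * (τ : ℂ)) ^ (1 / 2 : ℂ) with hu
  have hu2 : u ^ 2 = -I * τ := by
    rw [hu, ← cpow_nat_mul]
    norm_num
  have hu0 : u ≠ 0 := by
    intro h
    rw [h] at hu2
    simp [h0] at hu2
  simp only [klein]
  rw [hσ, show -(τ : ℂ)⁻¹ = -τ.1⁻¹ from rfl, h, ← show -(τ : ℂ)⁻¹ = -τ.1⁻¹ from rfl, eta_neg_inv,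
    ← hu]
  have e : cexp (-(π * I * x * (y + 1))) * (cexp (2 * π * I * (x + 1 / 2 : ℝ) * (y + 1 / 2 : ℝ)) *
      cexp (2 * π * I * (-1 : ℤ) * (y + 1 / 2 : ℝ))) =
      -I * cexp (-(π * I * y * ((-x : ℝ) + 1))) := by
    rw [← Complex.exp_neg_pi_div_two_mul_I, ← Complex.exp_add, ← Complex.exp_add, ← Complex.exp_add]
    congr 1
    push_cast
    ring
  generalize theta (y + 1 / 2) (-x + 1 / 2) τ = θ
  have hd : (u * η τ) ^ 3 = u * (-I * τ) * η τ ^ 3 := by rw [← hu2]; ring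
  rw [hd, ← mul_div_assoc, div_eq_div_iff (by simp [hη, hu0, h0]) (by simp [hη])]
  linear_combination (θ * u * η τ ^ 3) * e + (θ * u * I * η τ ^ 3) *
    cexp (-(π * I * y * ((-x : ℝ) + 1))) * mul_inv_cancel₀ h0

lemma slash_apply_eq (k : ℤ) (f : ℍ → ℂ) (γ : SL(2, ℤ)) (τ : ℍ) :
    (f ∣[k] γ) τ = f (γ • τ) * ((γ 1 0 : ℂ) * τ + γ 1 1) ^ (-k) := by
  rw [SL_slash_apply, ModularGroup.denom_apply]

lemma klein_slash (γ : SL(2, ℤ)) (x y : ℝ) :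
    klein x y ∣[(-1 : ℤ)] γ = klein (x * γ 0 0 + y * γ 1 0) (x * γ 0 1 + y * γ 1 1) := by
  have hγ : γ ∈ Subgroup.closure {ModularGroup.S, ModularGroup.T} := by
    rw [SpecialLinearGroup.SL2Z_generators]
    trivial
  induction hγ using Subgroup.closure_induction generalizing x y with
  | mem γ hγ =>
    rcases hγ with rfl | rfl
    · ext τ
      rw [SL_slash_apply, modular_S_smul, ModularGroup.denom_S,
        klein_neg_inv x y τ _ (by simp [inv_neg])]
      simp [ModularGroup.S]
      field_simp [τ.ne_zero]
    · ext τ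
      rw [slash_apply_eq, modular_T_smul, klein_vadd_one]
      simp only [show ModularGroup.T 0 0 = 1 from rfl, show ModularGroup.T 0 1 = 1 from rfl,
        show ModularGroup.T 1 0 = 0 from rfl, show ModularGroup.T 1 1 = 1 from rfl]
      simp
  | one => simp
  | mul γ δ _ _ hγ hδ =>
    rw [SlashAction.slash_mul, hγ, hδ]
    congr 1 <;> simp [Matrix.mul_apply, Fin.sum_univ_two] <;> ring
  | inv γ _ hγ =>
    have hd : (γ 0 0 : ℝ) * γ 1 1 - γ 0 1 * γ 1 0 = 1 := by
      exact_mod_cast (Matrix.det_fin_two γ.1).symm.trans γ.2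
    have h := hγ (x * γ⁻¹ 0 0 + y * γ⁻¹ 1 0) (x * γ⁻¹ 0 1 + y * γ⁻¹ 1 1)
    have e : ∀ i j, ((γ⁻¹ : SL(2, ℤ)) i j : ℝ) = (!![γ 1 1, -γ 0 1; -γ 1 0, γ 0 0] i j : ℤ) := by
      intro i j
      rw [Matrix.SpecialLinearGroup.SL2_inv_expl]
      rfl
    have h2 := h.trans (b := klein _ _) (c := klein x y) (by
      congr 1 <;> simp only [e] <;> simp
      · linear_combination x * hd
      · linear_combination y * hd)
    rw [← h2, ← SlashAction.slash_mul, mul_inv_cancel, SlashAction.slash_one]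

lemma klein_add_int (x y : ℝ) (m n : ℤ) (τ : ℍ) :
    klein (x + m) (y + n) τ = cexp (π * I * (n * x - m * y + n - m - m * n)) * klein x y τ := by
  have h := theta_add_int (x + 1 / 2) (y + 1 / 2) m n τ
  simp only [klein]
  rw [show x + m + 1 / 2 = x + 1 / 2 + m by ring, show y + n + 1 / 2 = y + 1 / 2 + n by ring, h,
    ← mul_assoc, ← Complex.exp_add, ← mul_div_assoc, ← mul_assoc, ← Complex.exp_add]
  congr 3
  push_cast
  ring

lemma hasLead_eta : HasLead (fun τ ↦ η τ) (1 / 24) 1 := by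
  have htprod : Tendsto (fun q : ℂ ↦ ∏' (n : ℕ), (1 - q ^ (n + 1))) (𝓝 0) (𝓝 1) := by
    have := tendsto_tprod_one_add_of_dominated_convergence (𝓕 := 𝓝 0) (g := 0)
      (f := fun (q : ℂ) (n : ℕ) ↦ -q ^ (n + 1)) (bound := fun n ↦ (1 / 2 : ℝ) ^ (n + 1))
    simp only [Pi.zero_apply, norm_neg, norm_pow, add_zero, tprod_one] at this
    simp_rw [sub_eq_add_neg]
    refine this
      (by simpa only [pow_succ'] using (summable_geometric_of_abs_lt_one (by norm_num)).mul_left _)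
      (fun k ↦ by simpa using ((continuous_pow (M := ℂ) (k + 1)).tendsto 0).neg) ?_
    filter_upwards [Metric.ball_mem_nhds (0 : ℂ) (by norm_num : (0 : ℝ) < 1 / 2)] with q hq k
    exact pow_le_pow_left₀ (norm_nonneg _) (mem_ball_zero_iff.mp hq).le _
  have h : Tendsto (fun τ : ℍ ↦ cexp (2 * π * I * τ)) atImInfty (𝓝 0) := by
    simpa using tendsto_cexp_atImInfty one_pos
  refine (htprod.comp h).congr fun τ ↦ ?_
  simp only [Function.comp_apply, ModularForm.eta, Function.Periodic.qParam]
  rw [mul_right_comm (cexp (2 * π * I * (τ : ℂ) / (24 : ℝ))), ← Complex.exp_add]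
  simp only [eta_q_eq_pow]
  rw [show 2 * π * I * (τ : ℂ) / (24 : ℝ) + -(2 * π * I * (1 / 24 : ℝ) * τ) = 0 by push_cast; ring]
  simp

lemma hasLead_klein_of_mem_Ico {x y : ℝ} (hx : x ∈ Set.Ico (0 : ℝ) 1)
    (hxy : x ≠ 0 ∨ ∀ n : ℤ, y ≠ n) :
    ∃ β ≠ 0, HasLead (klein x y) (x * (x - 1) / 2) β := by
  have hfac : ∀ n : ℤ, ((n : ℝ) + (x + 1 / 2)) ^ 2 - (1 / 2 - x) ^ 2 = (n + 1) * (n + 2 * x) :=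
    fun n ↦ by ring
  have hμ : ∀ n : ℤ, (1 / 2 - x) ^ 2 ≤ ((n : ℝ) + (x + 1 / 2)) ^ 2 := by
    intro n
    rw [← sub_nonneg, hfac]
    rcases le_or_gt 0 n with h | h
    · have : (0 : ℝ) ≤ n := by exact_mod_cast h
      have := hx.1
      positivity
    rcases eq_or_lt_of_le (Int.le_sub_one_of_lt h) with h | h
    · simp [h]
    · have : (n : ℝ) ≤ -2 := by exact_mod_cast Int.le_sub_one_of_lt h
      have := hx.2
      exact mul_nonneg_of_nonpos_of_nonpos (by linarith) (by linarith)
  have hθ := hasLead_theta (x + 1 / 2) (y + 1 / 2) (1 / 2 - x) hμ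
  set β := ∑' n : ℤ, if ((n : ℝ) + (x + 1 / 2 : ℝ)) ^ 2 = (1 / 2 - x) ^ 2 then
    cexp (2 * π * I * (n + (x + 1 / 2 : ℝ)) * (y + 1 / 2 : ℝ)) else 0 with hβ
  have hcond : ∀ n : ℤ, ((n : ℝ) + (x + 1 / 2)) ^ 2 = (1 / 2 - x) ^ 2 ↔
      n = -1 ∨ (n : ℝ) = -(2 * x) := by
    intro n
    rw [← sub_eq_zero, hfac, mul_eq_zero, ← eq_neg_iff_add_eq_zero, ← eq_neg_iff_add_eq_zero]
    norm_cast
  have hβ0 : β ≠ 0 := by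
    rcases eq_or_ne x 0 with h0 | h0
    · have hy := hxy.resolve_left (not_not.mpr h0)
      have hs : β = ∑ n ∈ ({-1, 0} : Finset ℤ),
          cexp (2 * π * I * (n + (x + 1 / 2 : ℝ)) * (y + 1 / 2 : ℝ)) := by
        rw [hβ, tsum_eq_sum (s := ({-1, 0} : Finset ℤ))]
        · refine Finset.sum_congr rfl fun n hn ↦ if_pos ?_
          rw [hcond]
          simpa [h0] using hn
        · intro n hn
          rw [if_neg]
          rw [hcond]
          simpa [h0] using hn
      rw [hs, Finset.sum_pair (by norm_num)]
      intro h
      have h2 := eq_neg_of_add_eq_zero_right h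
      rw [← neg_one_mul, ← Complex.exp_pi_mul_I, ← Complex.exp_add,
        Complex.exp_eq_exp_iff_exists_int] at h2
      obtain ⟨m, hm⟩ := h2
      refine hy m ?_
      have hπ : (2 * π * I : ℂ) ≠ 0 := by simp
      have : (2 * π * I : ℂ) * y = 2 * π * I * m := by
        rw [h0] at hm
        push_cast at hm
        linear_combination hm
      exact_mod_cast mul_left_cancel₀ hπ this
    · have hs : β = cexp (2 * π * I * ((-1 : ℤ) + (x + 1 / 2 : ℝ)) * (y + 1 / 2 : ℝ)) := by
        rw [hβ, tsum_eq_single (-1)]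
        · exact if_pos ((hcond _).mpr (Or.inl rfl))
        · intro n hn
          rw [if_neg]
          rw [hcond]
          rintro (h | h)
          · exact hn h
          · have h1 : (n : ℝ) < 0 := by
              have := lt_of_le_of_ne hx.1 (Ne.symm h0)
              linarith
            have h2 : (-2 : ℝ) < n := by linarith [hx.2]
            have h1' : n < 0 := by exact_mod_cast h1
            have h2' : -2 < n := by exact_mod_cast h2
            omega
      rw [hs]
      exact Complex.exp_ne_zero _
  refine ⟨cexp (-(π * I * x * (y + 1))) * (β * ((1 ^ 3) ^ (-1 : ℤ))), ?_, ?_⟩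
  · simp [hβ0]
  · have h := (hθ.mul ((hasLead_eta.pow 3).zpow (by simp) (-1))).const_mul
      (cexp (-(π * I * x * (y + 1))))
    convert h using 1
    · ext τ
      simp [klein, div_eq_mul_inv, mul_assoc]
    · push_cast
      ring

lemma hasLead_klein {x y : ℝ} (hxy : (∀ n : ℤ, x ≠ n) ∨ ∀ n : ℤ, y ≠ n) :
    ∃ β ≠ 0, HasLead (klein x y) (Int.fract x * (Int.fract x - 1) / 2) β := by
  obtain ⟨β, hβ, h⟩ := hasLead_klein_of_mem_Ico (x := Int.fract x) (y := y)
    ⟨Int.fract_nonneg x, Int.fract_lt_one x⟩ (hxy.imp_left fun h h0 ↦ h ⌊x⌋ (by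
      rw [Int.fract, sub_eq_zero] at h0
      exact h0))
  have e := klein_add_int (Int.fract x) y ⌊x⌋ 0
  simp only [Int.fract_add_floor, Int.cast_zero, add_zero] at e
  rw [show klein x y = _ from funext e]
  exact ⟨_, mul_ne_zero (Complex.exp_ne_zero _) hβ, h.const_mul _⟩

lemma differentiableOn_klein (x y : ℝ) :
    DifferentiableOn ℂ (klein x y ∘ ofComplex) {z | 0 < z.im} := by
  have h : DifferentiableOn ℂ (fun z : ℂ ↦ cexp (-(π * I * x * (y + 1))) *
      theta (x + 1 / 2) (y + 1 / 2) z / η z ^ 3) {z | 0 < z.im} := fun z hz ↦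
    (((differentiableAt_theta _ _ hz).const_mul _).div
      ((differentiableAt_eta_of_mem_upperHalfPlaneSet hz).pow 3)
      (pow_ne_zero _ (eta_ne_zero hz))).differentiableWithinAt
  refine h.congr fun z hz ↦ ?_
  simp [klein, ofComplex_apply_of_im_pos hz]

/-! ### Modular forms from functions on the upper half-plane -/

/-- A holomorphic function invariant under `Γ₁(N)` and bounded at all cusps. -/
noncomputable def modularFormOf {N : ℕ} [NeZero N] {k : ℤ} {F : ℍ → ℂ}
    (hol : DifferentiableOn ℂ (F ∘ ofComplex) {z | 0 < z.im})
    (inv : ∀ γ ∈ Gamma1 N, F ∣[k] γ = F)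
    (bdd : ∀ γ : SL(2, ℤ), IsBoundedAtImInfty (F ∣[k] γ)) : ModularForm (Gamma1 N) k where
  toFun := F
  slash_action_eq' := by
    rintro _ ⟨γ, hγ, rfl⟩
    exact inv γ hγ
  holo' := UpperHalfPlane.mdifferentiable_iff.mpr hol
  bdd_at_cusps' := fun hc ↦ by
    rw [Subgroup.IsArithmetic.isCusp_iff_isCusp_SL2Z] at hc
    rw [OnePoint.isBoundedAt_iff_forall_SL2Z hc]
    exact fun γ _ ↦ bdd γ

/-- A holomorphic function invariant under `Γ₁(N)` and vanishing at all cusps. -/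
noncomputable def cuspFormOf {N : ℕ} [NeZero N] {k : ℤ} {F : ℍ → ℂ}
    (hol : DifferentiableOn ℂ (F ∘ ofComplex) {z | 0 < z.im})
    (inv : ∀ γ ∈ Gamma1 N, F ∣[k] γ = F)
    (zero : ∀ γ : SL(2, ℤ), IsZeroAtImInfty (F ∣[k] γ)) : CuspForm (Gamma1 N) k where
  toFun := F
  slash_action_eq' := by
    rintro _ ⟨γ, hγ, rfl⟩
    exact inv γ hγ
  holo' := UpperHalfPlane.mdifferentiable_iff.mpr hol
  zero_at_cusps' := fun hc ↦ by
    rw [Subgroup.IsArithmetic.isCusp_iff_isCusp_SL2Z] at hc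
    rw [OnePoint.isZeroAt_iff_forall_SL2Z hc]
    exact fun γ _ ↦ zero γ

lemma isBoundedAtImInfty_of_tendsto {F : ℍ → ℂ} {a : ℂ} (h : Tendsto F atImInfty (𝓝 a)) :
    IsBoundedAtImInfty F :=
  h.isBigO_one ℝ

lemma eq_const_of_weight_zero {N : ℕ} [NeZero N] {F : ℍ → ℂ}
    (hol : DifferentiableOn ℂ (F ∘ ofComplex) {z | 0 < z.im})
    (inv : ∀ γ ∈ Gamma1 N, F ∣[(0 : ℤ)] γ = F)
    (bdd : ∀ γ : SL(2, ℤ), IsBoundedAtImInfty (F ∣[(0 : ℤ)] γ))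
    {a : ℂ} (ha : Tendsto F atImInfty (𝓝 a)) (τ : ℍ) : F τ = a := by
  obtain ⟨c, hc⟩ := ModularForm.eq_const_of_weight_zero (modularFormOf hol inv bdd)
  have hF : F = Function.const ℍ c := hc
  rw [hF] at ha ⊢
  exact tendsto_nhds_unique tendsto_const_nhds ha

/-- The sum of the residues of the differential `F dτ` vanishes. -/
lemma residue_sum {N : ℕ} [NeZero N] {F : ℍ → ℂ} {κ : ℂ}
    (hol : DifferentiableOn ℂ (F ∘ ofComplex) {z | 0 < z.im})
    (inv : ∀ γ ∈ Gamma1 N, F ∣[(2 : ℤ)] γ = F)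
    (lim : ∀ γ : SL(2, ℤ), Tendsto (F ∣[(2 : ℤ)] γ) atImInfty (𝓝 0) ∨
      Tendsto (F ∣[(2 : ℤ)] γ) atImInfty (𝓝 κ))
    (γ₁ : SL(2, ℤ)) (h₁ : Tendsto (F ∣[(2 : ℤ)] γ₁) atImInfty (𝓝 κ)) : κ = 0 := by
  have bdd : ∀ γ : SL(2, ℤ), IsBoundedAtImInfty (F ∣[(2 : ℤ)] γ) := fun γ ↦
    (lim γ).elim isBoundedAtImInfty_of_tendsto isBoundedAtImInfty_of_tendsto
  set f := modularFormOf hol inv bdd with hf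
  have hcoe : (f : ℍ → ℂ) = F := rfl
  have h0 : ModularForm.trace 𝒮ℒ f = 0 :=
    rank_zero_iff_forall_zero.mp ModularForm.levelOne_weight_two_rank_zero _
  by_contra hκ
  classical
  let _ := Fintype.ofFinite (𝒮ℒ ⧸ ((Gamma1 N : Subgroup (GL (Fin 2) ℝ)).subgroupOf 𝒮ℒ))
  have key : ∀ q : 𝒮ℒ ⧸ ((Gamma1 N : Subgroup (GL (Fin 2) ℝ)).subgroupOf 𝒮ℒ), ∃ n : ℕ,
      Tendsto (SlashInvariantForm.quotientFunc f q) atImInfty (𝓝 (n * κ)) := by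
    intro q
    induction q using Quotient.inductionOn with
    | h r =>
      obtain ⟨_, γ, rfl⟩ := r
      rw [SlashInvariantForm.quotientFunc_mk, hcoe]
      have : F ∣[(2 : ℤ)] ((Matrix.SpecialLinearGroup.mapGL ℝ γ)⁻¹ : GL (Fin 2) ℝ) =
          F ∣[(2 : ℤ)] γ⁻¹ := by
        rw [← map_inv]
        rfl
      rw [this]
      rcases lim γ⁻¹ with h | h
      · exact ⟨0, by simpa using h⟩
      · exact ⟨1, by simpa using h⟩
  choose n hn using key
  have hsum := tendsto_finsetSum (Finset.univ) fun q _ ↦ hn q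
  have htr : ∀ τ, ∑ q : 𝒮ℒ ⧸ ((Gamma1 N : Subgroup (GL (Fin 2) ℝ)).subgroupOf 𝒮ℒ),
      SlashInvariantForm.quotientFunc f q τ = 0 := by
    intro τ
    have := congrArg (fun g : ModularForm 𝒮ℒ 2 ↦ (g : ℍ → ℂ) τ) h0
    simpa [ModularForm.coe_trace] using this
  simp only [htr] at hsum
  have h3 := tendsto_nhds_unique hsum tendsto_const_nhds
  rw [← Finset.sum_mul] at h3
  have h4 : ∑ q, (n q : ℂ) = 0 := (mul_eq_zero.mp h3).resolve_right hκ
  have h5 : ∑ q, n q = 0 := by exact_mod_cast h4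
  have h6 := (Finset.sum_eq_zero_iff.mp h5)
    (⟦⟨Matrix.SpecialLinearGroup.mapGL ℝ γ₁⁻¹, ⟨γ₁⁻¹, rfl⟩⟩⟧) (Finset.mem_univ _)
  have h7 := hn (⟦⟨Matrix.SpecialLinearGroup.mapGL ℝ γ₁⁻¹, ⟨γ₁⁻¹, rfl⟩⟩⟧)
  rw [h6, SlashInvariantForm.quotientFunc_mk, hcoe] at h7
  have : F ∣[(2 : ℤ)] ((Matrix.SpecialLinearGroup.mapGL ℝ γ₁⁻¹)⁻¹ : GL (Fin 2) ℝ) =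
      F ∣[(2 : ℤ)] γ₁ := by
    rw [← map_inv, inv_inv]
    rfl
  simp only [this] at h7
  exact hκ (by simpa using tendsto_nhds_unique h₁ h7)

/-- A periodic holomorphic function that vanishes at `i∞` is `O(q)`. -/
lemma exists_hasLead_of_tendsto_zero {F : ℍ → ℂ} {h : ℝ} (hh : 0 < h)
    (hol : DifferentiableOn ℂ (F ∘ ofComplex) {z | 0 < z.im})
    (per : ∀ τ : ℍ, F (h +ᵥ τ) = F τ) (lim : Tendsto F atImInfty (𝓝 0)) :
    ∃ β, HasLead F (1 / h) β := by
  have hper : Function.Periodic (F ∘ ofComplex) h := by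
    intro w
    by_cases hw : 0 < w.im
    · have hw' : 0 < (w + h).im := by simpa using hw
      have : F (ofComplex (w + h)) = F (ofComplex w) := by
        rw [← per (ofComplex w)]
        congr 1
        ext
        rw [coe_vadd, ofComplex_apply_of_im_pos hw, ofComplex_apply_of_im_pos hw']
        simp [add_comm]
      exact this
    · have hw' : (w + h).im ≤ 0 := by simpa using hw
      simp [ofComplex_apply_of_im_nonpos (not_lt.mp hw), ofComplex_apply_of_im_nonpos hw']
  have hdiff := differentiableAt_cuspFunction hh hper (UpperHalfPlane.mdifferentiable_iff.mpr hol)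
    (isBoundedAtImInfty_of_tendsto lim) (q := 0) (by simp)
  have h0 : cuspFunction h F 0 = 0 :=
    IsZeroAtImInfty.cuspFunction_apply_zero lim hh
  refine ⟨deriv (cuspFunction h F) 0, ?_⟩
  have hs := hdiff.hasDerivAt.tendsto_slope
  have hq : Tendsto (fun τ : ℍ ↦ Function.Periodic.qParam h τ) atImInfty (𝓝[≠] 0) :=
    tendsto_nhdsWithin_iff.mpr ⟨qParam_tendsto_atImInfty hh,
      Eventually.of_forall fun τ ↦ Function.Periodic.qParam_ne_zero _⟩
  refine (hs.comp hq).congr fun τ ↦ ?_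
  simp only [Function.comp_apply, slope, h0, sub_zero, vsub_eq_sub, smul_eq_mul]
  rw [eq_cuspFunction τ hh.ne' hper, mul_comm, Function.Periodic.qParam, ← Complex.exp_neg]
  congr 2
  push_cast
  ring

/-! ### Nonvanishing of Klein forms -/

lemma HasLead.prod {ι : Type*} (A : Finset ι) {F : ι → ℍ → ℂ} {s : ι → ℝ} {β : ι → ℂ}
    (h : ∀ i ∈ A, HasLead (F i) (s i) (β i)) :
    HasLead (fun τ ↦ ∏ i ∈ A, F i τ) (∑ i ∈ A, s i) (∏ i ∈ A, β i) := by
  classical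
  induction A using Finset.induction_on with
  | empty => exact hasLead_one
  | insert i A hi ih =>
    simp only [Finset.prod_insert hi, Finset.sum_insert hi]
    exact (h i (Finset.mem_insert_self i A)).mul
      (ih fun j hj ↦ h j (Finset.mem_insert_of_mem hj))

/-- The power of a Klein form that only depends on its characteristic modulo `1`. -/
noncomputable def kleinPow {N : ℕ} (p : ZMod N × ZMod N) (τ : ℍ) : ℂ :=
  klein (p.1.val / N) (p.2.val / N) τ ^ (12 * N)

lemma klein_pow_eq {N : ℕ} [NeZero N] (u v : ℤ) (τ : ℍ) :
    klein (u / N) (v / N) τ ^ (12 * N) = kleinPow ((u : ZMod N), (v : ZMod N)) τ := by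
  have hN : (N : ℂ) ≠ 0 := Nat.cast_ne_zero.mpr (NeZero.ne N)
  have hN' : (N : ℝ) ≠ 0 := Nat.cast_ne_zero.mpr (NeZero.ne N)
  have key : ∀ w : ℤ, (w : ℝ) / N = (((w : ZMod N).val : ℕ) : ℝ) / N + ((w / N : ℤ) : ℝ) := by
    intro w
    have h1 : (((w : ZMod N).val : ℕ) : ℤ) = w % N := ZMod.val_intCast w
    have h2 := Int.emod_add_mul_ediv w N
    rw [← h1] at h2
    have h3 : (((w : ZMod N).val : ℕ) : ℝ) + N * ((w / N : ℤ) : ℝ) = w := by exact_mod_cast h2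
    rw [← h3]
    field_simp
  rw [kleinPow, key u, key v, klein_add_int, mul_pow, ← Complex.exp_nat_mul]
  set m := u / (N : ℤ)
  set n := v / (N : ℤ)
  set a := (u : ZMod N).val
  set b := (v : ZMod N).val
  rw [Complex.exp_eq_one_iff.mpr, one_mul]
  refine ⟨6 * (n * a - m * b + N * (n - m - m * n)), ?_⟩
  push_cast
  field_simp
  ring

/-- The product of all Klein forms of level `N`, normalised to have weight `0`. -/
noncomputable def kleinNorm (N : ℕ) [NeZero N] (τ : ℍ) : ℂ :=
  (∏ p ∈ (Finset.univ : Finset (ZMod N × ZMod N)).erase 0, kleinPow p τ) *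
    discriminant τ ^ (N * (N ^ 2 - 1))

lemma kleinPow_vadd_one {N : ℕ} [NeZero N] (p : ZMod N × ZMod N) (τ : ℍ) :
    kleinPow p ((1 : ℝ) +ᵥ τ) = kleinPow (p.1, p.1 + p.2) τ := by
  have := klein_pow_eq (N := N) (p.1.val : ℤ) ((p.1.val : ℤ) + p.2.val) τ
  push_cast at this
  rw [ZMod.natCast_zmod_val, ZMod.natCast_zmod_val, add_div] at this
  rw [← this, kleinPow, klein_vadd_one]

lemma kleinPow_neg_inv {N : ℕ} [NeZero N] (p : ZMod N × ZMod N) (τ σ : ℍ)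
    (hσ : (σ : ℂ) = -(τ : ℂ)⁻¹) :
    kleinPow p σ = (τ : ℂ)⁻¹ ^ (12 * N) * kleinPow (p.2, -p.1) τ := by
  have := klein_pow_eq (N := N) (p.2.val : ℤ) (-(p.1.val : ℤ)) τ
  push_cast at this
  rw [ZMod.natCast_zmod_val, ZMod.natCast_zmod_val, neg_div] at this
  rw [← this, kleinPow, klein_neg_inv _ _ τ σ hσ, mul_pow]

lemma discriminant_vadd_one (τ : ℍ) : discriminant ((1 : ℝ) +ᵥ τ) = discriminant τ := by
  have := congrFun discriminant_T_invariant τ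
  rw [slash_apply_eq, modular_T_smul] at this
  simpa [ModularGroup.T] using this

lemma discriminant_S_smul (τ : ℍ) :
    discriminant (ModularGroup.S • τ) = (τ : ℂ) ^ 12 * discriminant τ := by
  have := congrFun discriminant_S_invariant τ
  rw [slash_apply_eq] at this
  have h0 : (τ : ℂ) ≠ 0 := τ.ne_zero
  simp [ModularGroup.S] at this
  rw [← this]
  field_simp
  rfl

lemma kleinNorm_vadd_one (N : ℕ) [NeZero N] (τ : ℍ) :
    kleinNorm N ((1 : ℝ) +ᵥ τ) = kleinNorm N τ := by
  rw [kleinNorm, kleinNorm, discriminant_vadd_one]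
  congr 1
  refine Finset.prod_bij' (fun p _ ↦ (p.1, p.1 + p.2)) (fun p _ ↦ (p.1, p.2 - p.1)) ?_ ?_ ?_ ?_ ?_
  · rintro ⟨a, b⟩ h
    simp only [Finset.mem_erase, ne_eq, Prod.mk_eq_zero, Finset.mem_univ, and_true] at h ⊢
    rintro ⟨rfl, h'⟩
    exact h ⟨rfl, by simpa using h'⟩
  · rintro ⟨a, b⟩ h
    simp only [Finset.mem_erase, ne_eq, Prod.mk_eq_zero, Finset.mem_univ, and_true] at h ⊢
    rintro ⟨rfl, h'⟩
    exact h ⟨rfl, by simpa using h'⟩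
  · simp
  · simp
  · intro p _
    exact kleinPow_vadd_one p τ

lemma coe_S_smul (τ : ℍ) : ((ModularGroup.S • τ : ℍ) : ℂ) = -(τ : ℂ)⁻¹ := by
  rw [modular_S_smul]
  exact (neg_inv).symm

lemma kleinNorm_S_smul (N : ℕ) [NeZero N] (τ : ℍ) :
    kleinNorm N (ModularGroup.S • τ) = kleinNorm N τ := by
  have h0 : (τ : ℂ) ≠ 0 := τ.ne_zero
  rw [kleinNorm, kleinNorm, discriminant_S_smul]
  have hcard : ((Finset.univ : Finset (ZMod N × ZMod N)).erase 0).card = N ^ 2 - 1 := by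
    rw [Finset.card_erase_of_mem (Finset.mem_univ _), Finset.card_univ]
    simp [ZMod.card, sq]
  have : ∏ p ∈ (Finset.univ : Finset (ZMod N × ZMod N)).erase 0, kleinPow p (ModularGroup.S • τ) =
      (τ : ℂ)⁻¹ ^ (12 * N * (N ^ 2 - 1)) *
        ∏ p ∈ (Finset.univ : Finset (ZMod N × ZMod N)).erase 0, kleinPow p τ := by
    rw [Finset.prod_congr rfl fun p _ ↦ kleinPow_neg_inv p τ _ (coe_S_smul τ),
      Finset.prod_mul_distrib, Finset.prod_const, hcard, ← pow_mul]
    congr 1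
    refine Finset.prod_bij' (fun p _ ↦ (p.2, -p.1)) (fun p _ ↦ (-p.2, p.1)) ?_ ?_ ?_ ?_ ?_
    · rintro ⟨a, b⟩ h
      simp only [Finset.mem_erase, ne_eq, Prod.mk_eq_zero, Finset.mem_univ, and_true] at h ⊢
      exact fun ⟨h1, h2⟩ ↦ h ⟨by simpa using h2, h1⟩
    · rintro ⟨a, b⟩ h
      simp only [Finset.mem_erase, ne_eq, Prod.mk_eq_zero, Finset.mem_univ, and_true] at h ⊢
      exact fun ⟨h1, h2⟩ ↦ h ⟨h2, by simpa using h1⟩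
    · simp
    · simp
    · simp
  have h1 : (τ : ℂ)⁻¹ ^ (12 * (N * (N ^ 2 - 1))) * (τ : ℂ) ^ (12 * (N * (N ^ 2 - 1))) = 1 := by
    rw [← mul_pow, inv_mul_cancel₀ h0, one_pow]
  rw [this, mul_pow, ← pow_mul, mul_assoc 12, mul_mul_mul_comm, h1, one_mul]

lemma kleinNorm_slash (N : ℕ) [NeZero N] (γ : SL(2, ℤ)) :
    kleinNorm N ∣[(0 : ℤ)] γ = kleinNorm N := by
  refine SlashInvariantForm.slash_action_generators_SL2Z ?_ ?_ γ
  · ext τ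
    rw [slash_apply_eq, kleinNorm_S_smul]
    simp
  · ext τ
    rw [slash_apply_eq, modular_T_smul, kleinNorm_vadd_one]
    simp

lemma sum_range_mul_sub (N : ℕ) :
    ∑ r ∈ Finset.range N, (r : ℝ) * (r - N) = -(N * (N ^ 2 - 1) / 6) := by
  have h : ∀ n : ℕ, ∑ r ∈ Finset.range n, (r : ℝ) * (r - N) =
      (n * (n - 1) * (2 * n - 1) / 6) - N * (n * (n - 1) / 2) := by
    intro n
    induction n with
    | zero => simp
    | succ n ih =>
      rw [Finset.sum_range_succ, ih]
      push_cast
      ring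
  rw [h]
  ring

lemma sum_val_mul_sub (N : ℕ) [NeZero N] :
    ∑ p : ZMod N × ZMod N, (p.1.val : ℝ) * (p.1.val - N) = -(N ^ 2 * (N ^ 2 - 1) / 6) := by
  obtain ⟨n, rfl⟩ : ∃ n, N = n + 1 := ⟨N - 1, (Nat.succ_pred (NeZero.ne N)).symm⟩
  have h2 : ∑ r : ZMod (n + 1), (r.val : ℝ) * (r.val - (n + 1 : ℕ)) =
      ∑ r ∈ Finset.range (n + 1), (r : ℝ) * (r - (n + 1 : ℕ)) :=
    Fin.sum_univ_eq_sum_range (fun r ↦ (r : ℝ) * (r - (n + 1 : ℕ))) (n + 1)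
  rw [Fintype.sum_prod_type]
  simp only [Finset.sum_const, Finset.card_univ, ZMod.card, nsmul_eq_mul]
  rw [← Finset.mul_sum, h2, sum_range_mul_sub]
  ring

lemma hasLead_kleinPow {N : ℕ} [NeZero N] {p : ZMod N × ZMod N} (hp : p ≠ 0) :
    ∃ β ≠ 0, HasLead (kleinPow p) (6 / N * (p.1.val * (p.1.val - N))) β := by
  have hN : 0 < (N : ℝ) := Nat.cast_pos.mpr (NeZero.pos N)
  have key : ∀ r : ZMod N, r ≠ 0 → ∀ n : ℤ, (r.val : ℝ) / N ≠ n := by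
    intro r hr n h
    rw [div_eq_iff hN.ne'] at h
    have h' : ((r.val : ℕ) : ℤ) = n * N := by exact_mod_cast h
    apply hr
    have := congrArg (Int.cast : ℤ → ZMod N) h'
    simpa using this
  obtain ⟨β, hβ, h⟩ := hasLead_klein (x := p.1.val / N) (y := p.2.val / N) (by
    by_cases h1 : p.1 = 0
    · exact Or.inr (key _ fun h2 ↦ hp (Prod.ext h1 h2))
    · exact Or.inl (key _ h1))
  refine ⟨β ^ (12 * N), pow_ne_zero _ hβ, ?_⟩
  have h' := h.pow (12 * N)
  rw [Int.fract_eq_self.mpr ⟨by positivity, (div_lt_one hN).mpr (by exact_mod_cast ZMod.val_lt _)⟩]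
    at h'
  have he : (6 : ℝ) / N * (p.1.val * (p.1.val - N)) =
      (12 * N : ℕ) * (p.1.val / N * (p.1.val / N - 1) / 2) := by
    push_cast
    field_simp
    ring
  rw [he]
  exact h'

lemma hasLead_kleinNorm (N : ℕ) [NeZero N] : ∃ β ≠ 0, HasLead (kleinNorm N) 0 β := by
  have hN : (N : ℝ) ≠ 0 := Nat.cast_ne_zero.mpr (NeZero.ne N)
  choose! β hβ h using fun (p : ZMod N × ZMod N) (hp : p ≠ 0) ↦ hasLead_kleinPow hp
  have h1 := HasLead.prod ((Finset.univ : Finset (ZMod N × ZMod N)).erase 0)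
    (F := kleinPow) (s := fun p ↦ 6 / N * (p.1.val * (p.1.val - N))) (β := β)
    fun p hp ↦ h p (Finset.ne_of_mem_erase hp)
  have h2 : HasLead discriminant 1 1 := by
    have := hasLead_eta.pow 24
    norm_num at this
    refine this.congr fun τ ↦ ?_
    rfl
  refine ⟨(∏ p ∈ Finset.univ.erase 0, β p) * 1 ^ (N * (N ^ 2 - 1)),
    mul_ne_zero (Finset.prod_ne_zero_iff.mpr fun p hp ↦ hβ p (Finset.ne_of_mem_erase hp))
    (pow_ne_zero (N * (N ^ 2 - 1)) one_ne_zero), ?_⟩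
  have h3 := h1.mul (h2.pow (N * (N ^ 2 - 1)))
  rw [Finset.sum_erase _ (by simp), ← Finset.mul_sum, sum_val_mul_sub] at h3
  have h4 : (6 : ℝ) / N * -(N ^ 2 * (N ^ 2 - 1) / 6) + (N * (N ^ 2 - 1) : ℕ) * 1 = 0 := by
    have : 1 ≤ N ^ 2 := Nat.one_le_pow _ _ (NeZero.pos N)
    push_cast [this]
    field_simp
    ring
  rw [h4] at h3
  exact h3

lemma differentiableOn_kleinPow {N : ℕ} (p : ZMod N × ZMod N) :
    DifferentiableOn ℂ (kleinPow p ∘ ofComplex) {z | 0 < z.im} :=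
  (differentiableOn_klein _ _).pow _

lemma differentiableOn_kleinNorm (N : ℕ) [NeZero N] :
    DifferentiableOn ℂ (kleinNorm N ∘ ofComplex) {z | 0 < z.im} := by
  have h : DifferentiableOn ℂ (discriminant ∘ ofComplex) {z | 0 < z.im} :=
    UpperHalfPlane.mdifferentiable_iff.mp (CuspForm.discriminant).holo'
  have h' := (DifferentiableOn.finsetProd (u := (Finset.univ : Finset (ZMod N × ZMod N)).erase 0)
    (f := fun p ↦ kleinPow p ∘ ofComplex) fun p _ ↦ differentiableOn_kleinPow p).mul
    (h.pow (N * (N ^ 2 - 1)))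
  refine h'.congr fun z _ ↦ ?_
  simp [kleinNorm]

lemma kleinNorm_ne_zero (N : ℕ) [NeZero N] (τ : ℍ) : kleinNorm N τ ≠ 0 := by
  obtain ⟨β, hβ, h⟩ := hasLead_kleinNorm N
  rw [hasLead_zero_iff] at h
  rwa [eq_const_of_weight_zero (N := 1) (differentiableOn_kleinNorm N)
    (fun γ _ ↦ kleinNorm_slash N γ) (fun γ ↦ by
      rw [kleinNorm_slash]
      exact isBoundedAtImInfty_of_tendsto h) h τ]

lemma klein_ne_zero {N : ℕ} [NeZero N] {u v : ℤ} (h : (u : ZMod N) ≠ 0 ∨ (v : ZMod N) ≠ 0)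
    (τ : ℍ) : klein (u / N) (v / N) τ ≠ 0 := by
  have h1 := Finset.prod_ne_zero_iff.mp (left_ne_zero_of_mul (kleinNorm_ne_zero N τ))
    ((u : ZMod N), (v : ZMod N)) (Finset.mem_erase.mpr ⟨fun h0 ↦ by
      rw [Prod.mk_eq_zero] at h0
      exact h.elim (· h0.1) (· h0.2), Finset.mem_univ _⟩)
  rw [← klein_pow_eq] at h1
  exact fun h2 ↦ h1 (by rw [h2, zero_pow (by simp [NeZero.ne N])])

/-! ### Products of Klein forms -/

/-- The product `∏ 𝔨_{(ju/N, jv/N)} ^ n` over the pairs `(j, n)` in a list. -/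
noncomputable def kleinProd (N : ℕ) (e : List (ℤ × ℤ)) (u v : ℤ) (τ : ℍ) : ℂ :=
  (e.map fun p ↦ klein ((p.1 * u : ℤ) / N) ((p.1 * v : ℤ) / N) τ ^ p.2).prod

/-- The sum of the exponents. -/
def expSum (e : List (ℤ × ℤ)) : ℤ := (e.map fun p ↦ p.2).sum

def linSum (e : List (ℤ × ℤ)) : ℤ := (e.map fun p ↦ p.1 * p.2).sum

def quadSum (e : List (ℤ × ℤ)) : ℤ := (e.map fun p ↦ p.1 * p.1 * p.2).sum

/-- The pole order, scaled by `2 * N ^ 2`, of a product of Klein forms. -/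
def poleOrder (N : ℕ) (e : List (ℤ × ℤ)) (u : ℤ) : ℤ :=
  (e.map fun p ↦ p.2 * (p.1 * u % N * (N - p.1 * u % N))).sum

lemma klein_smul (γ : SL(2, ℤ)) (x y : ℝ) (τ : ℍ) :
    klein x y (γ • τ) = ((γ 1 0 : ℂ) * τ + γ 1 1)⁻¹ *
      klein (x * γ 0 0 + y * γ 1 0) (x * γ 0 1 + y * γ 1 1) τ := by
  have hd : (γ 1 0 : ℂ) * τ + γ 1 1 ≠ 0 := by
    rw [← ModularGroup.denom_apply]
    exact denom_ne_zero _ _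
  rw [← klein_slash, slash_apply_eq]
  simp only [neg_neg, zpow_one]
  field_simp

lemma kleinProd_smul (N : ℕ) (e : List (ℤ × ℤ)) (u v : ℤ) (γ : SL(2, ℤ)) (τ : ℍ) :
    kleinProd N e u v (γ • τ) = ((γ 1 0 : ℂ) * τ + γ 1 1) ^ (-expSum e) *
      kleinProd N e (u * γ 0 0 + v * γ 1 0) (u * γ 0 1 + v * γ 1 1) τ := by
  have hd : (γ 1 0 : ℂ) * τ + γ 1 1 ≠ 0 := by
    rw [← ModularGroup.denom_apply]
    exact denom_ne_zero _ _
  simp only [kleinProd, expSum]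
  induction e with
  | nil => simp
  | cons p e ih =>
    simp only [List.map_cons, List.prod_cons, List.sum_cons]
    rw [ih, klein_smul, mul_zpow, neg_add, zpow_add₀ hd, inv_zpow', mul_mul_mul_comm]
    congr 4 <;> push_cast <;> ring

lemma kleinProd_add_mul (N : ℕ) [NeZero N] (e : List (ℤ × ℤ)) (u v m n : ℤ) (τ : ℍ) :
    kleinProd N e (u + N * m) (v + N * n) τ =
      cexp (π * I * (quadSum e * (n * u - m * v) / N + linSum e * (n - m) - quadSum e * (m * n))) *
        kleinProd N e u v τ := by
  have hN : (N : ℂ) ≠ 0 := Nat.cast_ne_zero.mpr (NeZero.ne N)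
  have hN' : (N : ℝ) ≠ 0 := Nat.cast_ne_zero.mpr (NeZero.ne N)
  simp only [kleinProd, linSum, quadSum]
  induction e with
  | nil => simp
  | cons p e ih =>
    simp only [List.map_cons, List.prod_cons, List.sum_cons]
    have hx : ((p.1 * (u + N * m) : ℤ) : ℝ) / N = (p.1 * u : ℤ) / N + (p.1 * m : ℤ) := by
      push_cast
      field_simp
    have hy : ((p.1 * (v + N * n) : ℤ) : ℝ) / N = (p.1 * v : ℤ) / N + (p.1 * n : ℤ) := by
      push_cast
      field_simp
    rw [ih, hx, hy, klein_add_int, mul_zpow, ← Complex.exp_int_mul, mul_mul_mul_comm,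
      ← Complex.exp_add]
    congr 2
    push_cast
    field_simp
    ring

lemma linSum_emod_two (e : List (ℤ × ℤ)) : linSum e % 2 = quadSum e % 2 := by
  induction e with
  | nil => rfl
  | cons p e ih =>
    simp only [linSum, quadSum, List.map_cons, List.sum_cons] at ih ⊢
    have h : (p.1 * p.2) % 2 = (p.1 * p.1 * p.2) % 2 := by
      rcases Int.emod_two_eq_zero_or_one p.1 with h | h <;>
      rcases Int.emod_two_eq_zero_or_one p.2 with h' | h' <;> simp [Int.mul_emod, h, h']
    omega

lemma kleinProd_congr {N : ℕ} [NeZero N] {e : List (ℤ × ℤ)} (he : (2 * N : ℤ) ∣ quadSum e)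
    {u v u' v' : ℤ} (hu : (u : ZMod N) = u') (hv : (v : ZMod N) = v') :
    kleinProd N e u v = kleinProd N e u' v' := by
  have hN : (N : ℂ) ≠ 0 := Nat.cast_ne_zero.mpr (NeZero.ne N)
  obtain ⟨m, hm⟩ := (ZMod.intCast_eq_intCast_iff_dvd_sub u' u N).mp hu.symm
  obtain ⟨n, hn⟩ := (ZMod.intCast_eq_intCast_iff_dvd_sub v' v N).mp hv.symm
  obtain rfl : u = u' + N * m := by omega
  obtain rfl : v = v' + N * n := by omega
  obtain ⟨K, hK⟩ := he
  obtain ⟨L, hL⟩ : (2 : ℤ) ∣ linSum e := by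
    have := linSum_emod_two e
    rw [hK, mul_assoc, Int.mul_emod_right] at this
    exact Int.dvd_of_emod_eq_zero this
  ext τ
  rw [kleinProd_add_mul, Complex.exp_eq_one_iff.mpr, one_mul]
  refine ⟨K * (n * u' - m * v') + L * (n - m) - K * N * (m * n), ?_⟩
  rw [hK, hL]
  push_cast
  field_simp

lemma fract_intCast_div (N : ℕ) [NeZero N] (a : ℤ) :
    Int.fract ((a : ℝ) / N) = ((a % N : ℤ) : ℝ) / N := by
  have := Int.fract_div_intCast_eq_div_intCast_mod (k := ℝ) (m := a) (n := N)
  simpa using this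

lemma hasLead_kleinProd {N : ℕ} [NeZero N] {e : List (ℤ × ℤ)}
    (he : ∀ p ∈ e, (p.1 : ZMod N) ≠ 0) {u v : ℤ} {α β : ZMod N} (huv : α * u + β * v = 1) :
    ∃ δ ≠ 0, HasLead (kleinProd N e u v) (-(poleOrder N e u / (2 * N ^ 2))) δ := by
  have hN : (N : ℝ) ≠ 0 := Nat.cast_ne_zero.mpr (NeZero.ne N)
  induction e with
  | nil => exact ⟨1, one_ne_zero, by
      simp only [poleOrder, List.map_nil, List.sum_nil, Int.cast_zero, zero_div, neg_zero]
      exact hasLead_one⟩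
  | cons p e ih =>
    obtain ⟨δ, hδ, h⟩ := ih fun q hq ↦ he q (List.mem_cons_of_mem _ hq)
    have hmod : ∀ w : ℤ, (∃ n : ℤ, ((w : ℤ) : ℝ) / N = n) → (w : ZMod N) = 0 := by
      rintro w ⟨n, hn⟩
      rw [div_eq_iff hN] at hn
      have : w = n * N := by exact_mod_cast hn
      simp [this]
    obtain ⟨δ', hδ', h'⟩ := hasLead_klein (x := (p.1 * u : ℤ) / N) (y := (p.1 * v : ℤ) / N) (by
      by_contra! hc
      have h1 := hmod _ hc.1
      have h2 := hmod _ hc.2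
      push_cast at h1 h2
      apply he p List.mem_cons_self
      linear_combination (-(p.1 : ZMod N)) * huv + α * h1 + β * h2)
    refine ⟨δ' ^ p.2 * δ, mul_ne_zero (zpow_ne_zero _ hδ') hδ, ?_⟩
    have := (h'.zpow hδ' p.2).mul h
    rw [fract_intCast_div] at this
    have hs : -((poleOrder N (p :: e) u : ℝ) / (2 * N ^ 2)) =
        p.2 * (((p.1 * u % N : ℤ) : ℝ) / N * (((p.1 * u % N : ℤ) : ℝ) / N - 1) / 2) +
          -((poleOrder N e u : ℝ) / (2 * N ^ 2)) := by
      simp only [poleOrder, List.map_cons, List.sum_cons]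
      push_cast
      field_simp
      ring
    rw [hs]
    exact this

lemma klein_mul_ne_zero {N : ℕ} [NeZero N] {j u v : ℤ} (hj : (j : ZMod N) ≠ 0) {α β : ZMod N}
    (huv : α * u + β * v = 1) (τ : ℍ) : klein ((j * u : ℤ) / N) ((j * v : ℤ) / N) τ ≠ 0 := by
  refine klein_ne_zero ?_ τ
  by_contra! hc
  obtain ⟨h1, h2⟩ := hc
  push_cast at h1 h2
  apply hj
  linear_combination (-(j : ZMod N)) * huv + α * h1 + β * h2

lemma kleinProd_ne_zero {N : ℕ} [NeZero N] {e : List (ℤ × ℤ)}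
    (he : ∀ p ∈ e, (p.1 : ZMod N) ≠ 0) {u v : ℤ} {α β : ZMod N} (huv : α * u + β * v = 1)
    (τ : ℍ) : kleinProd N e u v τ ≠ 0 := by
  refine List.prod_ne_zero fun h ↦ ?_
  obtain ⟨p, hp, h⟩ := List.mem_map.mp h
  exact zpow_ne_zero _ (klein_mul_ne_zero (he p hp) huv τ) h

lemma differentiableOn_kleinProd {N : ℕ} [NeZero N] {e : List (ℤ × ℤ)}
    (he : ∀ p ∈ e, (p.1 : ZMod N) ≠ 0) {u v : ℤ} {α β : ZMod N} (huv : α * u + β * v = 1) :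
    DifferentiableOn ℂ (kleinProd N e u v ∘ ofComplex) {z | 0 < z.im} := by
  induction e with
  | nil => exact differentiableOn_const 1
  | cons p e ih =>
    exact ((differentiableOn_klein _ _).zpow
      (Or.inl fun z _ ↦ klein_mul_ne_zero (he p List.mem_cons_self) huv _)).mul
      (ih fun q hq ↦ he q (List.mem_cons_of_mem _ hq))

/-! ### Expansions at the cusps -/

lemma mem_Gamma1_of_bottom_row {N : ℕ} {A : SL(2, ℤ)} (h0 : (A 1 0 : ZMod N) = 0)
    (h1 : (A 1 1 : ZMod N) = 1) : A ∈ Gamma1 N := by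
  rw [Gamma1_mem]
  refine ⟨?_, h1, h0⟩
  have hdet := congrArg (Int.cast : ℤ → ZMod N) (Matrix.SpecialLinearGroup.det_coe A)
  rw [Matrix.det_fin_two] at hdet
  push_cast at hdet
  rw [h0, h1] at hdet
  simpa using hdet

lemma mul_T_zpow_mul_inv_bottom (γ γ' : SL(2, ℤ)) (k : ℤ) :
    (γ * ModularGroup.T ^ k * γ'⁻¹) 1 0 = γ 1 0 * γ' 1 1 - γ' 1 0 * (k * γ 1 0 + γ 1 1) ∧
    (γ * ModularGroup.T ^ k * γ'⁻¹) 1 1 =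
      -(γ 1 0 * γ' 0 1) + γ' 0 0 * (k * γ 1 0 + γ 1 1) := by
  have h1 : (γ'⁻¹ : SL(2, ℤ)).1 = !![γ' 1 1, -γ' 0 1; -γ' 1 0, γ' 0 0] := by
    rw [Matrix.SpecialLinearGroup.SL2_inv_expl]
    rfl
  have h2 : (γ * ModularGroup.T ^ k * γ'⁻¹).1 = γ.1 * !![1, k; 0, 1] *
      !![γ' 1 1, -γ' 0 1; -γ' 1 0, γ' 0 0] := by
    rw [← h1, ← ModularGroup.coe_T_zpow]
    rfl
  constructor
  · rw [h2]
    simp [Matrix.mul_apply, Fin.sum_univ_two]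
    ring
  · rw [h2]
    simp [Matrix.mul_apply, Fin.sum_univ_two]
    ring

lemma det_cast {N : ℕ} (γ : SL(2, ℤ)) :
    (γ 0 0 : ZMod N) * γ 1 1 - γ 0 1 * γ 1 0 = 1 := by
  have hdet := congrArg (Int.cast : ℤ → ZMod N) (Matrix.SpecialLinearGroup.det_coe γ)
  rw [Matrix.det_fin_two] at hdet
  push_cast at hdet
  exact hdet

lemma exists_mul_T_zpow_mem {N : ℕ} {γ γ' : SL(2, ℤ)} (hu : IsUnit (γ 1 0 : ZMod N))
    (h : (γ 1 0 : ZMod N) = γ' 1 0) : ∃ k : ℤ, γ * ModularGroup.T ^ k * γ'⁻¹ ∈ Gamma1 N := by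
  obtain ⟨w, hw⟩ := hu.exists_left_inv
  obtain ⟨k, hk⟩ := ZMod.intCast_surjective (((γ' 1 1 : ZMod N) - (γ 1 1 : ZMod N)) * w)
  refine ⟨k, mem_Gamma1_of_bottom_row ?_ ?_⟩
  · rw [(mul_T_zpow_mul_inv_bottom γ γ' k).1]
    push_cast
    rw [hk, ← h]
    linear_combination (-(γ 1 0 : ZMod N) * (γ' 1 1 - γ 1 1)) * hw
  · rw [(mul_T_zpow_mul_inv_bottom γ γ' k).2]
    push_cast
    rw [hk]
    linear_combination ((γ' 0 0 : ZMod N) * (γ' 1 1 - γ 1 1)) * hw - (γ' 0 1 : ZMod N) * h +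
      det_cast (N := N) γ'

lemma mul_T_zpow_mul_inv_mem {N : ℕ} {γ : SL(2, ℤ)} {k : ℤ} (h : (k : ZMod N) * γ 1 0 = 0) :
    γ * ModularGroup.T ^ k * γ⁻¹ ∈ Gamma1 N := by
  refine mem_Gamma1_of_bottom_row ?_ ?_
  · rw [(mul_T_zpow_mul_inv_bottom γ γ k).1]
    push_cast
    linear_combination (-(γ 1 0 : ZMod N)) * h
  · rw [(mul_T_zpow_mul_inv_bottom γ γ k).2]
    push_cast
    linear_combination (γ 0 0 : ZMod N) * h + det_cast (N := N) γ

lemma slash_shift {N : ℕ} {k : ℤ} {F : ℍ → ℂ} (inv : ∀ γ ∈ Gamma1 N, F ∣[k] γ = F)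
    {γ γ' : SL(2, ℤ)} {n : ℤ} (h : γ * ModularGroup.T ^ n * γ'⁻¹ ∈ Gamma1 N) (τ : ℍ) :
    (F ∣[k] γ') τ = (F ∣[k] γ) ((n : ℝ) +ᵥ τ) := by
  have h1 := congrArg (· ∣[k] γ') (inv _ h)
  simp only [← SlashAction.slash_mul, inv_mul_cancel_right] at h1
  rw [← h1, SlashAction.slash_mul, slash_apply_eq, modular_T_zpow_smul]
  have h10 : (ModularGroup.T ^ n) 1 0 = 0 := by
    rw [ModularGroup.coe_T_zpow]
    rfl
  have h11 : (ModularGroup.T ^ n) 1 1 = 1 := by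
    rw [ModularGroup.coe_T_zpow]
    rfl
  simp [h10, h11]

lemma slash_neg_apply (k : ℤ) (F : ℍ → ℂ) (γ : SL(2, ℤ)) (τ : ℍ) :
    (F ∣[k] (-γ)) τ = (-1) ^ k * (F ∣[k] γ) τ := by
  rw [slash_apply_eq, slash_apply_eq, ModularGroup.SL_neg_smul]
  have : (((-γ) 1 0 : ℤ) : ℂ) * τ + ((-γ) 1 1 : ℤ) = (-1) * (γ 1 0 * τ + γ 1 1) := by
    simp
    ring
  rw [this, mul_zpow, zpow_neg (-1 : ℂ)]
  rcases Int.even_or_odd k with h | h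
  · simp [h.neg_one_zpow]
  · simp [h.neg_one_zpow]

section CuspForm

variable {N : ℕ} (f : CuspForm (Gamma1 N) 1)

lemma slash_mem (γ : SL(2, ℤ)) (hγ : γ ∈ Gamma1 N) : (f : ℍ → ℂ) ∣[(1 : ℤ)] γ = f :=
  f.slash_action_eq' _ ⟨γ, hγ, rfl⟩

lemma differentiableOn_slash (γ : SL(2, ℤ)) :
    DifferentiableOn ℂ (((f : ℍ → ℂ) ∣[(1 : ℤ)] γ) ∘ ofComplex) {z | 0 < z.im} :=
  UpperHalfPlane.mdifferentiable_iff.mp (MDifferentiable.slash f.holo' 1 _)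

lemma isZeroAtImInfty_slash [NeZero N] (γ : SL(2, ℤ)) :
    IsZeroAtImInfty ((f : ℍ → ℂ) ∣[(1 : ℤ)] γ) :=
  CuspFormClass.zero_at_infty_slash f γ

/-- The trivial bound for the order of vanishing at the cusps. -/
lemma exists_hasLead_slash [NeZero N] (γ : SL(2, ℤ)) {g : ℕ} (hg : g ∣ N) (hγ : (g : ℤ) ∣ γ 1 0) :
    ∃ β, HasLead ((f : ℍ → ℂ) ∣[(1 : ℤ)] γ) (g / N) β := by
  obtain ⟨h, hh⟩ := hg
  obtain ⟨c, hc⟩ := hγ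
  have hN : (N : ℝ) = g * h := by exact_mod_cast hh
  have hN0 : (N : ℝ) ≠ 0 := Nat.cast_ne_zero.mpr (NeZero.ne N)
  have hh0 : (h : ℝ) ≠ 0 := right_ne_zero_of_mul (hN ▸ hN0)
  have hg0 : (g : ℝ) ≠ 0 := left_ne_zero_of_mul (hN ▸ hN0)
  have hper := slash_shift (slash_mem f) (γ := γ) (γ' := γ) (n := h) (mul_T_zpow_mul_inv_mem (by
    rw [hc]
    have : ((g * h : ℕ) : ZMod N) = 0 := hh ▸ ZMod.natCast_self N
    push_cast at this ⊢
    linear_combination (c : ZMod N) * this))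
  obtain ⟨β, hβ⟩ := exists_hasLead_of_tendsto_zero (h := h) (by positivity)
    (differentiableOn_slash f γ) (fun τ ↦ by simpa using (hper τ).symm)
    (isZeroAtImInfty_slash f γ)
  refine ⟨β, ?_⟩
  rw [hN]
  convert hβ using 1
  field_simp

/-- `f` vanishes to order at least `m` at the cusps of width `N`. -/
def OrdGe (m : ℕ) : Prop :=
  ∀ γ : SL(2, ℤ), IsUnit (γ 1 0 : ZMod N) →
    ∃ β, HasLead ((f : ℍ → ℂ) ∣[(1 : ℤ)] γ) (m / N) β

/-- `f` vanishes to order greater than `m` at the cusps of width `N` with lower left entry `s`. -/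
def LeadZero (m : ℕ) (s : ZMod N) : Prop :=
  ∀ γ : SL(2, ℤ), (γ 1 0 : ZMod N) = s → HasLead ((f : ℍ → ℂ) ∣[(1 : ℤ)] γ) (m / N) 0

lemma ordGe_one [NeZero N] : OrdGe f 1 := fun γ _ ↦
  exists_hasLead_slash f γ (one_dvd _) (by simp)

variable {f}

lemma LeadZero.neg {m : ℕ} {s : ZMod N} (h : LeadZero f m s) : LeadZero f m (-s) := by
  intro γ hγ
  have := (h (-γ) (by simp [hγ])).neg
  rw [neg_zero] at this
  refine this.congr fun τ ↦ ?_
  simp [slash_neg_apply]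

lemma leadZero_of_hasLead {m : ℕ} {γ : SL(2, ℤ)} (hu : IsUnit (γ 1 0 : ZMod N))
    (h : HasLead ((f : ℍ → ℂ) ∣[(1 : ℤ)] γ) (m / N) 0) : LeadZero f m (γ 1 0) := by
  intro γ' hγ'
  obtain ⟨k, hk⟩ := exists_mul_T_zpow_mem hu hγ'.symm
  simpa using h.comp_vadd k fun τ ↦ slash_shift (slash_mem f) hk τ

lemma HasLead.mul_cexp {F : ℍ → ℂ} {s : ℝ} {β : ℂ} (h : HasLead F s β) (t : ℝ) :
    HasLead (fun τ ↦ F τ * cexp (2 * π * I * t * τ)) (s + t) β := by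
  refine h.congr fun τ ↦ ?_
  dsimp only
  rw [mul_assoc (F τ), ← Complex.exp_add]
  congr 2
  push_cast
  ring

lemma OrdGe.succ [NeZero N] {m : ℕ} (h : ∀ s : ZMod N, IsUnit s → LeadZero f m s) :
    OrdGe f (m + 1) := by
  intro γ hγ
  have hN : (N : ℂ) ≠ 0 := Nat.cast_ne_zero.mpr (NeZero.ne N)
  have hN' : (0 : ℝ) < N := Nat.cast_pos.mpr (NeZero.pos N)
  have h1 := (h _ hγ γ rfl).mul_cexp (-(m / N))
  rw [add_neg_cancel, hasLead_zero_iff] at h1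
  have hper := slash_shift (slash_mem f) (γ := γ) (γ' := γ) (n := N)
    (mul_T_zpow_mul_inv_mem (by simp))
  obtain ⟨β, hβ⟩ := exists_hasLead_of_tendsto_zero hN'
    (((differentiableOn_slash f γ).mul
      (b := fun z : ℂ ↦ cexp (2 * π * I * (-(m / N) : ℝ) * z)) (by fun_prop)).congr fun z hz ↦ by
      simp [ofComplex_apply_of_im_pos hz]) (fun τ ↦ by
      rw [show (N : ℝ) = ((N : ℤ) : ℝ) by simp, ← hper τ, coe_vadd]
      congr 1
      refine Complex.exp_eq_exp_iff_exists_int.mpr ⟨-m, ?_⟩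
      push_cast
      field_simp
      ring) h1
  refine ⟨β, ?_⟩
  have h2 := hβ.mul_cexp (m / N)
  have h3 : (1 : ℝ) / N + m / N = ((m + 1 : ℕ) : ℝ) / N := by
    push_cast
    ring
  rw [h3] at h2
  refine h2.congr fun τ ↦ ?_
  dsimp only
  rw [mul_assoc (((f : ℍ → ℂ) ∣[(1 : ℤ)] γ) τ), ← Complex.exp_add]
  push_cast
  simp

end CuspForm

/-! ### Relations between leading coefficients -/

/-- The product of the `k`-th power of `f` with a product of Klein forms. -/
noncomputable def mulKlein (N : ℕ) (f : ℍ → ℂ) (k : ℕ) (e : List (ℤ × ℤ)) (t : ℤ) (τ : ℍ) : ℂ :=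
  f τ ^ k * kleinProd N e 0 t τ

lemma mulKlein_slash (N : ℕ) (f : ℍ → ℂ) (k : ℕ) (e : List (ℤ × ℤ)) (t : ℤ) (γ : SL(2, ℤ)) :
    mulKlein N f k e t ∣[k - expSum e] γ =
      fun τ ↦ (f ∣[(1 : ℤ)] γ) τ ^ k * kleinProd N e (t * γ 1 0) (t * γ 1 1) τ := by
  ext τ
  have hd : (γ 1 0 : ℂ) * τ + γ 1 1 ≠ 0 := by
    rw [← ModularGroup.denom_apply]
    exact denom_ne_zero _ _
  rw [slash_apply_eq, slash_apply_eq, mulKlein, kleinProd_smul, mul_pow,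
    ← zpow_natCast (_ ^ (-1 : ℤ)), ← zpow_mul,
    show -(k - expSum e) = -1 * (k : ℤ) + expSum e by ring, zpow_add₀ hd, zpow_neg]
  simp only [zero_mul, zero_add]
  have := zpow_ne_zero (expSum e) hd
  field_simp

lemma poleOrder_emod (N : ℕ) (e : List (ℤ × ℤ)) (u : ℤ) :
    poleOrder N e (u % N) = poleOrder N e u := by
  have h (p : ℤ × ℤ) : p.1 * (u % N) % N = p.1 * u % N := by simp [Int.mul_emod]
  simp [poleOrder, h]

section CuspForm

variable {N : ℕ} [NeZero N] {f : CuspForm (Gamma1 N) 1} {e : List (ℤ × ℤ)}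

lemma mulKlein_slash_mem (k : ℕ) (hquad : (2 * N : ℤ) ∣ quadSum e) (t : ℤ) (γ : SL(2, ℤ))
    (hγ : γ ∈ Gamma1 N) : mulKlein N f k e t ∣[k - expSum e] γ = mulKlein N f k e t := by
  obtain ⟨-, hd, hc⟩ := (Gamma1_mem N γ).mp hγ
  rw [mulKlein_slash, slash_mem f γ hγ,
    kleinProd_congr (u' := 0) (v' := t) hquad (by simp [hc]) (by simp [hd])]
  rfl

lemma differentiableOn_mulKlein (k : ℕ) (he : ∀ p ∈ e, (p.1 : ZMod N) ≠ 0) {t : ℤ} {s : ZMod N}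
    (hst : s * t = 1) :
    DifferentiableOn ℂ (mulKlein N f k e t ∘ ofComplex) {z | 0 < z.im} :=
  ((UpperHalfPlane.mdifferentiable_iff.mp f.holo').pow k).mul
    (differentiableOn_kleinProd he (α := 0) (β := s) (by simpa using hst))

lemma exists_hasLead_mulKlein (k : ℕ) (he : ∀ p ∈ e, (p.1 : ZMod N) ≠ 0) {t : ℤ} {s : ZMod N}
    (hst : s * t = 1) (γ : SL(2, ℤ)) : ∃ δ ≠ 0, ∀ (m : ℕ) (β : ℂ),
      HasLead ((f : ℍ → ℂ) ∣[(1 : ℤ)] γ) (m / N) β →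
      HasLead (mulKlein N f k e t ∣[k - expSum e] γ)
        ((2 * N * (k * m) - poleOrder N e (t * γ 1 0) : ℤ) / (2 * N ^ 2)) (β ^ k * δ) := by
  obtain ⟨δ, hδ, h⟩ := hasLead_kleinProd he (u := t * γ 1 0) (v := t * γ 1 1)
    (α := -(γ 0 1 : ZMod N) * s) (β := (γ 0 0 : ZMod N) * s) (by
      push_cast
      linear_combination ((γ 0 0 : ZMod N) * γ 1 1 - γ 0 1 * γ 1 0) * hst + det_cast (N := N) γ)
  refine ⟨δ, hδ, fun m β hβ ↦ ?_⟩
  have hN : (N : ℝ) ≠ 0 := Nat.cast_ne_zero.mpr (NeZero.ne N)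
  have h1 := (hβ.pow k).mul h
  have h2 : (k : ℝ) * (m / N) + -((poleOrder N e (t * γ 1 0) : ℝ) / (2 * N ^ 2)) =
      (2 * N * (k * m) - poleOrder N e (t * γ 1 0) : ℤ) / (2 * N ^ 2) := by
    push_cast
    field_simp
    ring
  rw [h2] at h1
  rw [mulKlein_slash]
  exact h1

/-- A product of Klein forms of weight `1` on `Γ₁(N)` whose product with a cusp form vanishing to
order `m` at the cusps of width `N` has poles at most at the cusps in `P`. -/
def IsRelation (N m : ℕ) (e : List (ℤ × ℤ)) (P : List ℕ) : Bool :=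
  (e.all fun p ↦ p.1 % N != 0) && expSum e == -1 && quadSum e % (2 * N) == 0 &&
  (P.all fun b ↦ poleOrder N e b == 2 * N * m && Nat.gcd b N == 1) &&
  (List.range N).all fun x ↦
    if Nat.gcd x N = 1 then poleOrder N e x < 2 * N * m ||
      (poleOrder N e x == 2 * N * m && (P.contains x || P.contains (N - x)))
    else poleOrder N e x < 2 * N * Nat.gcd x N

lemma HasLead.tendsto_zero {F : ℍ → ℂ} {s : ℝ} {β : ℂ} (h : HasLead F s β) (hs : 0 < s) :
    Tendsto F atImInfty (𝓝 0) :=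
  hasLead_zero_iff.mp (h.of_lt hs)

lemma leadZero_of_isRelation {m : ℕ} {P : List ℕ} (hrel : IsRelation N m e P = true)
    (hf : OrdGe f m) {s : ZMod N} (hs : IsUnit s) {b : ℕ} (hb : b ∈ P)
    (h : ∀ p ∈ P, p ≠ b → LeadZero f m (s * p)) : LeadZero f m (s * b) := by
  simp only [IsRelation, Bool.and_eq_true, List.all_eq_true, beq_iff_eq, bne_iff_ne, ne_eq] at hrel
  obtain ⟨⟨⟨⟨he, hexp⟩, hquad⟩, hP⟩, hx⟩ := hrel
  replace he : ∀ p ∈ e, (p.1 : ZMod N) ≠ 0 := fun p hp h0 ↦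
    he p hp (Int.emod_eq_zero_of_dvd ((ZMod.intCast_zmod_eq_zero_iff_dvd _ _).mp h0))
  replace hquad := Int.dvd_of_emod_eq_zero hquad
  have hN : (0 : ℝ) < N := Nat.cast_pos.mpr (NeZero.pos N)
  obtain ⟨t', ht'⟩ := hs.exists_right_inv
  obtain ⟨t, rfl⟩ := ZMod.intCast_surjective t'
  have hk : ((1 : ℕ) : ℤ) - expSum e = 2 := by rw [hexp]; rfl
  have hinv := mulKlein_slash_mem (f := f) 1 hquad t
  rw [hk] at hinv
  have hbu : IsUnit (s * b) := hs.mul ((ZMod.isUnit_iff_coprime b N).mpr (hP b hb).2)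
  intro γ hγ
  obtain ⟨β, hβ⟩ := hf γ (hγ ▸ hbu)
  obtain ⟨δ, hδ, h1⟩ := exists_hasLead_mulKlein (f := f) 1 he ht' γ
  have h2 := h1 m β hβ
  have h3 : poleOrder N e (t * γ 1 0) = 2 * N * m := by
    rw [← (hP b hb).1, ← poleOrder_emod, ← poleOrder_emod _ _ b]
    congr 1
    refine (ZMod.intCast_eq_intCast_iff' _ _ N).mp ?_
    push_cast
    rw [hγ]
    linear_combination (b : ZMod N) * ht'
  rw [h3, hk, Nat.cast_one, one_mul, sub_self, Int.cast_zero, zero_div, hasLead_zero_iff,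
    pow_one] at h2
  suffices hκ : β * δ = 0 by
    rwa [(mul_eq_zero.mp hκ).resolve_right hδ] at hβ
  have hdiff := differentiableOn_mulKlein (f := f) 1 he ht'
  refine residue_sum hdiff hinv (fun γ' ↦ ?_) γ h2
  obtain ⟨δ', hδ', h1'⟩ := exists_hasLead_mulKlein (f := f) 1 he ht' γ'
  rw [hk] at h1'
  set x := (t * γ' 1 0 % N).toNat with hxdef
  have hxval : (x : ℤ) = t * γ' 1 0 % N :=
    Int.toNat_of_nonneg (Int.emod_nonneg _ (by exact_mod_cast NeZero.ne N))
  have hxN : x < N := by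
    have := Int.emod_lt_of_pos (t * γ' 1 0) (b := N) (by exact_mod_cast NeZero.pos N)
    omega
  have hxcast : (x : ZMod N) = t * γ' 1 0 := by
    have := congrArg (Int.cast : ℤ → ZMod N) hxval
    simpa using this
  have hsx : s * x = γ' 1 0 := by
    rw [hxcast]
    linear_combination (γ' 1 0 : ZMod N) * ht'
  have hx' := hx x (List.mem_range.mpr hxN)
  rw [← poleOrder_emod, ← hxval] at h1'
  by_cases hg : Nat.gcd x N = 1
  · have hu : IsUnit (γ' 1 0 : ZMod N) := hsx ▸ hs.mul ((ZMod.isUnit_iff_coprime x N).mpr hg)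
    obtain ⟨β', hβ'⟩ := hf γ' hu
    simp only [hg, if_true, Bool.or_eq_true, decide_eq_true_eq, Bool.and_eq_true, beq_iff_eq,
      List.contains_iff_mem] at hx'
    rcases hx' with hlt | ⟨heq, hmem⟩
    · refine Or.inl ((h1' m β' hβ').tendsto_zero (div_pos ?_ (by positivity)))
      exact_mod_cast (by rw [Nat.cast_one, one_mul]; linarith :
        (0 : ℤ) < 2 * N * ((1 : ℕ) * m) - poleOrder N e x)
    · obtain ⟨p, hp, hpx⟩ : ∃ p ∈ P, (γ' 1 0 : ZMod N) = s * p ∨ (γ' 1 0 : ZMod N) = -(s * p) := by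
        rcases hmem with hmem | hmem
        · exact ⟨x, hmem, Or.inl hsx.symm⟩
        · refine ⟨N - x, hmem, Or.inr ?_⟩
          rw [Nat.cast_sub hxN.le, ZMod.natCast_self, ← hsx]
          ring
      by_cases hpb : p = b
      · subst hpb
        right
        rw [← hγ] at hpx
        rcases hpx with h4 | h4
        · obtain ⟨n, hn⟩ := exists_mul_T_zpow_mem (γ := γ) (γ' := γ') (hγ ▸ hbu) h4.symm
          have := (hasLead_zero_iff.mpr h2).comp_vadd n fun τ ↦ slash_shift hinv hn τ
          simpa [hasLead_zero_iff] using this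
        · obtain ⟨n, hn⟩ := exists_mul_T_zpow_mem (γ := γ) (γ' := -γ') (hγ ▸ hbu) (by
            simp [h4])
          have := (hasLead_zero_iff.mpr h2).comp_vadd n fun τ ↦ slash_shift hinv hn τ
          have h5 : mulKlein N f 1 e t ∣[(2 : ℤ)] (-γ') = mulKlein N f 1 e t ∣[(2 : ℤ)] γ' := by
            ext τ
            simp [slash_neg_apply]
          rw [h5] at this
          simpa [hasLead_zero_iff] using this
      · left
        have h4 : HasLead ((f : ℍ → ℂ) ∣[(1 : ℤ)] γ') (m / N) 0 := by
          rcases hpx with h5 | h5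
          · exact h p hp hpb γ' h5
          · exact (h p hp hpb).neg γ' h5
        have h5 := h1' m 0 h4
        rwa [heq, Nat.cast_one, one_mul, sub_self, Int.cast_zero, zero_div, hasLead_zero_iff,
          pow_one, zero_mul] at h5
  · left
    simp only [hg, if_false, decide_eq_true_eq] at hx'
    obtain ⟨s', rfl⟩ := ZMod.intCast_surjective s
    obtain ⟨β', hβ'⟩ := exists_hasLead_slash f γ' (Nat.gcd_dvd_right x N) (by
      have h5 : (N : ℤ) ∣ γ' 1 0 - s' * x := by
        rw [← ZMod.intCast_zmod_eq_zero_iff_dvd]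
        push_cast
        rw [hsx, sub_self]
      have h6 := (Int.natCast_dvd_natCast.mpr (Nat.gcd_dvd_right x N)).trans h5
      have h7 := (Int.natCast_dvd_natCast.mpr (Nat.gcd_dvd_left x N)).mul_left s'
      simpa using dvd_add h6 h7)
    refine (h1' _ β' hβ').tendsto_zero (div_pos ?_ (by positivity))
    exact_mod_cast (by rw [Nat.cast_one, one_mul]; linarith :
      (0 : ℤ) < 2 * N * ((1 : ℕ) * (Nat.gcd x N : ℕ)) - poleOrder N e x)

/-- A product of Klein forms of negative weight witnessing that a cusp form vanishing to order `m`
at the cusps of width `N` is zero. -/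
def IsKiller (N m : ℕ) (e : List (ℤ × ℤ)) : Bool :=
  (e.all fun p ↦ p.1 % N != 0) && 0 < expSum e && quadSum e % (2 * N) == 0 &&
  (List.range N).all fun x ↦ poleOrder N e x ≤
    2 * N * (expSum e * if Nat.gcd x N = 1 then m else Nat.gcd x N)

lemma eq_zero_of_isKiller {m : ℕ} (hkill : IsKiller N m e = true) (hf : OrdGe f m) : f = 0 := by
  simp only [IsKiller, Bool.and_eq_true, List.all_eq_true, beq_iff_eq, bne_iff_ne, ne_eq,
    decide_eq_true_eq] at hkill
  obtain ⟨⟨⟨he, hexp⟩, hquad⟩, hx⟩ := hkill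
  replace he : ∀ p ∈ e, (p.1 : ZMod N) ≠ 0 := fun p hp h0 ↦
    he p hp (Int.emod_eq_zero_of_dvd ((ZMod.intCast_zmod_eq_zero_iff_dvd _ _).mp h0))
  replace hquad := Int.dvd_of_emod_eq_zero hquad
  have hN : (0 : ℝ) < N := Nat.cast_pos.mpr (NeZero.pos N)
  obtain ⟨k, hk⟩ := Int.eq_ofNat_of_zero_le hexp.le
  have hk0 : k ≠ 0 := by rintro rfl; simp [hk] at hexp
  have hk' : (k : ℤ) - expSum e = 0 := by rw [hk]; simp
  have ht : (1 : ZMod N) * (1 : ℤ) = 1 := by simp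
  have hinv := mulKlein_slash_mem (f := f) k hquad 1
  rw [hk'] at hinv
  have hbdd (γ : SL(2, ℤ)) : IsBoundedAtImInfty (mulKlein N f k e 1 ∣[(0 : ℤ)] γ) := by
    obtain ⟨δ, hδ, h1⟩ := exists_hasLead_mulKlein (f := f) k he ht γ
    rw [hk'] at h1
    set x := (γ 1 0 % N).toNat with hxdef
    have hxval : (x : ℤ) = γ 1 0 % N :=
      Int.toNat_of_nonneg (Int.emod_nonneg _ (by exact_mod_cast NeZero.ne N))
    have hxN : x < N := by
      have := Int.emod_lt_of_pos (γ 1 0) (b := N) (by exact_mod_cast NeZero.pos N)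
      omega
    have hxcast : (x : ZMod N) = γ 1 0 := by
      have := congrArg (Int.cast : ℤ → ZMod N) hxval
      simpa using this
    have hx' := hx x (List.mem_range.mpr hxN)
    rw [one_mul, ← poleOrder_emod, ← hxval] at h1
    obtain ⟨m', β, hβ, hm'⟩ : ∃ (m' : ℕ) (β : ℂ), HasLead ((f : ℍ → ℂ) ∣[(1 : ℤ)] γ) (m' / N) β ∧
        poleOrder N e x ≤ 2 * N * (k * m') := by
      by_cases hg : Nat.gcd x N = 1
      · obtain ⟨β, hβ⟩ := hf γ (hxcast ▸ (ZMod.isUnit_iff_coprime x N).mpr hg)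
        exact ⟨m, β, hβ, by simpa [hg, hk] using hx'⟩
      · obtain ⟨β, hβ⟩ := exists_hasLead_slash f γ (Nat.gcd_dvd_right x N) (by
          have h5 : (N : ℤ) ∣ γ 1 0 - x := by
            rw [hxval]
            exact Int.dvd_self_sub_emod
          have h6 := (Int.natCast_dvd_natCast.mpr (Nat.gcd_dvd_right x N)).trans h5
          have h7 := Int.natCast_dvd_natCast.mpr (Nat.gcd_dvd_left x N)
          simpa using dvd_add h6 h7)
        exact ⟨_, β, hβ, by simpa [hg, hk] using hx'⟩
    have h2 := h1 m' β hβ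
    rcases (sub_nonneg.mpr hm').eq_or_lt with h3 | h3
    · rw [← h3, Int.cast_zero, zero_div, hasLead_zero_iff] at h2
      exact isBoundedAtImInfty_of_tendsto h2
    · exact isBoundedAtImInfty_of_tendsto (h2.tendsto_zero (div_pos (by exact_mod_cast h3)
        (by positivity)))
  have hlim : Tendsto (mulKlein N f k e 1) atImInfty (𝓝 0) := by
    obtain ⟨δ, hδ, h1⟩ := exists_hasLead_mulKlein (f := f) k he ht 1
    obtain ⟨β, hβ⟩ := exists_hasLead_slash f 1 (dvd_refl N) (by simp)
    have h2 := h1 N β hβ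
    have h0 : poleOrder N e 0 = 0 := by simp [poleOrder]
    simp only [hk', SlashAction.slash_one] at h2
    refine h2.tendsto_zero (div_pos ?_ (by positivity))
    have h3 : 0 < 2 * N * (k * N) := by
      have := NeZero.pos N
      positivity
    simp only [Matrix.SpecialLinearGroup.coe_one, ne_eq, one_ne_zero, not_false_eq_true,
      Matrix.one_apply_ne, mul_zero, h0, sub_zero]
    exact_mod_cast h3
  ext τ
  have h1 := eq_const_of_weight_zero (differentiableOn_mulKlein (f := f) k he ht) hinv hbdd hlim τ
  have h2 := (mul_eq_zero.mp h1).resolve_right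
    (kleinProd_ne_zero he (α := 0) (β := 1) (by simp) τ)
  simpa [hk0] using h2

end CuspForm

/-! ### Propagating the vanishing of leading coefficients -/

/-- Membership of the class of `x` modulo `N` in a list, up to sign. -/
def memUpToSign (N : ℕ) (K : List ℕ) (x : ℕ) : Bool :=
  K.contains (x % N) || K.contains (N - x % N)

/-- If all but one of the multiples by `s` of the elements of `P` are known, add the last one. -/
def closureStep (N s : ℕ) (K P : List ℕ) : List ℕ :=
  match P.filter fun p ↦ !memUpToSign N K (s * p) with
  | [b] => s * b % N :: K
  | _ => K

/-- A round of applications of `closureStep`. -/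
def closureRound (N : ℕ) (Ps : List (List ℕ)) (K : List ℕ) : List ℕ :=
  (List.range N).foldl
    (fun K s ↦ if Nat.gcd s N = 1 then Ps.foldl (closureStep N s) K else K) K

/-- After `n` rounds all units modulo `N` are known up to sign. -/
def IsClosureFull (N n : ℕ) (Ps : List (List ℕ)) (K : List ℕ) : Bool :=
  (List.range N).all fun x ↦
    Nat.gcd x N != 1 || memUpToSign N ((closureRound N Ps)^[n] K) x

section CuspForm

variable {N : ℕ} [NeZero N] {f : CuspForm (Gamma1 N) 1} {m : ℕ}

lemma leadZero_of_memUpToSign {K : List ℕ} (hK : ∀ x ∈ K, LeadZero f m x) {x : ℕ}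
    (hx : memUpToSign N K x = true) : LeadZero f m x := by
  simp only [memUpToSign, Bool.or_eq_true, List.contains_iff_mem] at hx
  rcases hx with hx | hx
  · simpa using hK _ hx
  · have := (hK _ hx).neg
    rw [Nat.cast_sub (Nat.mod_lt _ (NeZero.pos N)).le] at this
    simpa using this

lemma leadZero_closureStep {s : ℕ} (hs : Nat.gcd s N = 1) (hf : OrdGe f m) {K P : List ℕ}
    (hP : ∃ e, IsRelation N m e P = true) (hK : ∀ x ∈ K, LeadZero f m x) :
    ∀ x ∈ closureStep N s K P, LeadZero f m x := by
  obtain ⟨e, he⟩ := hP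
  rw [closureStep]
  split
  · next b hb =>
    intro x hx
    rcases List.mem_cons.mp hx with rfl | hx
    · have hbP : b ∈ P := List.mem_of_mem_filter (hb ▸ List.mem_singleton.mpr rfl)
      have := leadZero_of_isRelation he hf ((ZMod.isUnit_iff_coprime s N).mpr hs) hbP
        fun p hp hpb ↦ by
          have hp' : memUpToSign N K (s * p) = true := by
            by_contra hcon
            have : p ∈ P.filter fun p ↦ !memUpToSign N K (s * p) :=
              List.mem_filter.mpr ⟨hp, by simpa using hcon⟩
            rw [hb, List.mem_singleton] at this
            exact hpb this
          simpa using leadZero_of_memUpToSign hK hp'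
      simpa using this
    · exact hK x hx
  · exact hK

lemma leadZero_closureRound (hf : OrdGe f m) {K : List ℕ} {Ps : List (List ℕ)}
    (hP : ∀ P ∈ Ps, ∃ e, IsRelation N m e P = true) (hK : ∀ x ∈ K, LeadZero f m x) :
    ∀ x ∈ closureRound N Ps K, LeadZero f m x := by
  rw [closureRound]
  generalize List.range N = l
  induction l generalizing K with
  | nil => exact hK
  | cons s l ih =>
    rw [List.foldl_cons]
    refine ih ?_
    split_ifs with hs
    · clear ih
      induction Ps generalizing K with
      | nil => exact hK
      | cons P Ps ih =>
        exact ih (fun P' hP' ↦ hP P' (List.mem_cons_of_mem _ hP'))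
          (leadZero_closureStep hs hf (hP P List.mem_cons_self) hK)
    · exact hK

lemma OrdGe.succ_of_isClosureFull (hf : OrdGe f m) {K : List ℕ}
    {R : List (List (ℤ × ℤ) × List ℕ)} (n : ℕ)
    (hR : (R.all fun r ↦ IsRelation N m r.1 r.2) = true)
    (hfull : IsClosureFull N n (R.map Prod.snd) K = true)
    (hK : ∀ x ∈ K, LeadZero f m x) : OrdGe f (m + 1) := by
  have hP : ∀ P ∈ R.map Prod.snd, ∃ e, IsRelation N m e P = true := by
    intro P hP
    obtain ⟨r, hr, rfl⟩ := List.mem_map.mp hP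
    exact ⟨r.1, List.all_eq_true.mp hR r hr⟩
  have hK' : ∀ x ∈ (closureRound N (R.map Prod.snd))^[n] K, LeadZero f m x := by
    clear hfull
    induction n generalizing K with
    | zero => exact hK
    | succ n ih => exact ih (leadZero_closureRound hf hP hK)
  refine OrdGe.succ fun s hs ↦ ?_
  have h1 := List.all_eq_true.mp hfull s.val (List.mem_range.mpr s.val_lt)
  have h2 : Nat.gcd s.val N = 1 := by
    rw [← ZMod.natCast_zmod_val s] at hs
    exact (ZMod.isUnit_iff_coprime _ _).mp hs
  simp only [h2, bne_self_eq_false, Bool.false_or] at h1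
  simpa using leadZero_of_memUpToSign hK' h1

lemma OrdGe.succ_of_isRelation (hf : OrdGe f m) (e : List (ℤ × ℤ)) (b : ℕ)
    (h : IsRelation N m e [b] = true) : OrdGe f (m + 1) := by
  have hb : IsUnit (b : ZMod N) := by
    simp only [IsRelation, Bool.and_eq_true, List.all_cons, beq_iff_eq] at h
    exact (ZMod.isUnit_iff_coprime b N).mpr h.1.2.1.2
  obtain ⟨c, hc⟩ := hb.exists_right_inv
  refine OrdGe.succ fun s hs ↦ ?_
  have := leadZero_of_isRelation h hf (s := s * c)
    (hs.mul (IsUnit.of_mul_eq_one (b : ZMod N) ((mul_comm _ _).trans hc)))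
    (List.mem_singleton.mpr rfl) (fun p hp hpb ↦ absurd (List.mem_singleton.mp hp) hpb)
  rwa [show s * c * (b : ZMod N) = s by linear_combination s * hc] at this

end CuspForm

/-! ### Bounds for the dimension -/

section Rank

variable {N : ℕ}

/-- The cusp forms in `W` whose expansion at a cusp has a vanishing coefficient. -/
def leadKer (W : Submodule ℂ (CuspForm (Gamma1 N) 1)) (γ : SL(2, ℤ)) (s : ℝ) :
    Submodule ℂ (CuspForm (Gamma1 N) 1) where
  carrier := {f | f ∈ W ∧ HasLead ((f : ℍ → ℂ) ∣[(1 : ℤ)] γ) s 0}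
  zero_mem' := ⟨W.zero_mem, by simp [HasLead]⟩
  add_mem' := fun hf hg ↦ ⟨W.add_mem hf.1 hg.1, by
    have := hf.2.add hg.2
    rw [add_zero] at this
    simpa using this⟩
  smul_mem' := fun c f hf ↦ ⟨W.smul_mem c hf.1, by
    have := hf.2.const_mul c
    rw [mul_zero] at this
    refine this.congr fun τ ↦ ?_
    simp⟩

lemma rank_le_rank_leadKer_add_one (W : Submodule ℂ (CuspForm (Gamma1 N) 1)) (γ : SL(2, ℤ))
    (s : ℝ) (h : ∀ f ∈ W, ∃ β, HasLead ((f : ℍ → ℂ) ∣[(1 : ℤ)] γ) s β) :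
    Module.rank ℂ W ≤ Module.rank ℂ (leadKer W γ s) + 1 := by
  choose! φ hφ using h
  let L : W →ₗ[ℂ] ℂ :=
    { toFun := fun f ↦ φ f
      map_add' := fun f g ↦ (hφ _ (f + g).2).unique (by
        have := (hφ _ f.2).add (hφ _ g.2)
        simpa using this)
      map_smul' := fun c f ↦ (hφ _ (c • f).2).unique (by
        refine ((hφ _ f.2).const_mul c).congr fun τ ↦ ?_
        simp) }
  rw [← LinearMap.rank_range_add_rank_ker L, add_comm]
  refine add_le_add ?_ ?_
  · refine LinearMap.rank_le_of_injective
      ((W.subtype.comp (LinearMap.ker L).subtype).codRestrict (leadKer W γ s) fun f ↦ ?_) ?_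
    · refine ⟨f.1.2, ?_⟩
      have h1 := hφ _ f.1.2
      rwa [show φ f.1 = 0 from f.2] at h1
    · intro f g hfg
      have h1 := congrArg (leadKer W γ s).subtype hfg
      simp only [Submodule.subtype_apply] at h1
      exact Subtype.ext (Subtype.ext h1)
  · simpa using Submodule.rank_le (LinearMap.range L)

lemma rank_le_one_of_hasLead (γ : SL(2, ℤ)) (s : ℝ)
    (h : ∀ f : CuspForm (Gamma1 N) 1, ∃ β, HasLead ((f : ℍ → ℂ) ∣[(1 : ℤ)] γ) s β)
    (h0 : ∀ f : CuspForm (Gamma1 N) 1, HasLead ((f : ℍ → ℂ) ∣[(1 : ℤ)] γ) s 0 → f = 0) :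
    Module.rank ℂ (CuspForm (Gamma1 N) 1) ≤ 1 := by
  have h1 := rank_le_rank_leadKer_add_one ⊤ γ s fun f _ ↦ h f
  rw [show leadKer ⊤ γ s = (⊥ : Submodule ℂ (CuspForm (Gamma1 N) 1)) from
    (Submodule.eq_bot_iff _).mpr fun f hf ↦ h0 f hf.2] at h1
  simpa using h1

lemma rank_le_two_of_hasLead (γ γ' : SL(2, ℤ)) (s s' : ℝ)
    (h : ∀ f : CuspForm (Gamma1 N) 1, ∃ β, HasLead ((f : ℍ → ℂ) ∣[(1 : ℤ)] γ) s β)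
    (h' : ∀ f : CuspForm (Gamma1 N) 1, HasLead ((f : ℍ → ℂ) ∣[(1 : ℤ)] γ) s 0 →
      ∃ β, HasLead ((f : ℍ → ℂ) ∣[(1 : ℤ)] γ') s' β)
    (h0 : ∀ f : CuspForm (Gamma1 N) 1, HasLead ((f : ℍ → ℂ) ∣[(1 : ℤ)] γ) s 0 →
      HasLead ((f : ℍ → ℂ) ∣[(1 : ℤ)] γ') s' 0 → f = 0) :
    Module.rank ℂ (CuspForm (Gamma1 N) 1) ≤ 2 := by
  have h1 := rank_le_rank_leadKer_add_one ⊤ γ s fun f _ ↦ h f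
  have h2 := rank_le_rank_leadKer_add_one (leadKer ⊤ γ s) γ' s' fun f hf ↦ h' f hf.2
  rw [show leadKer (leadKer ⊤ γ s) γ' s' = (⊥ : Submodule ℂ (CuspForm (Gamma1 N) 1)) from
    (Submodule.eq_bot_iff _).mpr fun f hf ↦ h0 f hf.1.2 hf.2] at h2
  rw [rank_bot, zero_add] at h2
  rw [rank_top] at h1
  refine h1.trans ((add_le_add_left h2 1).trans ?_)
  norm_num

end Rank

/-! ### Upper bounds -/

/-- The list of exponents constant on the residues with a given greatest common divisor with `N`. -/
def gcdExponents (N : ℕ) (c : ℕ → ℤ) : List (ℤ × ℤ) :=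
  (List.range (N / 2)).map fun j ↦ ((j + 1 : ℕ), c (Nat.gcd (j + 1) N))

/-- A matrix with lower left entry `s`. -/
def lowerUnipotent (s : ℤ) : SL(2, ℤ) := ⟨!![1, 0; s, 1], by simp [Matrix.det_fin_two]⟩

lemma leadZero_lowerUnipotent {N : ℕ} [NeZero N] {f : CuspForm (Gamma1 N) 1} {m s : ℕ}
    (hs : Nat.gcd s N = 1)
    (h : HasLead ((f : ℍ → ℂ) ∣[(1 : ℤ)] lowerUnipotent s) (m / N) 0) : LeadZero f m s := by
  have h1 : ((lowerUnipotent s 1 0 : ℤ) : ZMod N) = s := by simp [lowerUnipotent]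
  rw [← h1]
  exact leadZero_of_hasLead (h1 ▸ (ZMod.isUnit_iff_coprime s N).mpr hs) h

lemma OrdGe.exists_hasLead {N : ℕ} [NeZero N] {f : CuspForm (Gamma1 N) 1} {m : ℕ}
    (hf : OrdGe f m) {s : ℕ} (hs : Nat.gcd s N = 1) :
    ∃ β, HasLead ((f : ℍ → ℂ) ∣[(1 : ℤ)] lowerUnipotent s) (m / N) β :=
  hf _ (by
    have h1 : ((lowerUnipotent s 1 0 : ℤ) : ZMod N) = s := by simp [lowerUnipotent]
    exact h1 ▸ (ZMod.isUnit_iff_coprime s N).mpr hs)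

/-- Up to a scalar there is at most one cusp form if vanishing at one cusp propagates. -/
lemma rank_le_one_of_propagation {N : ℕ} [NeZero N]
    (h : ∀ f : CuspForm (Gamma1 N) 1, LeadZero f 1 (1 : ℕ) → f = 0) :
    Module.rank ℂ (CuspForm (Gamma1 N) 1) ≤ 1 :=
  rank_le_one_of_hasLead (lowerUnipotent (1 : ℕ)) ((1 : ℕ) / N)
    (fun f ↦ (ordGe_one f).exists_hasLead (Nat.gcd_one_left N))
    (fun f hf ↦ h f (leadZero_lowerUnipotent (Nat.gcd_one_left N) hf))

lemma rank_le_two_of_propagation {N : ℕ} [NeZero N] (s m : ℕ) (hs : Nat.gcd s N = 1)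
    (h1 : ∀ f : CuspForm (Gamma1 N) 1, LeadZero f 1 (1 : ℕ) → OrdGe f m)
    (h : ∀ f : CuspForm (Gamma1 N) 1, LeadZero f 1 (1 : ℕ) → LeadZero f m s → f = 0) :
    Module.rank ℂ (CuspForm (Gamma1 N) 1) ≤ 2 :=
  rank_le_two_of_hasLead (lowerUnipotent (1 : ℕ)) (lowerUnipotent s) ((1 : ℕ) / N) (m / N)
    (fun f ↦ (ordGe_one f).exists_hasLead (Nat.gcd_one_left N))
    (fun f hf ↦ (h1 f (leadZero_lowerUnipotent (Nat.gcd_one_left N) hf)).exists_hasLead hs)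
    (fun f hf hf' ↦ h f (leadZero_lowerUnipotent (Nat.gcd_one_left N) hf)
      (leadZero_lowerUnipotent hs hf'))

lemma rank_le_one_level_31 : Module.rank ℂ (CuspForm (Gamma1 31) 1) ≤ 1 := by
  refine rank_le_one_of_propagation fun f hf ↦ ?_
  have h2 : OrdGe f 2 := (ordGe_one f).succ_of_isClosureFull (K := [1]) (R := [([(1, -1), (5,
    -1), (11, 1), (14, -1), (15, 1)], [1, 7])]) 2 (by decide +kernel) (by decide +kernel) (by
    simpa using hf)
  have h3 : OrdGe f 3 := h2.succ_of_isRelation [(3, 2), (8, -1), (9, -1), (11, -1)] 14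
    (by decide +kernel)
  exact eq_zero_of_isKiller (e := gcdExponents 31 fun _ ↦ 1) (by decide +kernel) h3

lemma rank_le_one_level_39 : Module.rank ℂ (CuspForm (Gamma1 39) 1) ≤ 1 := by
  refine rank_le_one_of_propagation fun f hf ↦ ?_
  have h2 : OrdGe f 2 := (ordGe_one f).succ_of_isClosureFull (K := [1]) (R := [([(1, 1), (2,
    -1), (3, -1), (5, 1), (6, 1), (7, -1), (8, -1), (9, -1), (10, -1), (14, 1), (19, 1)], [4,
    5])]) 2 (by decide +kernel) (by decide +kernel) (by simpa using hf)
  have h3 : OrdGe f 3 := h2.succ_of_isRelation [(10, -1), (13, 1), (15, -1)] 8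
    (by decide +kernel)
  exact eq_zero_of_isKiller (e := gcdExponents 39 fun g ↦ if g = 3 then -3 else if g = 13 then 3
    else 2) (by decide +kernel) h3

lemma rank_le_one_level_44 : Module.rank ℂ (CuspForm (Gamma1 44) 1) ≤ 1 := by
  refine rank_le_one_of_propagation fun f hf ↦ ?_
  have h2 : OrdGe f 2 := (ordGe_one f).succ_of_isClosureFull (K := [1]) (R := [([(2, -1), (4,
    -1), (5, 1), (6, 1), (7, -1), (12, -1), (16, 1), (18, -1), (22, 1)], [19, 21])]) 1
    (by decide +kernel) (by decide +kernel) (by simpa using hf)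
  have h3 : OrdGe f 3 := h2.succ_of_isRelation [(8, -1), (17, -1), (21, 1)] 5
    (by decide +kernel)
  exact eq_zero_of_isKiller (e := gcdExponents 44 fun g ↦ if g = 1 then 2 else if g = 2 then -1
    else if g = 4 then -2 else 0) (by decide +kernel) h3

lemma rank_le_one_level_55 : Module.rank ℂ (CuspForm (Gamma1 55) 1) ≤ 1 := by
  refine rank_le_one_of_propagation fun f hf ↦ ?_
  have h2 : OrdGe f 2 := (ordGe_one f).succ_of_isClosureFull (K := [1]) (R := [([(2, -1), (10,
    -1), (18, 1)], [1, 27])]) 3 (by decide +kernel) (by decide +kernel) (by simpa using hf)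
  have h3 : OrdGe f 3 := h2.succ_of_isRelation [(7, -1), (11, 1), (22, -2), (26, 1)] 8
    (by decide +kernel)
  have h4 : OrdGe f 4 := h3.succ_of_isRelation [(10, -1), (13, 1), (27, -1)] 6
    (by decide +kernel)
  exact eq_zero_of_isKiller (e := gcdExponents 55 fun g ↦ if g = 5 then -2 else if g = 11 then 0
    else 1) (by decide +kernel) h4

lemma rank_le_one_level_56 : Module.rank ℂ (CuspForm (Gamma1 56) 1) ≤ 1 := by
  refine rank_le_one_of_propagation fun f hf ↦ ?_
  have h2 : OrdGe f 2 := (ordGe_one f).succ_of_isClosureFull (K := [1]) (R := [([(8, 1), (9,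
    -1), (16, -1), (24, -1), (25, 1)], [19, 25]), ([(4, -1), (15, 1), (21, -1), (25, 1), (27,
    -1)], [13, 27])]) 1 (by decide +kernel) (by decide +kernel) (by simpa using hf)
  have h3 : OrdGe f 3 := h2.succ_of_isRelation [(3, 1), (8, -1), (13, -1)] 13
    (by decide +kernel)
  have h4 : OrdGe f 4 := h3.succ_of_isRelation [(3, 1), (7, -1), (11, -1), (12, -1), (23, 1)] 9
    (by decide +kernel)
  have h5 : OrdGe f 5 := h4.succ_of_isRelation [(2, -1), (3, 1), (5, -1), (8, -1), (20, -1),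
    (22, 1), (28, 1)] 11 (by decide +kernel)
  exact eq_zero_of_isKiller (e := gcdExponents 56 fun g ↦ if g = 1 then 2 else if g = 4 then -4
    else if g = 8 then -1 else if g = 14 then -2 else if g = 28 then 1 else 0)
    (by decide +kernel) h5

lemma rank_le_one_level_59 : Module.rank ℂ (CuspForm (Gamma1 59) 1) ≤ 1 := by
  refine rank_le_one_of_propagation fun f hf ↦ ?_
  have h2 : OrdGe f 2 := (ordGe_one f).succ_of_isClosureFull (K := [1]) (R := [([(9, -1), (18,
    1), (19, -1)], [25, 28]), ([(12, -1), (15, -1), (29, 1)], [5, 15])]) 3 (by decide +kernel)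
    (by decide +kernel) (by simpa using hf)
  have h3 : OrdGe f 3 := h2.succ_of_isRelation [(4, -1), (5, -1), (9, 1), (12, -1), (24, 1)] 1
    (by decide +kernel)
  have h4 : OrdGe f 4 := h3.succ_of_isRelation [(2, -1), (7, 1), (8, 1), (18, -1), (27, -1)] 13
    (by decide +kernel)
  have h5 : OrdGe f 5 := h4.succ_of_isRelation [(1, -1), (8, -1), (9, 2), (12, -1), (23, -1),
    (24, 1)] 23 (by decide +kernel)
  exact eq_zero_of_isKiller (e := gcdExponents 59 fun _ ↦ 2) (by decide +kernel) h5

lemma rank_le_two_level_47 : Module.rank ℂ (CuspForm (Gamma1 47) 1) ≤ 2 := by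
  have hord (f : CuspForm (Gamma1 47) 1) (hf : LeadZero f 1 (1 : ℕ)) : OrdGe f 2 := by
    exact (ordGe_one f).succ_of_isClosureFull (K := [1]) (R := [([(5, -1), (12,
      1), (17, -1), (18, -1), (20, 1)], [11, 18]), ([(9, -1), (10, -1), (15, 1), (16, -1), (20,
      1)], [5, 15])]) 1 (by decide +kernel) (by decide +kernel) (by simpa using hf)
  refine rank_le_two_of_propagation 1 2 rfl hord fun f hf hf' ↦ ?_
  have h3 : OrdGe f 3 := (hord f hf).succ_of_isClosureFull (K := [1]) (R := [([(2, -1), (3, 1),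
    (5, -1), (13, -1), (14, 1), (17, 1), (22, -1)], [18, 21])]) 4 (by decide +kernel)
    (by decide +kernel) (by simpa using hf')
  have h4 : OrdGe f 4 := h3.succ_of_isRelation [(1, 1), (14, -1), (17, -1), (19, 1), (21, -1)]
    11 (by decide +kernel)
  exact eq_zero_of_isKiller (e := gcdExponents 47 fun _ ↦ 1) (by decide +kernel) h4

lemma rank_le_two_level_52 : Module.rank ℂ (CuspForm (Gamma1 52) 1) ≤ 2 := by
  refine rank_le_two_of_propagation 3 1 rfl (fun f _ ↦ ordGe_one f) fun f hf hf' ↦ ?_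
  have h2 : OrdGe f 2 := (ordGe_one f).succ_of_isClosureFull (K := [1, 3]) (R := [([(1, -1), (2,
    1), (5, -1), (8, -1), (9, 1), (10, -1), (11, 1), (12, -1), (14, -1), (15, 1), (16, -1), (17,
    1), (20, 1), (21, -1), (24, 1), (25, -1), (26, 1)], [1, 25]), ([(1, -1), (3, 1), (5, 1), (6,
    -1), (7, -1), (8, 1), (10, -1), (12, -1), (16, -1), (18, 1), (23, 1), (25, -1), (26, 1)],
    [5, 15, 17])]) 1 (by decide +kernel) (by decide +kernel) (by simpa using ⟨hf, hf'⟩)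
  have h3 : OrdGe f 3 := h2.succ_of_isRelation [(4, -2), (7, -1), (8, 1), (11, 1)] 15
    (by decide +kernel)
  have h4 : OrdGe f 4 := h3.succ_of_isRelation [(5, -1), (6, 1), (14, -1), (16, -1), (21, 1)] 11
    (by decide +kernel)
  exact eq_zero_of_isKiller (e := gcdExponents 52 fun g ↦ if g = 2 then -4 else if g = 4 then -7
    else if g = 13 then 0 else if g = 26 then 3 else 7) (by decide +kernel) h4

lemma rank_le_two_level_57 : Module.rank ℂ (CuspForm (Gamma1 57) 1) ≤ 2 := by
  refine rank_le_two_of_propagation 2 1 rfl (fun f _ ↦ ordGe_one f) fun f hf hf' ↦ ?_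
  have h2 : OrdGe f 2 := (ordGe_one f).succ_of_isClosureFull (K := [1, 2]) (R := [([(10, 1),
    (13, -1), (27, -1)], [4, 13]), ([(2, -1), (10, -1), (16, 1), (18, -1), (20, 1)], [1, 16,
    28])]) 1 (by decide +kernel) (by decide +kernel) (by simpa using ⟨hf, hf'⟩)
  have h3 : OrdGe f 3 := h2.succ_of_isRelation [(2, -1), (7, 1), (27, -1)] 2 (by decide +kernel)
  have h4 : OrdGe f 4 := h3.succ_of_isRelation [(1, -1), (5, -1), (6, 1), (11, -1), (15, 1)] 5
    (by decide +kernel)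
  have h5 : OrdGe f 5 := h4.succ_of_isRelation [(6, -1), (10, -1), (11, 1), (17, 1), (23, -2),
    (28, 1)] 5 (by decide +kernel)
  exact eq_zero_of_isKiller (e := gcdExponents 57 fun g ↦ if g = 3 then -3 else if g = 19 then 9
    else 2) (by decide +kernel) h5

/-! ### Positive definite binary quadratic forms -/

/-- A positive definite integral binary quadratic form `a x² + b x y + c y²`. -/
structure PosForm where
  a : ℤ
  b : ℤ
  c : ℤ
  a_pos : 0 < a
  disc_pos : 0 < 4 * a * c - b ^ 2

namespace PosForm

variable (Q : PosForm)

/-- The absolute value of the discriminant. -/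
def disc : ℤ := 4 * Q.a * Q.c - Q.b ^ 2

/-- The value of a form at `(x, y)`. -/
def val {R : Type*} [CommRing R] (x y : R) : R := Q.a * x ^ 2 + Q.b * x * y + Q.c * y ^ 2

lemma c_pos : 0 < Q.c := by
  have h1 := Q.disc_pos
  have h2 := Q.a_pos
  by_contra h
  nlinarith [sq_nonneg Q.b]

/-- The adjoint form `c x² - b x y + a y²`. -/
def adj : PosForm where
  a := Q.c
  b := -Q.b
  c := Q.a
  a_pos := Q.c_pos
  disc_pos := by
    have := Q.disc_pos
    nlinarith

lemma disc_cast {R : Type*} [CommRing R] : (Q.disc : R) = 4 * Q.a * Q.c - Q.b ^ 2 := by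
  simp [disc]

lemma disc_pos' : (0 : ℝ) < Q.disc := by exact_mod_cast Q.disc_pos

lemma val_cast {R : Type*} [CommRing R] (x y : ℤ) : ((Q.val x y : ℤ) : R) = Q.val (x : R) y := by
  simp [val]

lemma val_smul {R : Type*} [CommRing R] (t x y : R) :
    Q.val (t * x) (t * y) = t ^ 2 * Q.val x y := by
  simp only [val]
  ring

lemma mul_sq_le_val_left (x y : ℝ) : Q.disc * x ^ 2 ≤ 4 * Q.c * Q.val x y := by
  rw [Q.disc_cast, val]
  nlinarith [sq_nonneg (Q.b * x + 2 * Q.c * y)]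

lemma mul_sq_le_val_right (x y : ℝ) : Q.disc * y ^ 2 ≤ 4 * Q.a * Q.val x y := by
  rw [Q.disc_cast, val]
  nlinarith [sq_nonneg (2 * Q.a * x + Q.b * y)]

lemma exists_le_val : ∃ δ > 0, ∀ x y : ℝ, δ * (x ^ 2 + y ^ 2) ≤ Q.val x y := by
  have ha : (0 : ℝ) < Q.a := by exact_mod_cast Q.a_pos
  have hc : (0 : ℝ) < Q.c := by exact_mod_cast Q.c_pos
  refine ⟨Q.disc / (4 * (Q.a + Q.c)), div_pos Q.disc_pos' (by positivity), fun x y ↦ ?_⟩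
  rw [div_mul_eq_mul_div, div_le_iff₀ (by positivity)]
  linarith [Q.mul_sq_le_val_left x y, Q.mul_sq_le_val_right x y]

lemma val_nonneg (x y : ℝ) : 0 ≤ Q.val x y := by
  obtain ⟨δ, hδ, h⟩ := Q.exists_le_val
  exact (by positivity : 0 ≤ δ * (x ^ 2 + y ^ 2)).trans (h x y)

lemma val_pos {x y : ℝ} (h : x ≠ 0 ∨ y ≠ 0) : 0 < Q.val x y := by
  obtain ⟨δ, hδ, hle⟩ := Q.exists_le_val
  refine lt_of_lt_of_le (mul_pos hδ ?_) (hle x y)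
  rcases h with h | h <;> positivity

end PosForm

lemma summable_exp_neg_sq {C : ℝ} (hC : 0 < C) (α : ℝ) :
    Summable fun n : ℤ ↦ Real.exp (-(C * (n + α) ^ 2)) := by
  have h := ((summable_jacobiTheta₂_term_iff ((α * (C / π) : ℝ) * I) ((C / π : ℝ) * I)).mpr
    (by simp; positivity)).norm.mul_left (Real.exp (-(C * α ^ 2)))
  refine h.congr fun n ↦ ?_
  rw [norm_jacobiTheta₂_term, ← Real.exp_add]
  congr 1
  simp only [mul_im, ofReal_re, ofReal_im, Complex.I_im, Complex.I_re]
  field_simp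
  ring

lemma PosForm.summable_exp_neg (Q : PosForm) {C : ℝ} (hC : 0 < C) (α β : ℝ) :
    Summable fun n : ℤ × ℤ ↦ Real.exp (-(C * Q.val (n.1 + α) (n.2 + β))) := by
  obtain ⟨δ, hδ, hle⟩ := Q.exists_le_val
  refine Summable.of_nonneg_of_le (fun n ↦ (Real.exp_pos _).le) (fun n ↦ ?_)
    ((summable_exp_neg_sq (mul_pos hC hδ) α).mul_of_nonneg
      (summable_exp_neg_sq (mul_pos hC hδ) β) (fun _ ↦ (Real.exp_pos _).le)
      fun _ ↦ (Real.exp_pos _).le)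
  rw [← Real.exp_add]
  refine Real.exp_le_exp.mpr ?_
  have := mul_le_mul_of_nonneg_left (hle (n.1 + α) (n.2 + β)) hC.le
  linarith

/-- The function `z ↦ exp (2 π i z)`. -/
noncomputable def expI (z : ℂ) : ℂ := cexp (2 * π * I * z)

lemma expI_add (z w : ℂ) : expI (z + w) = expI z * expI w := by
  rw [expI, expI, expI, ← Complex.exp_add, mul_add]

lemma norm_expI (z : ℂ) : ‖expI z‖ = Real.exp (-(2 * π * z.im)) := by
  rw [expI, norm_exp]
  congr 1
  have : 2 * π * I * z = ((2 * π : ℝ) : ℂ) * (I * z) := by push_cast; ring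
  rw [this, re_ofReal_mul]
  simp

lemma expI_int (n : ℤ) : expI n = 1 := by
  rw [expI, mul_comm]
  exact exp_int_mul_two_pi_mul_I n

lemma PosForm.norm_expI_val (Q : PosForm) (x y : ℝ) (z : ℂ) :
    ‖expI (Q.val (x : ℂ) y * z)‖ = Real.exp (-(2 * π * z.im * Q.val x y)) := by
  rw [norm_expI]
  congr 1
  have : Q.val (x : ℂ) y = (Q.val x y : ℝ) := by simp [PosForm.val]
  rw [this, im_ofReal_mul]
  ring

lemma PosForm.summable_expI (Q : PosForm) {z : ℂ} (hz : 0 < z.im) (α β : ℝ) :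
    Summable fun n : ℤ × ℤ ↦ expI (Q.val (n.1 + α : ℂ) (n.2 + β) * z) := by
  refine Summable.of_norm ?_
  refine (Q.summable_exp_neg (mul_pos Real.two_pi_pos hz) α β).congr fun n ↦ ?_
  rw [← Q.norm_expI_val]
  push_cast
  rfl

lemma summable_gaussian {z : ℂ} (hz : 0 < z.re) (α : ℝ) :
    Summable fun n : ℤ ↦ ‖cexp (-π * z * (n + α) ^ 2)‖ := by
  refine (summable_exp_neg_sq (mul_pos Real.pi_pos hz) α).congr fun n ↦ ?_
  rw [norm_exp]
  congr 1
  have : -π * z * (n + α) ^ 2 = ((-π * (n + α) ^ 2 : ℝ) : ℂ) * z := by push_cast; ring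
  rw [this, re_ofReal_mul]
  ring

lemma ofReal_mul_cpow_half {r : ℝ} (hr : 0 < r) {z : ℂ} (hz : z ≠ 0) :
    ((r : ℂ) * z) ^ (1 / 2 : ℂ) = √r * z ^ (1 / 2 : ℂ) := by
  rw [cpow_def_of_ne_zero (mul_ne_zero (by exact_mod_cast hr.ne') hz), cpow_def_of_ne_zero hz,
    log_ofReal_mul hr hz, add_mul, Complex.exp_add, Real.sqrt_eq_rpow, ofReal_cpow hr.le,
    cpow_def_of_ne_zero (by exact_mod_cast hr.ne'), ofReal_log hr.le]
  norm_num

lemma PosForm.tsum_inversion (Q : PosForm) {w : ℂ} (hw : 0 < w.im) (α β : ℝ) :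
    ∑' n : ℤ × ℤ, expI (Q.val (n.1 + α : ℂ) (n.2 + β) * (-w⁻¹)) =
      w / (I * √Q.disc) *
        ∑' k : ℤ × ℤ, expI (Q.adj.val (k.1 : ℂ) k.2 * (w / Q.disc) + (α * k.1 + β * k.2)) := by
  have hw0 : w ≠ 0 := fun h ↦ by simp [h] at hw
  have ha : (0 : ℝ) < Q.a := by exact_mod_cast Q.a_pos
  have haC : (Q.a : ℂ) ≠ 0 := by exact_mod_cast Q.a_pos.ne'
  have hD := Q.disc_pos'
  have hDC : (Q.disc : ℂ) ≠ 0 := by exact_mod_cast hD.ne'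
  have hDeq : (Q.disc : ℂ) = 4 * Q.a * Q.c - Q.b ^ 2 := Q.disc_cast
  have hneg : 0 < (-w⁻¹).im := by
    rw [neg_im, inv_im, neg_div, neg_neg]
    exact div_pos hw (normSq_pos.mpr hw0)
  set z : ℂ := -I * (-w⁻¹) with hz
  have hzre : 0 < z.re := by simpa [hz] using hneg
  have hz0 : z ≠ 0 := by simp [hz, hw0]
  have hzinv : z⁻¹ = -I * w := by
    rw [hz, mul_inv, inv_neg, inv_I, inv_neg, inv_inv]
    ring
  have hzw : -w⁻¹ = I * z := by
    rw [hz]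
    linear_combination -w⁻¹ * I_sq
  clear_value z
  set t₁ : ℂ := ((2 * Q.a : ℝ) : ℂ) * z with ht₁
  set t₂ : ℂ := ((Q.disc / (2 * Q.a) : ℝ) : ℂ) * z with ht₂
  have h₁ : 0 < t₁.re := by
    rw [ht₁, re_ofReal_mul]
    positivity
  have h₂ : 0 < t₂.re := by
    rw [ht₂, re_ofReal_mul]
    positivity
  have hroot : t₁ ^ (1 / 2 : ℂ) * t₂ ^ (1 / 2 : ℂ) = √Q.disc * z := by
    rw [ht₁, ht₂, ofReal_mul_cpow_half (by positivity) hz0,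
      ofReal_mul_cpow_half (by positivity) hz0, mul_mul_mul_comm, ← cpow_add _ _ hz0,
      ← ofReal_mul, ← Real.sqrt_mul (by positivity)]
    norm_num
    left
    congr 2
    field_simp
  set G : ℤ → ℤ → ℂ := fun n k ↦ cexp (-π * t₂ * (n + β) ^ 2 +
    2 * π * I * (Q.b * k / (2 * Q.a) : ℝ) * (n + β)) *
      cexp (-π * k ^ 2 / t₁ + 2 * π * I * α * k) with hG
  have hinv : 0 < (t₁⁻¹).re := by
    rw [inv_re]
    exact div_pos h₁ (normSq_pos.mpr fun h ↦ by simp [h] at h₁)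
  have hGsum : Summable (Function.uncurry G) := by
    refine Summable.of_norm (((summable_gaussian h₂ β).mul_of_nonneg
      (summable_gaussian hinv 0) (fun _ ↦ norm_nonneg _) fun _ ↦ norm_nonneg _).congr fun n ↦ ?_)
    simp only [Function.uncurry, hG, norm_mul, Complex.exp_add]
    have e1 : ‖cexp (2 * π * I * (Q.b * n.2 / (2 * Q.a) : ℝ) * (n.1 + β))‖ = 1 := by
      rw [← norm_exp_ofReal_mul_I (2 * π * (Q.b * n.2 / (2 * Q.a)) * (n.1 + β))]
      congr 2
      push_cast
      ring
    have e2 : ‖cexp (2 * π * I * α * n.2)‖ = 1 := by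
      rw [← norm_exp_ofReal_mul_I (2 * π * α * n.2)]
      congr 2
      push_cast
      ring
    rw [e1, e2, mul_one, mul_one]
    congr 3
    push_cast
    ring
  have hsum₁ : ∀ n₂ : ℤ, ∑' n₁ : ℤ, expI (Q.val (n₁ + α : ℂ) (n₂ + β) * (-w⁻¹)) =
      1 / t₁ ^ (1 / 2 : ℂ) * ∑' k : ℤ, G n₂ k := by
    intro n₂
    have h := tsum_gaussian_shift h₁ (α + Q.b * (n₂ + β) / (2 * Q.a)) 0
    calc ∑' n₁ : ℤ, expI (Q.val (n₁ + α : ℂ) (n₂ + β) * (-w⁻¹))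
        = ∑' n₁ : ℤ, cexp (-π * t₂ * (n₂ + β) ^ 2) * cexp (-π * t₁ * (n₁ +
            (α + Q.b * (n₂ + β) / (2 * Q.a) : ℝ)) ^ 2 + 2 * π * I * (0 : ℝ) * (n₁ +
            (α + Q.b * (n₂ + β) / (2 * Q.a) : ℝ))) := by
          refine tsum_congr fun n₁ ↦ ?_
          rw [← Complex.exp_add, expI, hzw, ht₁, ht₂, PosForm.val]
          congr 1
          push_cast
          rw [hDeq]
          field_simp
          rw [I_sq]
          ring
      _ = _ := by
          rw [tsum_mul_left, h, mul_left_comm, ← tsum_mul_left]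
          congr 1
          refine tsum_congr fun k ↦ ?_
          simp only [hG]
          rw [← Complex.exp_add, ← Complex.exp_add]
          congr 1
          push_cast
          ring
  have hsum₂ : ∀ k₁ : ℤ, ∑' n : ℤ, G n k₁ = 1 / t₂ ^ (1 / 2 : ℂ) *
      ∑' k₂ : ℤ, expI (Q.adj.val (k₁ : ℂ) k₂ * (w / Q.disc) + (α * k₁ + β * k₂)) := by
    intro k₁
    have h := tsum_gaussian_shift h₂ β (Q.b * k₁ / (2 * Q.a))
    rw [hG, tsum_mul_right, h, mul_right_comm, mul_assoc, ← tsum_mul_left]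
    congr 1
    refine tsum_congr fun k₂ ↦ ?_
    rw [← Complex.exp_add, expI, PosForm.val, PosForm.adj]
    congr 1
    rw [ht₁, ht₂, div_eq_mul_inv (-π * (k₁ : ℂ) ^ 2), div_eq_mul_inv (-(π : ℂ) * _), mul_inv,
      mul_inv, hzinv]
    push_cast
    field_simp
    rw [hDeq]
    ring
  have hF := Q.summable_expI hneg α β
  have hR : Summable fun k : ℤ × ℤ ↦
      expI (Q.adj.val (k.1 : ℂ) k.2 * (w / Q.disc) + (α * k.1 + β * k.2)) := by
    have him : 0 < (w / Q.disc).im := by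
      rw [show (w / Q.disc) = ((Q.disc : ℝ)⁻¹ : ℝ) * w by push_cast; ring, im_ofReal_mul]
      positivity
    refine Summable.of_norm ((Q.adj.summable_expI him 0 0).norm.congr fun k ↦ ?_)
    have : ‖expI (α * k.1 + β * k.2)‖ = 1 := by
      rw [norm_expI]
      simp
    rw [expI_add, norm_mul, this, mul_one]
    simp
  rw [hF.tsum_prod, hR.tsum_prod, ← Summable.tsum_comm (f := fun n₁ n₂ : ℤ ↦
    expI (Q.val (n₁ + α : ℂ) (n₂ + β) * (-w⁻¹))) hF]
  simp_rw [hsum₁]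
  rw [tsum_mul_left, ← Summable.tsum_comm (f := G) hGsum]
  simp_rw [hsum₂]
  rw [tsum_mul_left, ← mul_assoc]
  congr 1
  rw [div_mul_div_comm, hroot, one_mul, one_div, mul_inv, hzinv, ← div_eq_inv_mul,
    div_mul_eq_div_div, div_I]
  congr 1
  ring

/-! ### Theta series of binary quadratic forms -/

/-- The theta series of `Q` weighted by a function on `ℤ × ℤ`. -/
noncomputable def PosForm.thetaSum (Q : PosForm) (f : ℤ × ℤ → ℂ) (z : ℂ) : ℂ :=
  ∑' x : ℤ × ℤ, f x * expI (Q.val (x.1 : ℂ) x.2 * z)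

lemma PosForm.summable_thetaSum (Q : PosForm) {f : ℤ × ℤ → ℂ} {B : ℝ} (hf : ∀ x, ‖f x‖ ≤ B)
    {z : ℂ} (hz : 0 < z.im) :
    Summable fun x : ℤ × ℤ ↦ f x * expI (Q.val (x.1 : ℂ) x.2 * z) := by
  refine Summable.of_norm (Summable.of_nonneg_of_le (fun _ ↦ norm_nonneg _) (fun x ↦ ?_)
    ((Q.summable_expI hz 0 0).norm.mul_left B))
  rw [norm_mul]
  simpa using mul_le_mul_of_nonneg_right (hf x) (norm_nonneg _)

/-- The representation of integers by a residue and a quotient. -/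
def residueEquiv (M : ℕ) [NeZero M] : ZMod M × ℤ ≃ ℤ where
  toFun p := p.1.val + M * p.2
  invFun x := (x, x / M)
  left_inv p := by
    have hM : (M : ℤ) ≠ 0 := by exact_mod_cast NeZero.ne M
    have h1 : ((p.1.val : ℤ) + M * p.2) / M = p.2 := by
      rw [Int.add_mul_ediv_left _ _ hM, Int.ediv_eq_zero_of_lt (by positivity), zero_add]
      exact_mod_cast ZMod.val_lt p.1
    ext
    · simp
    · exact h1
  right_inv x := by
    simp only [ZMod.val_intCast]
    exact Int.emod_add_mul_ediv x M

/-- The finite Fourier transform of a function on `(ZMod M)²`, at an integral point. -/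
noncomputable def fourier {M : ℕ} [NeZero M] (ψ : ZMod M × ZMod M → ℂ) (y : ℤ × ℤ) : ℂ :=
  ∑ r, ψ r * ZMod.stdAddChar (r.1 * (y.1 : ZMod M) + r.2 * (y.2 : ZMod M))

lemma norm_stdAddChar {M : ℕ} [NeZero M] (x : ZMod M) : ‖ZMod.stdAddChar x‖ = 1 := by
  rw [ZMod.stdAddChar_apply]
  exact Circle.norm_coe _

lemma norm_fourier_le {M : ℕ} [NeZero M] (ψ : ZMod M × ZMod M → ℂ) (y : ℤ × ℤ) :
    ‖fourier ψ y‖ ≤ ∑ r, ‖ψ r‖ := by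
  refine (norm_sum_le _ _).trans (Finset.sum_le_sum fun r _ ↦ ?_)
  rw [norm_mul, norm_stdAddChar, mul_one]

lemma norm_le_sum {M : ℕ} [NeZero M] (ψ : ZMod M × ZMod M → ℂ) (r : ZMod M × ZMod M) :
    ‖ψ r‖ ≤ ∑ r, ‖ψ r‖ :=
  Finset.single_le_sum (f := fun r ↦ ‖ψ r‖) (fun _ _ ↦ norm_nonneg _) (Finset.mem_univ r)

lemma stdAddChar_intCast {M : ℕ} [NeZero M] (j : ℤ) :
    ZMod.stdAddChar (j : ZMod M) = expI (j / M) := by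
  rw [ZMod.stdAddChar_coe, expI]
  congr 1
  ring

lemma PosForm.thetaSum_inversion (Q : PosForm) {M : ℕ} [NeZero M] (ψ : ZMod M × ZMod M → ℂ)
    {w : ℂ} (hw : 0 < w.im) :
    Q.thetaSum (fun x ↦ ψ (x.1, x.2)) (-w⁻¹) =
      w / (I * √Q.disc * M ^ 2) * Q.adj.thetaSum (fourier ψ) (w / (Q.disc * M ^ 2)) := by
  have hM : (M : ℂ) ≠ 0 := by exact_mod_cast NeZero.ne M
  have hMR : (0 : ℝ) < M := by exact_mod_cast NeZero.pos M
  have hw0 : w ≠ 0 := fun h ↦ by simp [h] at hw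
  have hneg : 0 < (-w⁻¹).im := by
    rw [neg_im, inv_im, neg_div, neg_neg]
    exact div_pos hw (normSq_pos.mpr hw0)
  have him : 0 < (w / M ^ 2).im := by
    rw [show (w / M ^ 2) = (((M : ℝ) ^ 2)⁻¹ : ℝ) * w by push_cast; ring, im_ofReal_mul]
    positivity
  have him' : 0 < (w / (Q.disc * M ^ 2)).im := by
    rw [show (w / (Q.disc * M ^ 2)) = (((Q.disc : ℝ) * M ^ 2)⁻¹ : ℝ) * w by push_cast; ring,
      im_ofReal_mul]
    have := Q.disc_pos'
    positivity
  set e : (ZMod M × ZMod M) × (ℤ × ℤ) ≃ ℤ × ℤ :=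
    (Equiv.prodProdProdComm _ _ _ _).trans ((residueEquiv M).prodCongr (residueEquiv M)) with he
  have hsum := Q.summable_thetaSum (f := fun x ↦ ψ (x.1, x.2)) (fun x ↦ norm_le_sum ψ _) hneg
  have inner : ∀ r : ZMod M × ZMod M, ∑' n : ℤ × ℤ, (fun x : ℤ × ℤ ↦ ψ (x.1, x.2) *
      expI (Q.val (x.1 : ℂ) x.2 * -w⁻¹)) (e (r, n)) = ∑' y : ℤ × ℤ, w / (I * √Q.disc * M ^ 2) *
        (ψ r * ZMod.stdAddChar (r.1 * y.1 + r.2 * y.2 : ZMod M) *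
          expI (Q.adj.val (y.1 : ℂ) y.2 * (w / (Q.disc * M ^ 2)))) := by
    intro r
    have h := Q.tsum_inversion him (r.1.val / M) (r.2.val / M)
    calc _ = ∑' n : ℤ × ℤ, ψ r * expI (Q.val (n.1 + (r.1.val / M : ℝ) : ℂ)
          (n.2 + (r.2.val / M : ℝ)) * -(w / M ^ 2)⁻¹) := by
          refine tsum_congr fun n ↦ ?_
          have e1 : e (r, n) = ((r.1.val : ℤ) + M * n.1, (r.2.val : ℤ) + M * n.2) := rfl
          have e2 : ∀ s k : ℂ, s + M * k = M * (k + s / M) := fun s k ↦ by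
            field_simp
            ring
          have e3 : (((r.1.val + M * n.1 : ℤ) : ZMod M), ((r.2.val + M * n.2 : ℤ) : ZMod M)) =
              r := by
            simp
          simp only [e1, e3]
          congr 2
          push_cast
          rw [e2, e2, Q.val_smul, inv_div]
          field_simp
      _ = _ := by
          rw [tsum_mul_left, h, ← tsum_mul_left, ← tsum_mul_left]
          refine tsum_congr fun y ↦ ?_
          have e3 : (r.1 * y.1 + r.2 * y.2 : ZMod M) =
              ((r.1.val * y.1 + r.2.val * y.2 : ℤ) : ZMod M) := by simp
          rw [e3, stdAddChar_intCast, expI_add]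
          have e4 : w / M ^ 2 / Q.disc = w / (Q.disc * M ^ 2) := by
            rw [div_div, mul_comm]
          have e5 : ((r.1.val * y.1 + r.2.val * y.2 : ℤ) / M : ℂ) =
              (r.1.val / M : ℝ) * y.1 + (r.2.val / M : ℝ) * y.2 := by
            push_cast
            ring
          rw [e4, e5]
          field_simp
  have outer := Summable.tsum_prod (e.summable_iff.mpr hsum)
  simp only [Function.comp_apply] at outer
  rw [PosForm.thetaSum, ← e.tsum_eq, outer, tsum_fintype, Finset.sum_congr rfl fun r _ ↦ inner r]
  rw [← Summable.tsum_finsetSum, PosForm.thetaSum, ← tsum_mul_left]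
  · refine tsum_congr fun y ↦ ?_
    rw [← Finset.mul_sum, fourier, Finset.sum_mul]
  · intro r _
    refine Summable.mul_left _ (Q.adj.summable_thetaSum (B := ‖ψ r‖) (fun y ↦ ?_) him')
    rw [norm_mul, norm_stdAddChar, mul_one]

/-! ### Gauss sums of binary quadratic forms -/

lemma PosForm.gauss_sum (Q : PosForm) {p : ℕ} [Fact p.Prime] {B : ZMod p} (hB : B ≠ 0)
    (h2 : (2 : ZMod p) ≠ 0) (ha : (Q.a : ZMod p) ≠ 0) (hD : (Q.disc : ZMod p) ≠ 0)
    (hsq : IsSquare (-(Q.disc : ZMod p))) :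
    ∑ t : ZMod p × ZMod p, ZMod.stdAddChar (B * Q.val t.1 t.2) = (p : ℂ) := by
  obtain ⟨δ, hδ⟩ := hsq
  have hδ0 : δ ≠ 0 := by
    rintro rfl
    simp at hδ
    exact hD hδ
  have hDeq : (Q.disc : ZMod p) = 4 * Q.a * Q.c - Q.b ^ 2 := Q.disc_cast
  set κ : ZMod p := (Q.b + δ) / (2 * Q.a) with hκ
  have hval : ∀ u t : ZMod p, B * Q.val (u - κ * t) t = B * Q.a * u ^ 2 + t * (-B * δ * u) := by
    intro u t
    have h4 : (4 : ZMod p) ≠ 0 := by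
      rw [show (4 : ZMod p) = 2 * 2 by norm_num]
      exact mul_ne_zero h2 h2
    have e1 : 2 * Q.a * κ = Q.b + δ := by
      rw [hκ]
      field_simp
    have e2 : Q.a * κ ^ 2 - Q.b * κ + Q.c = 0 := by
      refine (mul_eq_zero_iff_left (mul_ne_zero h4 ha)).mp ?_
      linear_combination (2 * Q.a * κ - Q.b + δ) * e1 - hDeq + (-1 : ZMod p) * hδ
    rw [PosForm.val]
    linear_combination (-B * u * t) * e1 + B * t ^ 2 * e2
  have key : ∀ u : ZMod p, ∑ t : ZMod p, (ZMod.stdAddChar (B * Q.val (u - κ * t) t) : ℂ) =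
      if u = 0 then (p : ℂ) else 0 := by
    intro u
    have h := AddChar.sum_mulShift (-B * δ * u) (ZMod.isPrimitive_stdAddChar p)
    simp_rw [hval, AddChar.map_add_eq_mul]
    rw [← Finset.mul_sum, h]
    by_cases hu : u = 0
    · simp [hu, ZMod.card]
    · simp [hu, hB, hδ0]
  rw [Fintype.sum_prod_type_right]
  calc ∑ y : ZMod p, ∑ x : ZMod p, (ZMod.stdAddChar (B * Q.val x y) : ℂ)
      = ∑ y : ZMod p, ∑ u : ZMod p, ZMod.stdAddChar (B * Q.val (u - κ * y) y) :=
        Finset.sum_congr rfl fun y _ ↦ ((Equiv.subRight (κ * y)).sum_comp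
          fun x ↦ (ZMod.stdAddChar (B * Q.val x y) : ℂ)).symm
    _ = p := by
        rw [Finset.sum_comm, Finset.sum_congr rfl fun u _ ↦ key u]
        simp

lemma PosForm.gauss_sum_linear (Q : PosForm) {p : ℕ} [Fact p.Prime] {B : ZMod p} (hB : B ≠ 0)
    (h2 : (2 : ZMod p) ≠ 0) (ha : (Q.a : ZMod p) ≠ 0) (hD : (Q.disc : ZMod p) ≠ 0)
    (hsq : IsSquare (-(Q.disc : ZMod p))) (l₁ l₂ : ZMod p) :
    ∑ t : ZMod p × ZMod p, ZMod.stdAddChar (B * Q.val t.1 t.2 + (t.1 * l₁ + t.2 * l₂)) =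
      (p : ℂ) * ZMod.stdAddChar (-(Q.adj.val l₁ l₂ / (B * (Q.disc : ZMod p)))) := by
  have hDeq : (Q.disc : ZMod p) = 4 * Q.a * Q.c - Q.b ^ 2 := Q.disc_cast
  rw [← Q.gauss_sum hB h2 ha hD hsq, Finset.sum_mul]
  refine (Fintype.sum_equiv (Equiv.addRight (-((2 * Q.c * l₁ - Q.b * l₂) / (B * Q.disc)),
    -((2 * Q.a * l₂ - Q.b * l₁) / (B * Q.disc)))) _ _ fun t ↦ ?_).symm
  rw [← AddChar.map_add_eq_mul]
  congr 1
  simp only [Equiv.coe_addRight, Prod.fst_add, Prod.snd_add, PosForm.val, PosForm.adj]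
  push_cast
  field_simp
  rw [hDeq]
  ring

lemma stdAddChar_mul_eq {m p : ℕ} [NeZero m] [Fact p.Prime] (hmp : m.Coprime p)
    (hp : (p : ZMod m) = 1) (x : ZMod (m * p)) :
    (ZMod.stdAddChar x : ℂ) = ZMod.stdAddChar (ZMod.castHom (dvd_mul_right m p) (ZMod m) x) *
      ZMod.stdAddChar (ZMod.castHom (dvd_mul_left p m) (ZMod p) x * (m : ZMod p)⁻¹) := by
  obtain ⟨j, rfl⟩ := ZMod.intCast_surjective x
  obtain ⟨k, hk⟩ := ZMod.intCast_surjective (m : ZMod p)⁻¹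
  have hm0 : (m : ZMod p) ≠ 0 := by
    rw [Ne, ZMod.natCast_eq_zero_iff]
    exact fun h ↦ (Fact.out : p.Prime).one_lt.ne' (Nat.dvd_one.mp (hmp ▸ Nat.dvd_gcd h dvd_rfl))
  have hmC : (m : ℂ) ≠ 0 := by exact_mod_cast NeZero.ne m
  have hpC : (p : ℂ) ≠ 0 := by exact_mod_cast (Fact.out : p.Prime).ne_zero
  have d : ((m * p : ℕ) : ℤ) ∣ p + m * k - 1 := by
    push_cast
    refine IsCoprime.mul_dvd (Nat.isCoprime_iff_coprime.mpr hmp) ?_ ?_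
    · rw [← ZMod.intCast_zmod_eq_zero_iff_dvd]
      simp [hp]
    · rw [← ZMod.intCast_zmod_eq_zero_iff_dvd]
      simp [hk, hm0]
  obtain ⟨l, hl⟩ := d
  have hlC : (p : ℂ) + m * k - 1 = m * p * l := by exact_mod_cast hl
  rw [← hk, map_intCast (ZMod.castHom (dvd_mul_right m p) (ZMod m)),
    map_intCast (ZMod.castHom (dvd_mul_left p m) (ZMod p)), ← Int.cast_mul, stdAddChar_intCast,
    stdAddChar_intCast, stdAddChar_intCast, ← expI_add]
  have : (j : ℂ) / m + (j * k : ℤ) / p = j / (m * p : ℕ) + (l * j : ℤ) := by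
    push_cast
    field_simp
    linear_combination (j : ℂ) * hlC
  rw [this, expI_add _ ((l * j : ℤ) : ℂ), expI_int, mul_one]

lemma castHom_prod_bijective {m p : ℕ} [NeZero m] [NeZero p] (hmp : m.Coprime p) :
    Function.Bijective fun r : ZMod (m * p) × ZMod (m * p) ↦
      (((ZMod.castHom (dvd_mul_right m p) (ZMod m) r.1,
        ZMod.castHom (dvd_mul_right m p) (ZMod m) r.2),
      (ZMod.castHom (dvd_mul_left p m) (ZMod p) r.1,
        ZMod.castHom (dvd_mul_left p m) (ZMod p) r.2)) :
        (ZMod m × ZMod m) × (ZMod p × ZMod p)) := by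
  rw [Fintype.bijective_iff_injective_and_card]
  constructor
  · have inj : ∀ x y : ZMod (m * p), ZMod.castHom (dvd_mul_right m p) (ZMod m) x =
        ZMod.castHom (dvd_mul_right m p) (ZMod m) y → ZMod.castHom (dvd_mul_left p m) (ZMod p) x =
        ZMod.castHom (dvd_mul_left p m) (ZMod p) y → x = y := by
      intro x y h1 h2
      obtain ⟨i, rfl⟩ := ZMod.intCast_surjective x
      obtain ⟨j, rfl⟩ := ZMod.intCast_surjective y
      rw [map_intCast, map_intCast, ZMod.intCast_eq_intCast_iff_dvd_sub] at h1 h2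
      rw [ZMod.intCast_eq_intCast_iff_dvd_sub]
      push_cast
      exact IsCoprime.mul_dvd (Nat.isCoprime_iff_coprime.mpr hmp) h1 h2
    rintro ⟨x₁, x₂⟩ ⟨y₁, y₂⟩ h
    simp only [Prod.mk.injEq] at h
    exact Prod.ext (inj _ _ h.1.1 h.2.1) (inj _ _ h.1.2 h.2.2)
  · simp only [Fintype.card_prod, ZMod.card]
    ring

/-- The Fourier transform of the product of a function on `(ℤ/m)²` and a Gaussian on `(ℤ/p)²`. -/
lemma PosForm.fourier_mul_gaussian (Q : PosForm) {m p : ℕ} [NeZero m] [Fact p.Prime]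
    (hmp : m.Coprime p) (hp : (p : ZMod m) = 1) {B : ZMod p} (hB : B ≠ 0)
    (h2 : (2 : ZMod p) ≠ 0) (ha : (Q.a : ZMod p) ≠ 0) (hD : (Q.disc : ZMod p) ≠ 0)
    (hsq : IsSquare (-(Q.disc : ZMod p))) (φ : ZMod m × ZMod m → ℂ) (y : ℤ × ℤ) :
    fourier (fun r : ZMod (m * p) × ZMod (m * p) ↦
      φ (ZMod.castHom (dvd_mul_right m p) (ZMod m) r.1,
        ZMod.castHom (dvd_mul_right m p) (ZMod m) r.2) *
      ZMod.stdAddChar (B * Q.val (ZMod.castHom (dvd_mul_left p m) (ZMod p) r.1)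
        (ZMod.castHom (dvd_mul_left p m) (ZMod p) r.2))) y =
    fourier φ y * (p * ZMod.stdAddChar
      (-(Q.adj.val (y.1 / m : ZMod p) (y.2 / m) / (B * (Q.disc : ZMod p))))) := by
  rw [← Q.gauss_sum_linear hB h2 ha hD hsq, fourier, fourier, Finset.sum_mul_sum,
    ← Fintype.sum_prod_type']
  refine Fintype.sum_bijective _ (castHom_prod_bijective hmp) _ _ fun r ↦ ?_
  dsimp only
  rw [stdAddChar_mul_eq hmp hp, AddChar.map_add_eq_mul (ZMod.stdAddChar (N := p)) (B * _)]
  simp only [map_add, map_mul, map_intCast]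
  rw [mul_mul_mul_comm]
  congr 3
  ring

/-! ### Modularity of theta series -/

lemma PosForm.thetaSum_div_add (Q : PosForm) (M : ℕ) [NeZero M] (j : ℤ) (f : ℤ × ℤ → ℂ) (z : ℂ) :
    Q.thetaSum f (j / M + z) = Q.thetaSum
      (fun x ↦ f x * ZMod.stdAddChar ((j : ZMod M) * Q.val (x.1 : ZMod M) (x.2 : ZMod M))) z := by
  refine tsum_congr fun x ↦ ?_
  have h1 : (j : ZMod M) * Q.val (x.1 : ZMod M) (x.2 : ZMod M) =
      ((j * Q.val x.1 x.2 : ℤ) : ZMod M) := by rw [Int.cast_mul, Q.val_cast]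
  have h2 : Q.val (x.1 : ℂ) x.2 * (j / M + z) =
      (j * Q.val x.1 x.2 : ℤ) / M + Q.val (x.1 : ℂ) x.2 * z := by
    rw [Int.cast_mul, Q.val_cast]
    ring
  simp only [h1, h2, stdAddChar_intCast, expI_add]
  ring

/-- The theta series attached to a function on `(ℤ/m)²`. -/
noncomputable def PosForm.theta (Q : PosForm) {m : ℕ} (φ : ZMod m × ZMod m → ℂ) (τ : ℍ) : ℂ :=
  Q.thetaSum (fun x ↦ φ (x.1, x.2)) τ

/-- The conditions on `Q` and `φ` ensuring that the theta series is modular for `Γ₁(N)`. -/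
structure PosForm.IsLevel (Q : PosForm) (N : ℕ) {m : ℕ} [NeZero m]
    (φ : ZMod m × ZMod m → ℂ) : Prop where
  dvd : m ∣ N
  fourier_dvd : ∀ y, fourier φ y ≠ 0 → Q.disc * (m : ℤ) ^ 2 ∣ N * Q.adj.val y.1 y.2
  isSquare : ∀ p : ℕ, p.Prime → Q.disc < p → (p : ZMod N) = 1 → IsSquare (-(Q.disc : ZMod p))

lemma coe_smul_eq (γ : SL(2, ℤ)) (τ : ℍ) :
    ((γ • τ : ℍ) : ℂ) = (γ 0 0 * τ + γ 0 1) / (γ 1 0 * τ + γ 1 1) := by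
  rw [coe_specialLinearGroup_apply]
  simp

lemma denom_ne_zero' (γ : SL(2, ℤ)) (τ : ℍ) : (γ 1 0 : ℂ) * τ + γ 1 1 ≠ 0 := by
  rw [← ModularGroup.denom_apply]
  exact denom_ne_zero _ τ

lemma det_castC (γ : SL(2, ℤ)) : (γ 0 0 : ℂ) * γ 1 1 - γ 0 1 * γ 1 0 = 1 := by
  have hdet := congrArg (Int.cast : ℤ → ℂ) (Matrix.SpecialLinearGroup.det_coe γ)
  rw [Matrix.det_fin_two] at hdet
  push_cast at hdet
  exact hdet

lemma div_eq_add_neg_inv {a b c p τ : ℂ} (hp : p ≠ 0) (hd : c * τ + p ≠ 0)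
    (h : a * p - b * c = 1) :
    (a * τ + b) / (c * τ + p) = b / p + -(-(p * (c * τ + p)) / τ)⁻¹ := by
  obtain ⟨d, hd'⟩ : ∃ d, d = c * τ + p := ⟨_, rfl⟩
  rw [← hd'] at hd ⊢
  field_simp
  rw [hd']
  linear_combination τ * h

section Prime

variable {Q : PosForm} {N m : ℕ} [NeZero m] {φ : ZMod m × ZMod m → ℂ}

lemma PosForm.IsLevel.theta_smul_of_prime (h : Q.IsLevel N φ) {γ : SL(2, ℤ)} {p : ℕ}
    (hp : p.Prime) (hγ : γ 1 1 = p) (hN : (N : ℤ) ∣ γ 1 0) (hp1 : (p : ZMod N) = 1)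
    (hpD : Q.disc < p) (hpa : Q.a < p) (hp2 : 2 < p) (hpm : m < p) (τ : ℍ) :
    Q.theta φ (γ • τ) = (γ 1 0 * τ + γ 1 1) * Q.theta φ τ := by
  have : Fact p.Prime := ⟨hp⟩
  have unit : ∀ n : ℤ, 0 < n → n < p → (n : ZMod p) ≠ 0 := fun n h0 h1 h ↦ by
    rw [ZMod.intCast_zmod_eq_zero_iff_dvd] at h
    exact absurd (Int.le_of_dvd h0 h) (by lia)
  have ha := unit Q.a Q.a_pos hpa
  have hD := unit Q.disc Q.disc_pos hpD
  have h2 : (2 : ZMod p) ≠ 0 := by exact_mod_cast unit 2 (by norm_num) (by exact_mod_cast hp2)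
  have hm : (m : ZMod p) ≠ 0 := by
    exact_mod_cast unit m (by exact_mod_cast NeZero.pos m) (by exact_mod_cast hpm)
  have hmp : m.Coprime p := by
    refine ((Nat.Prime.coprime_iff_not_dvd hp).mpr fun hd ↦ ?_).symm
    exact absurd (Nat.le_of_dvd (NeZero.pos m) hd) (by lia)
  have hpm1 : (p : ZMod m) = 1 := by
    have := congrArg (ZMod.castHom h.dvd (ZMod m)) hp1
    rwa [map_natCast, map_one] at this
  have hdet : (γ 0 1 : ZMod p) * γ 1 0 = -1 := by
    have := det_cast (N := p) γ
    rw [hγ] at this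
    simp only [Int.cast_natCast, CharP.cast_eq_zero, mul_zero, zero_sub] at this
    linear_combination -this
  have hB : (γ 0 1 : ZMod p) ≠ 0 := fun h0 ↦ by simp [h0] at hdet
  have hmC : (m : ℂ) ≠ 0 := by exact_mod_cast NeZero.ne m
  have hpC : (p : ℂ) ≠ 0 := by exact_mod_cast hp.ne_zero
  have hDC : (Q.disc : ℂ) ≠ 0 := by exact_mod_cast Q.disc_pos.ne'
  have hs : (√Q.disc : ℂ) ≠ 0 := by
    exact_mod_cast (Real.sqrt_pos.mpr Q.disc_pos').ne'
  have hτ := τ.ne_zero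
  have hden := denom_ne_zero' γ τ
  have hdetC := det_castC γ
  rw [hγ] at hden hdetC
  simp only [Int.cast_natCast] at hden hdetC
  set w₀ : ℂ := -(τ : ℂ)⁻¹ with hw₀
  have hw₀im : 0 < w₀.im := by
    rw [hw₀, neg_im, inv_im, neg_div, neg_neg]
    exact div_pos τ.im_pos (normSq_pos.mpr hτ)
  set w : ℂ := -(p * γ 1 0) + p ^ 2 * w₀ with hw
  have hwim : 0 < w.im := by
    have : w = ((-(p * γ 1 0) : ℝ) : ℂ) + ((p ^ 2 : ℝ) : ℂ) * w₀ := by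
      rw [hw]
      push_cast
      ring
    rw [this, add_im, ofReal_im, im_ofReal_mul, zero_add]
    have : (0 : ℝ) < p := by exact_mod_cast hp.pos
    positivity
  have hw' : w = -(p * (γ 1 0 * τ + p)) / τ := by
    rw [hw, hw₀]
    field_simp
    ring
  have hsmul : ((γ • τ : ℍ) : ℂ) = (γ 0 1 : ℤ) / (p : ℕ) + -w⁻¹ := by
    rw [coe_smul_eq, hγ, hw']
    simp only [Int.cast_natCast]
    exact div_eq_add_neg_inv hpC hden hdetC
  have hτw : (τ : ℂ) = -w₀⁻¹ := by rw [hw₀, inv_neg, inv_inv, neg_neg]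
  have e1 := Q.fourier_mul_gaussian hmp hpm1 hB h2 ha hD (h.isSquare p hp hpD hp1) φ
  have key : ∀ y : ℤ × ℤ, fourier φ y * (p * ZMod.stdAddChar (-(Q.adj.val (y.1 / m : ZMod p)
      (y.2 / m) / ((γ 0 1 : ZMod p) * (Q.disc : ZMod p))))) *
      expI (Q.adj.val (y.1 : ℂ) y.2 * (w / (Q.disc * (m * p : ℕ) ^ 2))) =
      p * (fourier φ y * expI (Q.adj.val (y.1 : ℂ) y.2 * (w₀ / (Q.disc * m ^ 2)))) := by
    intro y
    by_cases hy : fourier φ y = 0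
    · simp [hy]
    obtain ⟨C, hC⟩ := hN
    obtain ⟨q, hq⟩ := h.fourier_dvd y hy
    have hCq : γ 1 0 * Q.adj.val y.1 y.2 = Q.disc * m ^ 2 * (C * q) := by
      rw [hC]
      linear_combination C * hq
    have hCqC : (γ 1 0 : ℂ) * Q.adj.val (y.1 : ℂ) y.2 = Q.disc * m ^ 2 * (C * q) := by
      rw [← Q.adj.val_cast]
      exact_mod_cast hCq
    have hCqp : (γ 1 0 : ZMod p) * Q.adj.val (y.1 : ZMod p) y.2 = Q.disc * m ^ 2 * (C * q) := by
      rw [← Q.adj.val_cast]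
      exact_mod_cast congrArg (Int.cast : ℤ → ZMod p) hCq
    have e2 : -(Q.adj.val (y.1 / m : ZMod p) (y.2 / m) /
        ((γ 0 1 : ZMod p) * (Q.disc : ZMod p))) = ((C * q : ℤ) : ZMod p) := by
      have hx : (y.1 / m : ZMod p) = (m : ZMod p)⁻¹ * y.1 := div_eq_inv_mul _ _
      have hy : (y.2 / m : ZMod p) = (m : ZMod p)⁻¹ * y.2 := div_eq_inv_mul _ _
      rw [hx, hy, Q.adj.val_smul]
      push_cast
      field_simp
      linear_combination (γ 0 1 : ZMod p) * hCqp -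
        (Q.adj.val (y.1 : ZMod p) y.2) * hdet
    have e3 : Q.adj.val (y.1 : ℂ) y.2 * (w / (Q.disc * (m * p : ℕ) ^ 2)) =
        -((C * q : ℤ) / (p : ℂ)) + Q.adj.val (y.1 : ℂ) y.2 * (w₀ / (Q.disc * m ^ 2)) := by
      rw [hw]
      push_cast
      field_simp
      linear_combination (-1 : ℂ) * hCqC
    have e4 : expI ((C * q : ℤ) / p) * expI (-((C * q : ℤ) / p)) = 1 := by
      rw [← expI_add, add_neg_cancel]
      simp [expI]
    rw [e2, stdAddChar_intCast, e3, expI_add]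
    linear_combination (fourier φ y * p *
      expI (Q.adj.val (y.1 : ℂ) y.2 * (w₀ / (Q.disc * m ^ 2)))) * e4
  have lhs := Q.thetaSum_inversion (M := m * p) (hw := hwim)
    (ψ := fun r ↦ φ (ZMod.castHom (dvd_mul_right m p) (ZMod m) r.1,
        ZMod.castHom (dvd_mul_right m p) (ZMod m) r.2) *
      ZMod.stdAddChar ((γ 0 1 : ZMod p) * Q.val (ZMod.castHom (dvd_mul_left p m) (ZMod p) r.1)
        (ZMod.castHom (dvd_mul_left p m) (ZMod p) r.2)))
  have rhs := Q.thetaSum_inversion φ hw₀im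
  rw [PosForm.theta, PosForm.theta, hsmul, Q.thetaSum_div_add]
  simp only [map_intCast] at lhs
  rw [lhs, hτw, rhs, PosForm.thetaSum, tsum_congr fun y ↦ (congrArg (· * _) (e1 y)).trans (key y),
    tsum_mul_left, PosForm.thetaSum, ← hτw, hγ, hw', hw₀]
  push_cast
  field_simp

end Prime

lemma PosForm.thetaSum_int_add (Q : PosForm) (f : ℤ × ℤ → ℂ) (k : ℤ) (z : ℂ) :
    Q.thetaSum f (k + z) = Q.thetaSum f z := by
  have := Q.thetaSum_div_add 1 k f z
  simpa [Subsingleton.elim _ (0 : ZMod 1)] using this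

lemma PosForm.theta_T_zpow (Q : PosForm) {m : ℕ} (φ : ZMod m × ZMod m → ℂ) (k : ℤ) (τ : ℍ) :
    Q.theta φ (ModularGroup.T ^ k • τ) = Q.theta φ τ := by
  rw [PosForm.theta, PosForm.theta, coe_smul_eq, ModularGroup.coe_T_zpow,
    ← Q.thetaSum_int_add _ k τ]
  simp [add_comm]

section Invariance

variable {Q : PosForm} {N m : ℕ} [NeZero m] {φ : ZMod m × ZMod m → ℂ}

lemma PosForm.IsLevel.theta_smul (h : Q.IsLevel N φ) (hN : 2 < N) {γ : SL(2, ℤ)}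
    (hγ : γ ∈ Gamma1 N) (τ : ℍ) :
    Q.theta φ (γ • τ) = (γ 1 0 * τ + γ 1 1) * Q.theta φ τ := by
  obtain ⟨-, h11, h10⟩ := (Gamma1_mem N γ).mp hγ
  have hNd : (N : ℤ) ∣ γ 1 0 := (ZMod.intCast_zmod_eq_zero_iff_dvd _ _).mp h10
  have hdet := Matrix.SpecialLinearGroup.det_coe γ
  rw [Matrix.det_fin_two] at hdet
  by_cases hc : γ 1 0 = 0
  · rw [hc, mul_zero, sub_zero] at hdet
    have hd : γ 1 1 = 1 := by
      rcases Int.isUnit_iff.mp (IsUnit.of_mul_eq_one_right _ hdet) with hd | hd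
      · exact hd
      · have : (N : ℤ) ∣ γ 1 1 - 1 := by
          rw [← ZMod.intCast_zmod_eq_zero_iff_dvd]
          simp [h11]
        rw [hd] at this
        have := Int.le_of_dvd (by norm_num) ((dvd_neg (b := (2 : ℤ))).mp (by simpa using this))
        lia
    have ha : γ 0 0 = 1 := by rwa [hd, mul_one] at hdet
    rw [PosForm.theta, PosForm.theta, coe_smul_eq, hc, hd, ha,
      ← Q.thetaSum_int_add _ (γ 0 1) τ]
    simp [add_comm]
  · have hq : (γ 1 0).natAbs ≠ 0 := Int.natAbs_ne_zero.mpr hc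
    have hco : IsCoprime (γ 1 1) ((γ 1 0).natAbs : ℤ) := by
      rw [Int.natCast_natAbs]
      refine IsCoprime.abs_right ⟨γ 0 0, -γ 0 1, ?_⟩
      linear_combination hdet
    obtain ⟨p, hpn, hp, hpq⟩ := Nat.forall_exists_prime_gt_and_zmodEq
      (Q.disc.natAbs + Q.a.natAbs + 2 + m) hq hco
    obtain ⟨k, hk⟩ : γ 1 0 ∣ p - γ 1 1 := by
      have := hpq.symm.dvd
      rwa [Int.natCast_natAbs, abs_dvd] at this
    have h10' : (γ * ModularGroup.T ^ k) 1 0 = γ 1 0 := by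
      simp [ModularGroup.coe_T_zpow, Matrix.mul_apply, Fin.sum_univ_two]
    have h11' : (γ * ModularGroup.T ^ k) 1 1 = p := by
      simp [ModularGroup.coe_T_zpow, Matrix.mul_apply, Fin.sum_univ_two]
      lia
    have hp1 : (p : ZMod N) = 1 := by
      have := (ZMod.intCast_zmod_eq_zero_iff_dvd _ N).mpr (hNd.trans ⟨k, hk⟩)
      rw [Int.cast_sub, h11, Int.cast_natCast] at this
      exact sub_eq_zero.mp this
    have key := h.theta_smul_of_prime hp h11' (h10' ▸ hNd) hp1 (by lia) (by lia) (by lia) (by lia)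
      (ModularGroup.T ^ (-k) • τ)
    rw [Q.theta_T_zpow, ← mul_smul, mul_assoc, ← zpow_add, add_neg_cancel, zpow_zero, mul_one,
      h10', h11', coe_smul_eq, ModularGroup.coe_T_zpow] at key
    rw [key]
    congr 1
    have hkC : (p : ℂ) - γ 1 1 = γ 1 0 * k := by exact_mod_cast congrArg (Int.cast : ℤ → ℂ) hk
    simp
    linear_combination hkC

lemma PosForm.IsLevel.theta_slash (h : Q.IsLevel N φ) (hN : 2 < N) {γ : SL(2, ℤ)}
    (hγ : γ ∈ Gamma1 N) : Q.theta φ ∣[(1 : ℤ)] γ = Q.theta φ := by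
  ext τ
  rw [slash_apply_eq, h.theta_smul hN hγ, zpow_neg_one]
  field_simp [denom_ne_zero' γ τ]

end Invariance

section Holomorphy

lemma norm_comp_cast_le {m : ℕ} [NeZero m] (φ : ZMod m × ZMod m → ℂ) (x : ℤ × ℤ) :
    ‖φ (x.1, x.2)‖ ≤ ∑ r, ‖φ r‖ :=
  norm_le_sum φ _

lemma PosForm.differentiableOn_thetaSum (Q : PosForm) {f : ℤ × ℤ → ℂ} {B : ℝ}
    (hf : ∀ x, ‖f x‖ ≤ B) : DifferentiableOn ℂ (Q.thetaSum f) {z | 0 < z.im} := by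
  have hB : 0 ≤ B := (norm_nonneg _).trans (hf 0)
  intro z hz
  have hz' : 0 < z.im := hz
  have hopen : IsOpen {w : ℂ | z.im / 2 < w.im} := isOpen_lt continuous_const continuous_im
  refine DifferentiableAt.differentiableWithinAt
    (DifferentiableOn.differentiableAt ?_ (hopen.mem_nhds (half_lt_self hz')))
  have hsum := ((Q.summable_thetaSum (f := fun _ ↦ (1 : ℂ)) (B := 1) (by simp)
    (z := ((z.im / 2 : ℝ) : ℂ) * I) (by simpa using hz)).norm).mul_left B
  refine differentiableOn_tsum_of_summable_norm hsum ?_ hopen ?_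
  · intro x
    unfold expI
    fun_prop
  · intro x w hw
    have hw' : z.im / 2 < w.im := hw
    rw [norm_mul, norm_mul, norm_one, one_mul]
    have h1 := Q.norm_expI_val (x.1 : ℝ) x.2 w
    have h2 := Q.norm_expI_val (x.1 : ℝ) x.2 (((z.im / 2 : ℝ) : ℂ) * I)
    simp only [ofReal_intCast] at h1 h2
    rw [h1, h2]
    have := Q.val_nonneg x.1 x.2
    refine mul_le_mul (hf x) (Real.exp_le_exp.mpr ?_) (Real.exp_nonneg _) hB
    rw [im_ofReal_mul, Complex.I_im, mul_one, neg_le_neg_iff]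
    gcongr

lemma PosForm.theta_differentiableOn (Q : PosForm) {m : ℕ} [NeZero m]
    (φ : ZMod m × ZMod m → ℂ) :
    DifferentiableOn ℂ (Q.theta φ ∘ ofComplex) {z | 0 < z.im} := by
  refine (Q.differentiableOn_thetaSum (norm_comp_cast_le φ)).congr fun z hz ↦ ?_
  rw [Function.comp_apply, PosForm.theta, ofComplex_apply_of_im_pos hz]

end Holomorphy

/-! ### Fourier expansions of theta series -/

lemma PosForm.hasLead_thetaSum (Q : PosForm) {f : ℤ × ℤ → ℂ} {B : ℝ} (hB : ∀ x, ‖f x‖ ≤ B)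
    {n : ℤ} (hf : ∀ x, f x ≠ 0 → n ≤ Q.val x.1 x.2) :
    HasLead (fun τ ↦ Q.thetaSum f τ) n (∑' x : ℤ × ℤ, if Q.val x.1 x.2 = n then f x else 0) := by
  have hB0 : 0 ≤ B := (norm_nonneg _).trans (hB 0)
  have hterm : ∀ τ : ℍ, Q.thetaSum f τ * cexp (-(2 * π * I * (n : ℝ) * τ)) =
      ∑' x : ℤ × ℤ, f x * cexp (2 * π * I * (Q.val x.1 x.2 - n : ℤ) * τ) := by
    intro τ
    rw [PosForm.thetaSum, ← tsum_mul_right]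
    refine tsum_congr fun x ↦ ?_
    rw [mul_assoc, expI, ← Complex.exp_add, ← Q.val_cast]
    congr 2
    push_cast
    ring
  refine Tendsto.congr (fun τ ↦ (hterm τ).symm) ?_
  have hsum := Q.summable_exp_neg (C := 2 * π) Real.two_pi_pos 0 0
  refine tendsto_tsum_of_dominated_convergence
    (hsum.mul_left (B * Real.exp (2 * π * n))) (fun x ↦ ?_) ?_
  · split_ifs with h
    · simp only [h, sub_self, Int.cast_zero, mul_zero, zero_mul, Complex.exp_zero, mul_one]
      exact tendsto_const_nhds
    · by_cases hx : f x = 0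
      · simp [hx]
      have : (0 : ℝ) < (Q.val x.1 x.2 - n : ℤ) := by
        exact_mod_cast sub_pos.mpr (lt_of_le_of_ne (hf x hx) (Ne.symm h))
      simpa using (tendsto_cexp_atImInfty this).const_mul (f x)
  · have : ∀ᶠ τ : ℍ in atImInfty, 1 ≤ τ.im := tendsto_comap.eventually_ge_atTop 1
    filter_upwards [this] with τ hτ x
    by_cases hx : f x = 0
    · rw [hx, zero_mul, norm_zero]
      positivity
    rw [norm_mul, mul_assoc B, ← Real.exp_add]
    refine mul_le_mul (hB x) ?_ (norm_nonneg _) hB0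
    rw [norm_exp]
    refine Real.exp_le_exp.mpr ?_
    have h : (2 * π * I * (Q.val x.1 x.2 - n : ℤ) * τ).re =
        -(2 * π * (Q.val x.1 x.2 - n : ℤ) * τ.im) := by
      have : 2 * π * I * (Q.val x.1 x.2 - n : ℤ) * τ =
        ((2 * π * (Q.val x.1 x.2 - n : ℤ) : ℝ) : ℂ) * (I * τ) := by
        push_cast
        ring
      rw [this, re_ofReal_mul]
      simp
    rw [h, add_zero, add_zero, ← Q.val_cast]
    have h0 : (0 : ℝ) ≤ (Q.val x.1 x.2 - n : ℤ) := by exact_mod_cast sub_nonneg.mpr (hf x hx)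
    have := mul_le_mul_of_nonneg_left hτ (mul_nonneg Real.two_pi_pos.le h0)
    push_cast at this ⊢
    linarith

lemma PosForm.tendsto_thetaSum (Q : PosForm) {f : ℤ × ℤ → ℂ} {B : ℝ} (hB : ∀ x, ‖f x‖ ≤ B) :
    Tendsto (fun τ : ℍ ↦ Q.thetaSum f τ) atImInfty (𝓝 (f 0)) := by
  have hpos : ∀ x : ℤ × ℤ, x ≠ 0 → 0 < Q.val x.1 x.2 := fun x hx ↦ by
    have := Q.val_pos (x := x.1) (y := x.2) (by
      by_contra! h
      exact hx (Prod.ext (by exact_mod_cast h.1) (by exact_mod_cast h.2)))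
    rw [← Q.val_cast] at this
    exact_mod_cast this
  have := Q.hasLead_thetaSum hB (n := 0) (fun x _ ↦ by
    rcases eq_or_ne x 0 with rfl | hx
    · simp [PosForm.val]
    · exact (hpos x hx).le)
  rw [tsum_eq_single 0 (fun x hx ↦ if_neg (hpos x hx).ne'),
    if_pos (by simp [PosForm.val])] at this
  refine Tendsto.congr (fun τ ↦ ?_) this
  simp

/-- The indicator function of the line `x + l y = h` modulo `m`. -/
def lineInd (m : ℕ) (l h : ZMod m) (r : ZMod m × ZMod m) : ℂ := if r.1 + l * r.2 = h then 1 else 0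

/-- The number of representations of `k` by `Q` on the line `x + l y = h` modulo `m` in the box
`|x|, |y| ≤ R`. -/
noncomputable def PosForm.repCount (Q : PosForm) (m : ℕ) (l h : ZMod m) (R k : ℤ) : ℕ :=
  ((Finset.Icc (-R) R ×ˢ Finset.Icc (-R) R).filter fun x : ℤ × ℤ ↦
    Q.val x.1 x.2 = k ∧ (x.1 : ZMod m) + l * x.2 = h).card

lemma norm_lineInd_le (m : ℕ) (l h : ZMod m) (r : ZMod m × ZMod m) : ‖lineInd m l h r‖ ≤ 1 := by
  unfold lineInd
  split_ifs <;> simp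

/-- All representations of integers at most `n` lie in the box `|x|, |y| ≤ R`. -/
def PosForm.Fits (Q : PosForm) (R n : ℤ) : Prop :=
  0 ≤ R ∧ 4 * Q.a * n < Q.disc * (R + 1) ^ 2 ∧ 4 * Q.c * n < Q.disc * (R + 1) ^ 2

lemma mem_Icc_of_sq_lt {x R D b : ℤ} (hD : 0 < D) (hR : 0 ≤ R) (h : D * x ^ 2 ≤ b)
    (hb : b < D * (R + 1) ^ 2) : x ∈ Finset.Icc (-R) R := by
  have := abs_lt_of_sq_lt_sq (lt_of_mul_lt_mul_left (h.trans_lt hb) hD.le) (by lia)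
  rw [abs_lt] at this
  rw [Finset.mem_Icc]
  lia

lemma PosForm.Fits.mem_box {Q : PosForm} {R n : ℤ} (h : Q.Fits R n) {x : ℤ × ℤ}
    (hx : Q.val x.1 x.2 ≤ n) : x ∈ Finset.Icc (-R) R ×ˢ Finset.Icc (-R) R := by
  obtain ⟨hR, ha, hc⟩ := h
  have h1 := Q.mul_sq_le_val_left x.1 x.2
  have h2 := Q.mul_sq_le_val_right x.1 x.2
  rw [← Q.val_cast] at h1 h2
  norm_cast at h1 h2
  rw [Finset.mem_product]
  exact ⟨mem_Icc_of_sq_lt Q.disc_pos hR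
      (h1.trans (mul_le_mul_of_nonneg_left hx (by linarith [Q.c_pos]))) hc,
    mem_Icc_of_sq_lt Q.disc_pos hR
      (h2.trans (mul_le_mul_of_nonneg_left hx (by linarith [Q.a_pos]))) ha⟩

lemma PosForm.hasLead_theta_sub (Q : PosForm) (m : ℕ) (l h : ZMod m) {R : ℤ} {n : ℕ}
    (hR : Q.Fits R n) :
    HasLead (fun τ ↦ Q.theta (lineInd m l h) τ -
      ∑ k ∈ Finset.range (n + 1), (Q.repCount m l h R k : ℂ) * expI (k * τ)) n 0 := by
  set box := Finset.Icc (-R) R ×ˢ Finset.Icc (-R) R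
  have hle : ∀ x : ℤ × ℤ, ‖lineInd m l h (x.1, x.2)‖ ≤ 1 := fun x ↦ norm_lineInd_le _ _ _ _
  have key : ∀ τ : ℍ, Q.theta (lineInd m l h) τ -
      ∑ k ∈ Finset.range (n + 1), (Q.repCount m l h R k : ℂ) * expI (k * τ) =
      Q.thetaSum (fun x ↦ if Q.val x.1 x.2 ≤ n then 0 else lineInd m l h (x.1, x.2)) τ := by
    intro τ
    rw [sub_eq_iff_eq_add, PosForm.theta, PosForm.thetaSum, PosForm.thetaSum,
      ← sub_eq_iff_eq_add', ← Summable.tsum_sub (Q.summable_thetaSum hle τ.im_pos)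
        (Q.summable_thetaSum (B := 1) (fun x ↦ by split_ifs <;> simp [hle]) τ.im_pos)]
    have hval : ∀ x : ℤ × ℤ, ∃ k : ℕ, Q.val x.1 x.2 = k := fun x ↦ by
      refine Int.eq_ofNat_of_zero_le ?_
      have := Q.val_nonneg x.1 x.2
      rw [← Q.val_cast] at this
      exact_mod_cast this
    have hterm : ∀ x : ℤ × ℤ, (∑ k ∈ Finset.range (n + 1),
        if x ∈ box.filter (fun x : ℤ × ℤ ↦
          Q.val x.1 x.2 = (k : ℤ) ∧ (x.1 : ZMod m) + l * x.2 = h) then expI (k * τ) else 0) =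
        lineInd m l h (x.1, x.2) * expI (Q.val (x.1 : ℂ) x.2 * τ) -
        (if Q.val x.1 x.2 ≤ n then 0 else lineInd m l h (x.1, x.2)) *
          expI (Q.val (x.1 : ℂ) x.2 * τ) := by
      intro x
      obtain ⟨j, hj⟩ := hval x
      rw [← Q.val_cast, hj]
      by_cases hjn : j ≤ n
      · rw [Finset.sum_eq_single_of_mem j (Finset.mem_range.mpr (by lia)) (fun k _ hk ↦ by
          rw [if_neg]
          simp only [Finset.mem_filter, hj, not_and]
          lia)]
        have : x ∈ box := hR.mem_box (by lia)
        simp [this, hj, hjn, lineInd]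
      · rw [Finset.sum_eq_zero (fun k hk ↦ by
          rw [if_neg]
          simp only [Finset.mem_filter, hj, not_and]
          have := Finset.mem_range.mp hk
          lia)]
        simp [hjn]
    simp_rw [← hterm]
    have hsum : ∀ k ∈ Finset.range (n + 1), HasSum (fun x : ℤ × ℤ ↦
        if x ∈ box.filter (fun x : ℤ × ℤ ↦ Q.val x.1 x.2 = (k : ℤ) ∧
          (x.1 : ZMod m) + l * x.2 = h) then expI (k * τ) else 0)
        ((Q.repCount m l h R k : ℂ) * expI (k * τ)) := by
      intro k _
      convert hasSum_sum_of_ne_finset_zero (L := .unconditional _) (s := box.filter (fun x : ℤ × ℤ ↦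
        Q.val x.1 x.2 = (k : ℤ) ∧ (x.1 : ZMod m) + l * x.2 = h)) (fun x hx ↦ if_neg hx) using 1
      rw [Finset.sum_ite_mem, Finset.inter_self, Finset.sum_const, nsmul_eq_mul]
      rfl
    exact (hasSum_sum hsum).tsum_eq
  have := Q.hasLead_thetaSum (n := n) (B := 1)
    (f := fun x ↦ if Q.val x.1 x.2 ≤ n then 0 else lineInd m l h (x.1, x.2))
    (fun x ↦ by split_ifs <;> simp [hle]) (fun x hx ↦ by
      by_contra! h'
      exact hx (if_pos h'.le))
  have hz : (∑' x : ℤ × ℤ, if Q.val x.1 x.2 = (n : ℤ) then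
      (if Q.val x.1 x.2 ≤ n then 0 else lineInd m l h (x.1, x.2)) else 0) = 0 := by
    refine (tsum_congr fun x ↦ ?_).trans tsum_zero
    split_ifs with h1 h2
    · rfl
    · exact absurd h1.le h2
    · rfl
  rw [hz] at this
  simpa only [key, Int.cast_natCast] using this

lemma PosForm.hasLead_theta_sub_theta (Q₁ Q₂ : PosForm) (m : ℕ) (l₁ h₁ l₂ h₂ : ZMod m)
    {R : ℤ} {n : ℕ} (hR₁ : Q₁.Fits R n) (hR₂ : Q₂.Fits R n)
    (heq : ∀ k < n, Q₁.repCount m l₁ h₁ R k = Q₂.repCount m l₂ h₂ R k) :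
    HasLead (Q₁.theta (lineInd m l₁ h₁) - Q₂.theta (lineInd m l₂ h₂)) n
      (Q₁.repCount m l₁ h₁ R n - Q₂.repCount m l₂ h₂ R n) := by
  have h3 : HasLead (fun τ ↦ ((Q₁.repCount m l₁ h₁ R n : ℂ) - Q₂.repCount m l₂ h₂ R n) *
      expI (n * τ)) n (Q₁.repCount m l₁ h₁ R n - Q₂.repCount m l₂ h₂ R n) := by
    refine tendsto_const_nhds.congr fun τ ↦ ?_
    rw [mul_assoc, expI, ← Complex.exp_add]
    simp [mul_assoc]
  have := ((Q₁.hasLead_theta_sub m l₁ h₁ hR₁).sub (Q₂.hasLead_theta_sub m l₂ h₂ hR₂)).add h3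
  rw [sub_zero, zero_add] at this
  convert this using 1
  ext τ
  have hs : ∑ k ∈ Finset.range n, (Q₁.repCount m l₁ h₁ R k : ℂ) * expI (k * τ) =
      ∑ k ∈ Finset.range n, (Q₂.repCount m l₂ h₂ R k : ℂ) * expI (k * τ) :=
    Finset.sum_congr rfl fun k hk ↦ by rw [heq k (Finset.mem_range.mp hk)]
  simp only [Pi.sub_apply, Pi.add_apply, Finset.sum_range_succ, hs]
  ring

/-! ### Behaviour of theta series at the cusps -/

/-- `φ` on `(ℤ/m)²` times the character `e(j Q / c)`, as a function on `(ℤ/mc)²`. -/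
noncomputable def PosForm.twist (Q : PosForm) {m c : ℕ} [NeZero c] (φ : ZMod m × ZMod m → ℂ)
    (j : ℤ) (r : ZMod (m * c) × ZMod (m * c)) : ℂ :=
  φ (ZMod.castHom (dvd_mul_right m c) (ZMod m) r.1,
    ZMod.castHom (dvd_mul_right m c) (ZMod m) r.2) *
  ZMod.stdAddChar ((j : ZMod c) * Q.val (ZMod.castHom (dvd_mul_left c m) (ZMod c) r.1)
    (ZMod.castHom (dvd_mul_left c m) (ZMod c) r.2))

lemma PosForm.tendsto_theta_slash (Q : PosForm) {m c : ℕ} [NeZero m] [NeZero c]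
    (φ : ZMod m × ZMod m → ℂ) {γ : SL(2, ℤ)} {j : ℤ} (h0 : γ 1 0 ≠ 0)
    (hj : (γ 0 0 : ℂ) / γ 1 0 = j / c) :
    Tendsto (Q.theta φ ∣[(1 : ℤ)] γ) atImInfty
      (𝓝 (γ 1 0 / (I * √Q.disc * (m * c : ℕ) ^ 2) * ∑ r, Q.twist (c := c) φ j r)) := by
  have hc0 : (γ 1 0 : ℂ) ≠ 0 := by exact_mod_cast h0
  have hM : (0 : ℝ) < (m * c : ℕ) := by exact_mod_cast NeZero.pos (m * c)
  have hD := Q.disc_pos'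
  have hc2 : (0 : ℝ) < (γ 1 0 : ℝ) ^ 2 := by
    have : (γ 1 0 : ℝ) ≠ 0 := by exact_mod_cast h0
    positivity
  set w : ℍ → ℂ := fun τ ↦ γ 1 0 * (γ 1 0 * τ + γ 1 1) with hw
  have hwim : ∀ τ, (w τ).im = (γ 1 0 : ℝ) ^ 2 * τ.im := by
    intro τ
    have : w τ = (((γ 1 0 : ℝ) ^ 2 : ℝ) : ℂ) * τ + ((γ 1 0 * γ 1 1 : ℤ) : ℝ) := by
      simp only [hw]
      push_cast
      ring
    rw [this, add_im, im_ofReal_mul, ofReal_im, add_zero]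
    rfl
  have hwpos : ∀ τ, 0 < (w τ).im := fun τ ↦ by
    rw [hwim]
    exact mul_pos hc2 τ.im_pos
  have hvim : ∀ τ, (w τ / (Q.disc * (m * c : ℕ) ^ 2)).im =
      (w τ).im / (Q.disc * (m * c : ℕ) ^ 2) := by
    intro τ
    have : w τ / (Q.disc * (m * c : ℕ) ^ 2) =
        w τ / ((Q.disc * (m * c : ℕ) ^ 2 : ℝ) : ℂ) := by push_cast; rfl
    rw [this, div_ofReal_im]
  set v : ℍ → ℍ := fun τ ↦ ⟨w τ / (Q.disc * (m * c : ℕ) ^ 2), by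
    rw [hvim]
    have := hwpos τ
    positivity⟩ with hv
  have hvt : Tendsto v atImInfty atImInfty := by
    rw [atImInfty, tendsto_comap_iff]
    have : (UpperHalfPlane.im ∘ v) =
        fun τ ↦ (γ 1 0 : ℝ) ^ 2 / (Q.disc * (m * c : ℕ) ^ 2) * τ.im := by
      ext τ
      change (w τ / (Q.disc * (m * c : ℕ) ^ 2)).im = _
      rw [hvim, hwim]
      ring
    rw [this]
    exact Tendsto.const_mul_atTop (by positivity) tendsto_comap
  have hlim := ((Q.adj.tendsto_thetaSum (norm_fourier_le (Q.twist (c := c) φ j))).comp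
    hvt).const_mul (γ 1 0 / (I * √Q.disc * (m * c : ℕ) ^ 2) : ℂ)
  have h00 : fourier (Q.twist (c := c) φ j) 0 = ∑ r, Q.twist (c := c) φ j r := by
    simp [fourier]
  rw [h00] at hlim
  refine hlim.congr fun τ ↦ ?_
  have hden := denom_ne_zero' γ τ
  have hsmul : ((γ • τ : ℍ) : ℂ) = j / c + -(w τ)⁻¹ := by
    rw [coe_smul_eq, ← hj]
    simp only [hw]
    obtain ⟨d, hd⟩ : ∃ d : ℂ, d = γ 1 0 * τ + γ 1 1 := ⟨_, rfl⟩
    rw [← hd] at hden ⊢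
    field_simp
    rw [hd]
    linear_combination -det_castC γ
  have hinv := Q.thetaSum_inversion (M := m * c) (hw := hwpos τ) (ψ := Q.twist (c := c) φ j)
  simp only [PosForm.twist, map_intCast] at hinv
  rw [slash_apply_eq, PosForm.theta, hsmul, Q.thetaSum_div_add, hinv, zpow_neg_one,
    Function.comp_apply]
  simp only [hv, hw]
  field_simp

/-- A similitude between two binary quadratic forms with multiplier `t²`, compatible with the
functions `φ₁` and `φ₂`. -/
structure Similitude (Q₁ Q₂ : PosForm) (t : ℕ) {m : ℕ} (φ₁ φ₂ : ZMod m × ZMod m → ℂ)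
    (p q r s : ℤ) : Prop where
  disc_eq : Q₁.disc = Q₂.disc
  det_sq : (p * s - q * r) ^ 2 = t ^ 4
  map_a : Q₁.a * p ^ 2 + Q₁.b * p * r + Q₁.c * r ^ 2 = t ^ 2 * Q₂.a
  map_b : 2 * Q₁.a * p * q + Q₁.b * (p * s + q * r) + 2 * Q₁.c * r * s = t ^ 2 * Q₂.b
  map_c : Q₁.a * q ^ 2 + Q₁.b * q * s + Q₁.c * s ^ 2 = t ^ 2 * Q₂.c
  map_fun : ∀ x y : ZMod m, φ₁ (p * x + q * y, r * x + s * y) = φ₂ (t * x, t * y)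

section Similitude

variable {Q₁ Q₂ : PosForm} {t m : ℕ} {φ₁ φ₂ : ZMod m × ZMod m → ℂ} {p q r s : ℤ}

lemma Similitude.val_eq (h : Similitude Q₁ Q₂ t φ₁ φ₂ p q r s) {R : Type*} [CommRing R]
    (x y : R) : Q₁.val (p * x + q * y) (r * x + s * y) = Q₂.val (t * x) (t * y) := by
  have ha := congrArg (Int.cast : ℤ → R) h.map_a
  have hb := congrArg (Int.cast : ℤ → R) h.map_b
  have hc := congrArg (Int.cast : ℤ → R) h.map_c
  push_cast at ha hb hc
  simp only [PosForm.val]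
  linear_combination x ^ 2 * ha + x * y * hb + y ^ 2 * hc

lemma bijective_of_det {R : Type*} [CommRing R] [Finite R] {p q r s : R}
    (h : IsUnit (p * s - q * r)) :
    Function.Bijective fun x : R × R ↦ (p * x.1 + q * x.2, r * x.1 + s * x.2) := by
  rw [← Finite.injective_iff_bijective]
  rintro ⟨x, y⟩ ⟨x', y'⟩ hxy
  obtain ⟨h1, h2⟩ := Prod.ext_iff.mp hxy
  simp only at h1 h2
  rw [Prod.mk.injEq]
  exact ⟨h.mul_left_cancel (by linear_combination s * h1 - q * h2),
    h.mul_left_cancel (by linear_combination p * h2 - r * h1)⟩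

lemma Similitude.sum_twist_eq [NeZero m] (h : Similitude Q₁ Q₂ t φ₁ φ₂ p q r s) {c : ℕ}
    [NeZero c] (htc : t.Coprime (m * c)) (j : ℤ) :
    ∑ x, Q₁.twist (c := c) φ₁ j x = ∑ x, Q₂.twist (c := c) φ₂ j x := by
  have ht : IsUnit (t : ZMod (m * c)) := (ZMod.isUnit_iff_coprime _ _).mpr htc
  have hdet : IsUnit ((p : ZMod (m * c)) * s - q * r) := by
    have := congrArg (Int.cast : ℤ → ZMod (m * c)) h.det_sq
    push_cast at this
    rw [← isUnit_pow_iff two_ne_zero, this]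
    exact ht.pow 4
  have hdet' : IsUnit ((t : ZMod (m * c)) * t - 0 * 0) := by simpa using ht.mul ht
  refine ((bijective_of_det hdet).sum_comp _).symm.trans
    (Eq.trans ?_ ((bijective_of_det hdet').sum_comp _))
  refine Finset.sum_congr rfl fun x _ ↦ ?_
  simp only [PosForm.twist, map_add, map_mul, map_intCast, map_natCast, h.map_fun, h.val_eq,
    zero_mul, add_zero, zero_add]

lemma Similitude.tendsto_slash_zero [NeZero m] (h : Similitude Q₁ Q₂ t φ₁ φ₂ p q r s)
    (ht : t.Prime) (htm : ¬ t ∣ m) {γ : SL(2, ℤ)} (hγ : ¬ (t : ℤ) ∣ γ 1 0) :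
    IsZeroAtImInfty ((Q₁.theta φ₁ - Q₂.theta φ₂) ∣[(1 : ℤ)] γ) := by
  have h0 : γ 1 0 ≠ 0 := fun h0 ↦ hγ (h0 ▸ dvd_zero _)
  have : NeZero (γ 1 0).natAbs := ⟨Int.natAbs_ne_zero.mpr h0⟩
  have hj : (γ 0 0 : ℂ) / γ 1 0 = (γ 0 0 * (γ 1 0).sign : ℤ) / ((γ 1 0).natAbs : ℕ) := by
    have hs2 : (γ 1 0).sign * (γ 1 0) = ((γ 1 0).natAbs : ℤ) := by
      rw [mul_comm, Int.mul_sign_self]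
    have h1 : (γ 1 0 : ℂ) ≠ 0 := by exact_mod_cast h0
    have h2 : (((γ 1 0).natAbs : ℕ) : ℂ) ≠ 0 := by exact_mod_cast Int.natAbs_ne_zero.mpr h0
    rw [div_eq_div_iff h1 h2]
    have := congrArg (Int.cast : ℤ → ℂ) hs2
    push_cast [Nat.cast_natAbs] at this ⊢
    linear_combination -(γ 0 0 : ℂ) * this
  have htc : t.Coprime (m * (γ 1 0).natAbs) := by
    rw [Nat.Prime.coprime_iff_not_dvd ht, ht.dvd_mul, not_or, ← Int.natCast_dvd]
    exact ⟨htm, hγ⟩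
  have := (Q₁.tendsto_theta_slash φ₁ h0 hj).sub (Q₂.tendsto_theta_slash φ₂ h0 hj)
  rw [h.sum_twist_eq htc, h.disc_eq, sub_self] at this
  rw [sub_eq_add_neg, SlashAction.add_slash, SlashAction.neg_slash, ← sub_eq_add_neg]
  exact this

lemma Similitude.isZeroAtImInfty [NeZero m] (h : Similitude Q₁ Q₂ t φ₁ φ₂ p q r s) {N : ℕ}
    (hN : 2 < N) (h₁ : Q₁.IsLevel N φ₁) (h₂ : Q₂.IsLevel N φ₂) (ht : t.Prime) (htN : ¬ t ∣ N)
    (γ : SL(2, ℤ)) : IsZeroAtImInfty ((Q₁.theta φ₁ - Q₂.theta φ₂) ∣[(1 : ℤ)] γ) := by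
  have htm : ¬ t ∣ m := fun h ↦ htN (h.trans h₁.dvd)
  by_cases hγ : (t : ℤ) ∣ γ 1 0
  · let δ : SL(2, ℤ) := ⟨!![1, 0; N, 1], by simp⟩
    have hδ : δ ∈ Gamma1 N := by
      rw [Gamma1_mem]
      exact ⟨Int.cast_one, Int.cast_one, (Int.cast_natCast N).trans (ZMod.natCast_self N)⟩
    have hinv : (Q₁.theta φ₁ - Q₂.theta φ₂) ∣[(1 : ℤ)] δ = Q₁.theta φ₁ - Q₂.theta φ₂ := by
      rw [sub_eq_add_neg, SlashAction.add_slash, SlashAction.neg_slash, h₁.theta_slash hN hδ,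
        h₂.theta_slash hN hδ]
    rw [← hinv, ← SlashAction.slash_mul]
    refine h.tendsto_slash_zero ht htm fun hd ↦ ?_
    have h10 : (δ * γ) 1 0 = N * γ 0 0 + γ 1 0 := by
      rw [Matrix.SpecialLinearGroup.coe_mul, Matrix.mul_apply, Fin.sum_univ_two]
      exact congrArg _ (one_mul _)
    rw [h10, Int.dvd_add_left hγ] at hd
    have htp : Prime (t : ℤ) := Nat.prime_iff_prime_int.mp ht
    rcases htp.dvd_or_dvd hd with hd | hd
    · exact htN (Int.natCast_dvd_natCast.mp hd)
    · have hdet := Matrix.SpecialLinearGroup.det_coe γ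
      rw [Matrix.det_fin_two] at hdet
      refine htp.not_dvd_one (hdet ▸ dvd_sub (hd.mul_right _) (hγ.mul_left _))
  · exact h.tendsto_slash_zero ht htm hγ

/-- The cusp form of weight one given by a difference of two theta series. -/
noncomputable def Similitude.cuspForm [NeZero m] (h : Similitude Q₁ Q₂ t φ₁ φ₂ p q r s)
    {N : ℕ} [NeZero N] (hN : 2 < N) (h₁ : Q₁.IsLevel N φ₁) (h₂ : Q₂.IsLevel N φ₂) (ht : t.Prime)
    (htN : ¬ t ∣ N) : CuspForm (Gamma1 N) 1 :=
  cuspFormOf (F := Q₁.theta φ₁ - Q₂.theta φ₂)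
    ((Q₁.theta_differentiableOn φ₁).sub (Q₂.theta_differentiableOn φ₂))
    (fun γ hγ ↦ by
      rw [sub_eq_add_neg, SlashAction.add_slash, SlashAction.neg_slash, h₁.theta_slash hN hγ,
        h₂.theta_slash hN hγ])
    (h.isZeroAtImInfty hN h₁ h₂ ht htN)

end Similitude

/-! ### Cusp forms of weight one -/

lemma dvd_of_fourier_lineInd_ne_zero {m : ℕ} [NeZero m] (l : ℤ) (h : ZMod m) {y : ℤ × ℤ}
    (hy : fourier (lineInd m l h) y ≠ 0) : (m : ℤ) ∣ y.2 - l * y.1 := by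
  rw [← ZMod.intCast_zmod_eq_zero_iff_dvd]
  by_contra hne
  refine hy ?_
  have key : fourier (lineInd m l h) y = ∑ r : ZMod m,
      ZMod.stdAddChar (h * y.1 : ZMod m) *
        ZMod.stdAddChar (r * ((y.2 - l * y.1 : ℤ) : ZMod m)) := by
    rw [fourier, Fintype.sum_prod_type_right]
    refine Finset.sum_congr rfl fun r _ ↦ ?_
    rw [Finset.sum_eq_single (h - l * r) (fun x _ hx ↦ by
      rw [lineInd, if_neg (fun h' ↦ hx (eq_sub_of_add_eq h')), zero_mul]) (by simp),
      lineInd, if_pos (sub_add_cancel _ _), one_mul, ← AddChar.map_add_eq_mul]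
    congr 1
    push_cast
    ring
  rw [key, ← Finset.mul_sum, AddChar.sum_mulShift _ (ZMod.isPrimitive_stdAddChar m), if_neg hne,
    Nat.cast_zero, mul_zero]

/-- `-D` is a square modulo all large primes `p ≡ 1 mod N`. -/
def IsSquareLevel (N : ℕ) (D : ℤ) : Prop :=
  ∀ p : ℕ, p.Prime → D < p → (p : ZMod N) = 1 → IsSquare (-(D : ZMod p))

lemma isLevel_lineInd {Q : PosForm} {N m : ℕ} [NeZero m] {l : ℤ} {h : ZMod m} (hm : m ∣ N)
    (h1 : Q.disc * (m : ℤ) ^ 2 ∣ N * (Q.c - Q.b * l + Q.a * l ^ 2))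
    (h2 : Q.disc * (m : ℤ) ^ 2 ∣ N * (m * (2 * Q.a * l - Q.b)))
    (h3 : Q.disc * (m : ℤ) ^ 2 ∣ N * (Q.a * m ^ 2))
    (hsq : IsSquareLevel N Q.disc) :
    Q.IsLevel N (lineInd m l h) where
  dvd := hm
  isSquare := hsq
  fourier_dvd y hy := by
    obtain ⟨k, hk⟩ := dvd_of_fourier_lineInd_ne_zero l h hy
    have : (N : ℤ) * Q.adj.val y.1 y.2 = N * (Q.c - Q.b * l + Q.a * l ^ 2) * y.1 ^ 2 +
        N * (m * (2 * Q.a * l - Q.b)) * (y.1 * k) + N * (Q.a * m ^ 2) * k ^ 2 := by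
      rw [show y.2 = l * y.1 + m * k by linear_combination hk]
      simp only [PosForm.val, PosForm.adj, Int.cast_id, Int.cast_neg]
      ring
    rw [this]
    exact ((h1.mul_right _).add (h2.mul_right _)).add (h3.mul_right _)

lemma natCast_eq_one_of_dvd {N d p : ℕ} (hd : d ∣ N) (hp : (p : ZMod N) = 1) :
    (p : ZMod d) = 1 := by
  have := congrArg (ZMod.castHom hd (ZMod d)) hp
  rwa [map_natCast, map_one] at this

lemma isSquare_neg_of_three_mod_four {d p : ℕ} (hd : d % 4 = 3) (hp : p.Prime) (h2 : p ≠ 2)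
    (h : (p : ZMod d) = 1) : IsSquare (-(d : ZMod p)) := by
  have : Fact p.Prime := ⟨hp⟩
  have hodd : Odd p := hp.odd_of_ne_two h2
  have hj : jacobiSym (p : ℤ) d = 1 := by
    rw [jacobiSym.mod_left, (ZMod.intCast_eq_intCast_iff _ 1 d).mp (by simpa using h),
      ← jacobiSym.mod_left, jacobiSym.one_left]
  have hneg : jacobiSym (-(d : ℤ)) p = 1 := by
    rw [jacobiSym.neg _ hodd]
    have hp4 : p % 4 = 1 ∨ p % 4 = 3 := by
      obtain ⟨k, rfl⟩ := hodd
      lia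
    have hdo : Odd d := Nat.odd_iff.mpr (by lia)
    rcases hp4 with hp4 | hp4
    · rw [ZMod.χ₄_nat_one_mod_four hp4, one_mul,
        jacobiSym.quadratic_reciprocity_one_mod_four' hdo hp4, hj]
    · rw [ZMod.χ₄_nat_three_mod_four hp4, jacobiSym.quadratic_reciprocity_three_mod_four hd hp4,
        hj]
      norm_num
  simpa using ZMod.isSquare_of_jacobiSym_eq_one hneg

lemma isSquareLevel_of_three_mod_four {N d : ℕ} (s : ℤ) {D : ℤ} (hdN : d ∣ N) (hd : d % 4 = 3)
    (hD : D = s ^ 2 * d) (h2 : 2 ≤ D) : IsSquareLevel N D := by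
  intro p hp hDp hpN
  have := isSquare_neg_of_three_mod_four hd hp (by lia) (natCast_eq_one_of_dvd hdN hpN)
  have h' := (IsSquare.sq (s : ZMod p)).mul this
  rw [hD]
  push_cast
  rwa [← mul_neg]

lemma isSquareLevel_four {N : ℕ} (hN : 4 ∣ N) : IsSquareLevel N 4 := by
  intro p hp _ hpN
  have : Fact p.Prime := ⟨hp⟩
  have hp4 : p % 4 = 1 :=
    (ZMod.natCast_eq_natCast_iff' p 1 4).mp (by simpa using natCast_eq_one_of_dvd hN hpN)
  have h1 : IsSquare (-1 : ZMod p) := ZMod.exists_sq_eq_neg_one_iff.mpr (by lia)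
  have := (IsSquare.sq (2 : ZMod p)).mul h1
  norm_num at this ⊢
  exact this

lemma isSquareLevel_fiftysix : IsSquareLevel 56 56 := by
  intro p hp hDp hpN
  have : Fact p.Prime := ⟨hp⟩
  have hp8 : p % 8 = 1 := (ZMod.natCast_eq_natCast_iff' p 1 8).mp
    (by simpa using natCast_eq_one_of_dvd (d := 8) (by norm_num) hpN)
  have h2 : IsSquare (2 : ZMod p) := (ZMod.exists_sq_eq_two_iff (by lia)).mpr (Or.inl hp8)
  have h7 := isSquare_neg_of_three_mod_four (d := 7) rfl hp (by lia)
    (natCast_eq_one_of_dvd (by norm_num) hpN)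
  have := (IsSquare.sq (2 : ZMod p)).mul (h2.mul h7)
  norm_num at this ⊢
  exact this

theorem Similitude.exists_hasLead {Q₁ Q₂ : PosForm} {m t : ℕ} [NeZero m] {l₁ l₂ : ℤ}
    {h₁ h₂ : ZMod m} {p q r s : ℤ}
    (h : Similitude Q₁ Q₂ t (lineInd m l₁ h₁) (lineInd m l₂ h₂) p q r s) {N : ℕ} [NeZero N]
    (hN : 2 < N) (hQ₁ : Q₁.IsLevel N (lineInd m l₁ h₁)) (hQ₂ : Q₂.IsLevel N (lineInd m l₂ h₂))
    (ht : t.Prime) (htN : ¬ t ∣ N) {R : ℤ} {n : ℕ} (hR₁ : Q₁.Fits R n) (hR₂ : Q₂.Fits R n)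
    (heq : ∀ k < n, Q₁.repCount m l₁ h₁ R (k : ℕ) = Q₂.repCount m l₂ h₂ R (k : ℕ))
    (hne : Q₁.repCount m l₁ h₁ R n ≠ Q₂.repCount m l₂ h₂ R n) :
    ∃ f : CuspForm (Gamma1 N) 1, ∃ β ≠ 0, HasLead f n β :=
  ⟨h.cuspForm hN hQ₁ hQ₂ ht htN, _, sub_ne_zero.mpr (by exact_mod_cast hne),
    Q₁.hasLead_theta_sub_theta Q₂ m l₁ h₁ l₂ h₂ hR₁ hR₂ heq⟩

lemma one_le_rank_of_hasLead {N n : ℕ}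
    (h : ∃ f : CuspForm (Gamma1 N) 1, ∃ β ≠ 0, HasLead f n β) :
    1 ≤ Module.rank ℂ (CuspForm (Gamma1 N) 1) := by
  obtain ⟨f, β, hβ, hf⟩ := h
  rw [Cardinal.one_le_iff_pos, rank_pos_iff_exists_ne_zero]
  refine ⟨f, ?_⟩
  rintro rfl
  refine hβ (hf.unique ?_)
  simp [HasLead]

lemma two_le_rank_of_hasLead {N n₁ n₂ : ℕ} (hn : n₁ < n₂)
    (h₁ : ∃ f : CuspForm (Gamma1 N) 1, ∃ β ≠ 0, HasLead f n₁ β)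
    (h₂ : ∃ f : CuspForm (Gamma1 N) 1, ∃ β ≠ 0, HasLead f n₂ β) :
    2 ≤ Module.rank ℂ (CuspForm (Gamma1 N) 1) := by
  obtain ⟨f, β, hβ, hf⟩ := h₁
  obtain ⟨g, δ, hδ, hg⟩ := h₂
  have hli : LinearIndependent ℂ ![f, g] := by
    rw [LinearIndependent.pair_iff]
    intro a b hab
    have hab' : ∀ τ, a * f τ + b * g τ = 0 := fun τ ↦ by
      simpa using DFunLike.congr_fun hab τ
    have hz : ∀ s : ℝ, HasLead (fun τ ↦ a * f τ + b * g τ) s 0 := fun s ↦ by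
      simp [HasLead, hab']
    have ha : a = 0 := by
      have := (hf.const_mul a).add ((hg.of_lt (s' := n₁) (by exact_mod_cast hn)).const_mul b)
      simpa [hβ] using HasLead.unique this (hz n₁)
    refine ⟨ha, ?_⟩
    have := (hg.const_mul b).unique (by simpa [ha] using hz n₂)
    simpa [hδ] using this
  simpa using hli.cardinal_le_rank

instance (Q : PosForm) (R n : ℤ) : Decidable (Q.Fits R n) :=
  inferInstanceAs (Decidable (_ ∧ _))

lemma lineInd_one_apply (l h : ZMod 1) (r : ZMod 1 × ZMod 1) : lineInd 1 l h r = 1 :=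
  if_pos (Subsingleton.elim _ _)

theorem exists_hasLead_of_disc {Q₁ Q₂ : PosForm} {N t : ℕ} {p q r s : ℤ} [NeZero N] (hN : 2 < N)
    (hdisc₁ : Q₁.disc = N) (hdisc₂ : Q₂.disc = N) (hsq : IsSquareLevel N N)
    (hdet : (p * s - q * r) ^ 2 = t ^ 4)
    (ha : Q₁.a * p ^ 2 + Q₁.b * p * r + Q₁.c * r ^ 2 = t ^ 2 * Q₂.a)
    (hb : 2 * Q₁.a * p * q + Q₁.b * (p * s + q * r) + 2 * Q₁.c * r * s = t ^ 2 * Q₂.b)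
    (hc : Q₁.a * q ^ 2 + Q₁.b * q * s + Q₁.c * s ^ 2 = t ^ 2 * Q₂.c)
    (ht : t.Prime) (htN : ¬ t ∣ N) {R : ℤ} {n : ℕ} (hR₁ : Q₁.Fits R n) (hR₂ : Q₂.Fits R n)
    (heq : ∀ k < n, Q₁.repCount 1 0 0 R (k : ℕ) = Q₂.repCount 1 0 0 R (k : ℕ))
    (hne : Q₁.repCount 1 0 0 R n ≠ Q₂.repCount 1 0 0 R n) :
    ∃ f : CuspForm (Gamma1 N) 1, ∃ β ≠ 0, HasLead f n β := by
  have hlevel : ∀ Q : PosForm, Q.disc = N → Q.IsLevel N (lineInd 1 (0 : ℤ) 0) := fun Q hQ ↦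
    isLevel_lineInd (one_dvd N) (by simp [hQ]) (by simp [hQ]) (by simp [hQ]) (hQ ▸ hsq)
  refine Similitude.exists_hasLead (t := t) (p := p) (q := q) (r := r) (s := s)
    ⟨hdisc₁.trans hdisc₂.symm, hdet, ha, hb, hc, fun _ _ ↦ ?_⟩ hN (hlevel Q₁ hdisc₁)
    (hlevel Q₂ hdisc₂) ht htN hR₁ hR₂ (by simpa using heq) (by simpa using hne)
  rw [lineInd_one_apply, lineInd_one_apply]

lemma one_le_rank_level_31 : 1 ≤ Module.rank ℂ (CuspForm (Gamma1 31) 1) :=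
  one_le_rank_of_hasLead (exists_hasLead_of_disc (n := 1) (R := 2) (t := 2)
    (Q₁ := ⟨1, 1, 8, by decide, by decide⟩) (Q₂ := ⟨2, 1, 4, by decide, by decide⟩)
    (p := -1) (q := -4) (r := 1) (s := 0) (by decide) (by decide) (by decide)
    (isSquareLevel_of_three_mod_four 1 dvd_rfl rfl rfl (by decide))
    (by decide) (by decide) (by decide) (by decide) (by decide) (by decide) (by decide)
    (by decide) (by decide +kernel) (by decide +kernel))

lemma one_le_rank_level_39 : 1 ≤ Module.rank ℂ (CuspForm (Gamma1 39) 1) :=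
  one_le_rank_of_hasLead (exists_hasLead_of_disc (n := 1) (R := 2) (t := 2)
    (Q₁ := ⟨1, 1, 10, by decide, by decide⟩) (Q₂ := ⟨3, 3, 4, by decide, by decide⟩)
    (p := -2) (q := -4) (r := 1) (s := 0) (by decide) (by decide) (by decide)
    (isSquareLevel_of_three_mod_four 1 dvd_rfl rfl rfl (by decide))
    (by decide) (by decide) (by decide) (by decide) (by decide) (by decide) (by decide)
    (by decide) (by decide +kernel) (by decide +kernel))

lemma one_le_rank_level_44 : 1 ≤ Module.rank ℂ (CuspForm (Gamma1 44) 1) :=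
  one_le_rank_of_hasLead (exists_hasLead_of_disc (n := 1) (R := 2) (t := 3)
    (Q₁ := ⟨1, 0, 11, by decide, by decide⟩) (Q₂ := ⟨3, 2, 4, by decide, by decide⟩)
    (p := -4) (q := -5) (r := -1) (s := 1) (by decide) (by decide) (by decide)
    (isSquareLevel_of_three_mod_four (d := 11) 2 (by decide) rfl rfl (by decide))
    (by decide) (by decide) (by decide) (by decide) (by decide) (by decide) (by decide)
    (by decide) (by decide +kernel) (by decide +kernel))

lemma one_le_rank_level_55 : 1 ≤ Module.rank ℂ (CuspForm (Gamma1 55) 1) :=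
  one_le_rank_of_hasLead (exists_hasLead_of_disc (n := 1) (R := 2) (t := 2)
    (Q₁ := ⟨1, 1, 14, by decide, by decide⟩) (Q₂ := ⟨4, 3, 4, by decide, by decide⟩)
    (p := -4) (q := -2) (r := 0) (s := 1) (by decide) (by decide) (by decide)
    (isSquareLevel_of_three_mod_four 1 dvd_rfl rfl rfl (by decide))
    (by decide) (by decide) (by decide) (by decide) (by decide) (by decide) (by decide)
    (by decide) (by decide +kernel) (by decide +kernel))

lemma one_le_rank_level_56 : 1 ≤ Module.rank ℂ (CuspForm (Gamma1 56) 1) :=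
  one_le_rank_of_hasLead (exists_hasLead_of_disc (n := 1) (R := 2) (t := 3)
    (Q₁ := ⟨1, 0, 14, by decide, by decide⟩) (Q₂ := ⟨2, 0, 7, by decide, by decide⟩)
    (p := -2) (q := -7) (r := -1) (s := 1) (by decide) (by decide) (by decide)
    isSquareLevel_fiftysix
    (by decide) (by decide) (by decide) (by decide) (by decide) (by decide) (by decide)
    (by decide) (by decide +kernel) (by decide +kernel))

lemma one_le_rank_level_59 : 1 ≤ Module.rank ℂ (CuspForm (Gamma1 59) 1) :=
  one_le_rank_of_hasLead (exists_hasLead_of_disc (n := 1) (R := 2) (t := 3)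
    (Q₁ := ⟨1, 1, 15, by decide, by decide⟩) (Q₂ := ⟨3, 1, 5, by decide, by decide⟩)
    (p := -4) (q := -5) (r := 1) (s := -1) (by decide) (by decide) (by decide)
    (isSquareLevel_of_three_mod_four 1 dvd_rfl rfl rfl (by decide))
    (by decide) (by decide) (by decide) (by decide) (by decide) (by decide) (by decide)
    (by decide) (by decide +kernel) (by decide +kernel))

lemma two_le_rank_level_47 : 2 ≤ Module.rank ℂ (CuspForm (Gamma1 47) 1) :=
  two_le_rank_of_hasLead (n₁ := 1) (n₂ := 2) (by decide)
    (exists_hasLead_of_disc (n := 1) (R := 2) (t := 3)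
    (Q₁ := ⟨1, 1, 12, by decide, by decide⟩) (Q₂ := ⟨2, 1, 6, by decide, by decide⟩)
    (p := -3) (q := -6) (r := 1) (s := -1) (by decide) (by decide) (by decide)
    (isSquareLevel_of_three_mod_four 1 dvd_rfl rfl rfl (by decide))
    (by decide) (by decide) (by decide) (by decide) (by decide) (by decide) (by decide)
    (by decide) (by decide +kernel) (by decide +kernel))
    (exists_hasLead_of_disc (n := 2) (R := 2) (t := 2)
    (Q₁ := ⟨2, 1, 6, by decide, by decide⟩) (Q₂ := ⟨3, 1, 4, by decide, by decide⟩)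
    (p := -2) (q := -2) (r := 1) (s := -1) (by decide) (by decide) (by decide)
    (isSquareLevel_of_three_mod_four 1 dvd_rfl rfl rfl (by decide))
    (by decide) (by decide) (by decide) (by decide) (by decide) (by decide) (by decide)
    (by decide) (by decide +kernel) (by decide +kernel))

lemma two_le_rank_level_52 : 2 ≤ Module.rank ℂ (CuspForm (Gamma1 52) 1) :=
  two_le_rank_of_hasLead (n₁ := 1) (n₂ := 2) (by decide)
    (Similitude.exists_hasLead (m := 13) (t := 5) (n := 1) (R := 2)
      (l₁ := 8) (l₂ := 8) (h₁ := 1) (h₂ := 2)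
      (p := 3) (q := -4) (r := 4) (s := 3)
      (Q₁ := ⟨1, 0, 1, by decide, by decide⟩) (Q₂ := ⟨1, 0, 1, by decide, by decide⟩)
      ⟨rfl, by decide, by decide, by decide, by decide,
        fun x y ↦ if_congr (by revert x y; decide +kernel) rfl rfl⟩ (by decide)
      (isLevel_lineInd (by decide) (by decide) (by decide) (by decide)
        (isSquareLevel_four (by decide)))
      (isLevel_lineInd (by decide) (by decide) (by decide) (by decide)
        (isSquareLevel_four (by decide)))
      (by decide) (by decide) (by decide) (by decide) (by decide +kernel) (by decide +kernel))
    (Similitude.exists_hasLead (m := 13) (t := 5) (n := 2) (R := 2)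
      (l₁ := 8) (l₂ := 8) (h₁ := 2) (h₂ := 4)
      (p := 3) (q := -4) (r := 4) (s := 3)
      (Q₁ := ⟨1, 0, 1, by decide, by decide⟩) (Q₂ := ⟨1, 0, 1, by decide, by decide⟩)
      ⟨rfl, by decide, by decide, by decide, by decide,
        fun x y ↦ if_congr (by revert x y; decide +kernel) rfl rfl⟩ (by decide)
      (isLevel_lineInd (by decide) (by decide) (by decide) (by decide)
        (isSquareLevel_four (by decide)))
      (isLevel_lineInd (by decide) (by decide) (by decide) (by decide)
        (isSquareLevel_four (by decide)))
      (by decide) (by decide) (by decide) (by decide) (by decide +kernel) (by decide +kernel))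

lemma two_le_rank_level_57 : 2 ≤ Module.rank ℂ (CuspForm (Gamma1 57) 1) :=
  two_le_rank_of_hasLead (n₁ := 1) (n₂ := 3) (by decide)
    (Similitude.exists_hasLead (m := 19) (t := 7) (n := 1) (R := 2)
      (l₁ := 8) (l₂ := 8) (h₁ := 1) (h₂ := 2)
      (p := -8) (q := -5) (r := 5) (s := -3)
      (Q₁ := ⟨1, 1, 1, by decide, by decide⟩) (Q₂ := ⟨1, 1, 1, by decide, by decide⟩)
      ⟨rfl, by decide, by decide, by decide, by decide,
        fun x y ↦ if_congr (by revert x y; decide +kernel) rfl rfl⟩ (by decide)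
      (isLevel_lineInd (by decide) (by decide) (by decide) (by decide)
        (isSquareLevel_of_three_mod_four (d := 3) 1 (by decide) rfl rfl (by decide)))
      (isLevel_lineInd (by decide) (by decide) (by decide) (by decide)
        (isSquareLevel_of_three_mod_four (d := 3) 1 (by decide) rfl rfl (by decide)))
      (by decide) (by decide) (by decide) (by decide) (by decide +kernel) (by decide +kernel))
    (Similitude.exists_hasLead (m := 19) (t := 7) (n := 3) (R := 2)
      (l₁ := 8) (l₂ := 8) (h₁ := 2) (h₂ := 4)
      (p := -8) (q := -5) (r := 5) (s := -3)
      (Q₁ := ⟨1, 1, 1, by decide, by decide⟩) (Q₂ := ⟨1, 1, 1, by decide, by decide⟩)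
      ⟨rfl, by decide, by decide, by decide, by decide,
        fun x y ↦ if_congr (by revert x y; decide +kernel) rfl rfl⟩ (by decide)
      (isLevel_lineInd (by decide) (by decide) (by decide) (by decide)
        (isSquareLevel_of_three_mod_four (d := 3) 1 (by decide) rfl rfl (by decide)))
      (isLevel_lineInd (by decide) (by decide) (by decide) (by decide)
        (isSquareLevel_of_three_mod_four (d := 3) 1 (by decide) rfl rfl (by decide)))
      (by decide) (by decide) (by decide) (by decide) (by decide +kernel) (by decide +kernel))

end WeightOne

theorem weight_one_cuspforms_dimensions_levels_31_to_59 :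
    Module.rank ℂ (CuspForm (CongruenceSubgroup.Gamma1 31) 1) = 1 ∧
    Module.rank ℂ (CuspForm (CongruenceSubgroup.Gamma1 39) 1) = 1 ∧
    Module.rank ℂ (CuspForm (CongruenceSubgroup.Gamma1 44) 1) = 1 ∧
    Module.rank ℂ (CuspForm (CongruenceSubgroup.Gamma1 55) 1) = 1 ∧
    Module.rank ℂ (CuspForm (CongruenceSubgroup.Gamma1 56) 1) = 1 ∧
    Module.rank ℂ (CuspForm (CongruenceSubgroup.Gamma1 59) 1) = 1 ∧
    Module.rank ℂ (CuspForm (CongruenceSubgroup.Gamma1 47) 1) = 2 ∧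
    Module.rank ℂ (CuspForm (CongruenceSubgroup.Gamma1 52) 1) = 2 ∧
    Module.rank ℂ (CuspForm (CongruenceSubgroup.Gamma1 57) 1) = 2 :=
  ⟨le_antisymm WeightOne.rank_le_one_level_31 WeightOne.one_le_rank_level_31,
    le_antisymm WeightOne.rank_le_one_level_39 WeightOne.one_le_rank_level_39,
    le_antisymm WeightOne.rank_le_one_level_44 WeightOne.one_le_rank_level_44,
    le_antisymm WeightOne.rank_le_one_level_55 WeightOne.one_le_rank_level_55,
    le_antisymm WeightOne.rank_le_one_level_56 WeightOne.one_le_rank_level_56,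
    le_antisymm WeightOne.rank_le_one_level_59 WeightOne.one_le_rank_level_59,
    le_antisymm WeightOne.rank_le_two_level_47 WeightOne.two_le_rank_level_47,
    le_antisymm WeightOne.rank_le_two_level_52 WeightOne.two_le_rank_level_52,
    le_antisymm WeightOne.rank_le_two_level_57 WeightOne.two_le_rank_level_57⟩
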